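/- arXiv:math/0602252 — 3 statements merged into one kernel-verified Lean document; each statement's English description precedes it below -/
import Mathlib

section
/- Let R be a commutative Noetherian ring, M ∈ D_qc(R), and q a prime of R lying in the specialization closure of Ass H_0(M). Then k(q) (concentrated in homological degree 0) lies in every cocomplete preaisle of D(R) that contains M. -/
open CategoryTheory CategoryTheory.Limits CategoryTheory.Pretriangulated

universe w

section Defs

variable (R : Type) [CommRing R] [HasDerivedCategory.{w} (ModuleCat R)]

/-- The `n`-th homology (homological indexing, so that `H_n (s M) = H_{n-1} M` where
`s = ⟦1⟧`) of an object of the derived category `D(R)` of `R`-modules. -/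
noncomputable def Hh (n : ℤ) (M : DerivedCategory (ModuleCat R)) : ModuleCat R :=
  (DerivedCategory.homologyFunctor (ModuleCat R) (-n)).obj M

/-- The object `s^n M` of `D(R)` given by a module `M` concentrated in homological
degree `n`. -/
noncomputable def sdeg (n : ℤ) (M : ModuleCat R) : DerivedCategory (ModuleCat R) :=
  (DerivedCategory.singleFunctor (ModuleCat R) (-n)).obj M

/-- Membership in `D_qc(R)`: all homology modules are finitely generated over `R`,
and all but finitely many of them vanish. -/
def memDqc (M : DerivedCategory (ModuleCat R)) : Prop :=
  (∀ n : ℤ, Module.Finite R ↥(Hh R n M)) ∧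
    {n : ℤ | ¬ IsZero (Hh R n M)}.Finite

/-- A cocomplete preaisle in `D(R)`: a class of objects closed under isomorphism,
suspension (`s = ⟦1⟧`), extensions, and arbitrary coproducts. -/
structure IsCocompletePreaisle (S : Set (DerivedCategory (ModuleCat R))) : Prop where
  mem_of_iso : ∀ ⦃X Y : DerivedCategory (ModuleCat R)⦄, (X ≅ Y) → X ∈ S → Y ∈ S
  shift_mem : ∀ ⦃X : DerivedCategory (ModuleCat R)⦄, X ∈ S → X⟦(1 : ℤ)⟧ ∈ S
  ext_mem : ∀ ⦃X Y Z : DerivedCategory (ModuleCat R)⦄ (f : X ⟶ Y) (g : Y ⟶ Z)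
    (h : Z ⟶ X⟦(1 : ℤ)⟧),
    (Triangle.mk f g h ∈ distTriang (DerivedCategory (ModuleCat R))) →
    X ∈ S → Z ∈ S → Y ∈ S
  coproduct_mem : ∀ ⦃ι : Type⦄ (X : ι → DerivedCategory (ModuleCat R)) (c : Cofan X),
    IsColimit c → (∀ i, X i ∈ S) → c.pt ∈ S

end Defs



section P1
variable {R : Type} [CommRing R]

lemma sc_quasiIso_iff {S T : ShortComplex (ModuleCat.{0} R)} (φ : S ⟶ T) :
    ShortComplex.QuasiIso φ ↔
      (∀ x : S.X₂, S.g x = 0 → ∀ z, φ.τ₂ x = T.f z → ∃ w, x = S.f w) ∧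
      (∀ y : T.X₂, T.g y = 0 → ∃ x, S.g x = 0 ∧ ∃ z, y = φ.τ₂ x + T.f z) := by
  have key : ∀ x : S.moduleCatLeftHomologyData.K,
      ShortComplex.leftHomologyMap' φ S.moduleCatLeftHomologyData T.moduleCatLeftHomologyData
        (S.moduleCatLeftHomologyData.π x) =
      T.moduleCatLeftHomologyData.π (ShortComplex.cyclesMap' φ S.moduleCatLeftHomologyData
        T.moduleCatLeftHomologyData x) := by
    intro x
    exact ConcreteCategory.congr_hom (ShortComplex.leftHomologyπ_naturality' φ S.moduleCatLeftHomologyData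
        T.moduleCatLeftHomologyData) x
  have key2 : ∀ x : S.moduleCatLeftHomologyData.K,
      (ShortComplex.cyclesMap' φ S.moduleCatLeftHomologyData
        T.moduleCatLeftHomologyData x).1 = φ.τ₂ x.1 := by
    intro x
    exact ConcreteCategory.congr_hom (ShortComplex.cyclesMap'_i φ S.moduleCatLeftHomologyData
        T.moduleCatLeftHomologyData) x
  have pi0 : ∀ (U : ShortComplex (ModuleCat.{0} R)) (x : U.moduleCatLeftHomologyData.K),
      U.moduleCatLeftHomologyData.π x = 0 ↔ ∃ w, x.1 = U.f w := by
    intro U x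
    refine (Submodule.Quotient.mk_eq_zero _).trans ?_
    constructor
    · rintro ⟨w, rfl⟩; exact ⟨w, rfl⟩
    · rintro ⟨w, hw⟩; exact ⟨w, Subtype.ext hw.symm⟩
  have pis : ∀ (U : ShortComplex (ModuleCat.{0} R)) (y : U.moduleCatLeftHomologyData.H),
      ∃ x, U.moduleCatLeftHomologyData.π x = y := fun U y => Submodule.Quotient.mk_surjective _ y
  rw [ShortComplex.quasiIso_iff_isIso_leftHomologyMap' φ S.moduleCatLeftHomologyData
        T.moduleCatLeftHomologyData, ConcreteCategory.isIso_iff_bijective]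
  refine and_congr ?_ ?_
  · rw [injective_iff_map_eq_zero]
    constructor
    · intro h x hx z hz
      obtain ⟨x, rfl⟩ : ∃ x' : S.moduleCatLeftHomologyData.K, x'.1 = x := ⟨⟨x, hx⟩, rfl⟩
      have := h (S.moduleCatLeftHomologyData.π x) (by
        rw [key, pi0]; exact ⟨z, (key2 _).trans hz⟩)
      exact (pi0 _ _).1 this
    · intro h a ha
      obtain ⟨x, rfl⟩ := pis _ a
      rw [key, pi0] at ha
      obtain ⟨z, hz⟩ := ha
      rw [key2] at hz
      exact (pi0 _ _).2 (h x.1 x.2 z hz)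
  · constructor
    · intro h y hy
      obtain ⟨y, rfl⟩ : ∃ x' : T.moduleCatLeftHomologyData.K, x'.1 = y := ⟨⟨y, hy⟩, rfl⟩
      obtain ⟨a, ha⟩ := h (T.moduleCatLeftHomologyData.π y)
      obtain ⟨x, rfl⟩ := pis _ a
      rw [key, ← sub_eq_zero, ← map_sub, pi0] at ha
      obtain ⟨z, hz⟩ := ha
      refine ⟨x.1, x.2, -z, ?_⟩
      have hz' : φ.τ₂ x.1 - y.1 = T.f z := by
        rw [← hz, ← key2]; rfl
      rw [map_neg, ← hz']; abel
    · intro h b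
      obtain ⟨y, rfl⟩ := pis _ b
      obtain ⟨x, hx, z, hz⟩ := h y.1 y.2
      obtain ⟨x, rfl⟩ : ∃ x' : S.moduleCatLeftHomologyData.K, x'.1 = x := ⟨⟨x, hx⟩, rfl⟩
      refine ⟨S.moduleCatLeftHomologyData.π x, ?_⟩
      rw [key, ← sub_eq_zero, ← map_sub, pi0]
      refine ⟨-z, ?_⟩
      have : (((ShortComplex.cyclesMap' φ S.moduleCatLeftHomologyData
        T.moduleCatLeftHomologyData x) - y : T.moduleCatLeftHomologyData.K)).1 = φ.τ₂ x.1 - y.1 := by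
        rw [← key2 x]; rfl
      rw [this, hz, map_neg]; abel

lemma quasiIso_iff_elem {K L : CochainComplex (ModuleCat.{0} R) ℤ} (f : K ⟶ L) :
    QuasiIso f ↔ ∀ i j k : ℤ, i + 1 = j → j + 1 = k →
      (∀ x : K.X j, K.d j k x = 0 → ∀ z, f.f j x = L.d i j z → ∃ w, x = K.d i j w) ∧
      (∀ y : L.X j, L.d j k y = 0 → ∃ x, K.d j k x = 0 ∧ ∃ z, y = f.f j x + L.d i j z) := by
  rw [quasiIso_iff]
  constructor
  · intro h i j k hi hk
    have := h j
    rw [quasiIsoAt_iff' f i j k (by simp; lia) (by simp; lia), sc_quasiIso_iff] at this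
    exact this
  · intro h j
    rw [quasiIsoAt_iff' f (j-1) j (j+1) (by simp) (by simp), sc_quasiIso_iff]
    exact h (j-1) j (j+1) (by simp) rfl

open DirectSum Classical in
noncomputable def dsum {ι : Type} (X : ι → CochainComplex (ModuleCat.{0} R) ℤ) :
    CochainComplex (ModuleCat.{0} R) ℤ where
  X n := ModuleCat.of R (⨁ i, (X i).X n)
  d n m := ModuleCat.ofHom (DirectSum.lmap fun i => ((X i).d n m).hom)
  shape n m h := by
    ext1
    refine DirectSum.linearMap_ext _ fun i => ?_
    ext x
    simp [(X i).shape n m h]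
  d_comp_d' n m k _ _ := by
    ext1
    refine DirectSum.linearMap_ext _ fun i => ?_
    ext x : 1
    have : ((X i).d m k).hom (((X i).d n m).hom x) = 0 :=
      ConcreteCategory.congr_hom ((X i).d_comp_d n m k) x
    simp [this]

open DirectSum Classical in
noncomputable def dsum.inc {ι : Type} (X : ι → CochainComplex (ModuleCat.{0} R) ℤ) (i : ι) :
    X i ⟶ dsum X where
  f n := ModuleCat.ofHom (DirectSum.lof R ι (fun i => (X i).X n) i)
  comm' n m _ := by
    ext x
    exact (DirectSum.lmap_lof (fun i => ((X i).d n m).hom) i x)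

open DirectSum Classical in
noncomputable def dsum.descX {ι : Type} (X : ι → CochainComplex (ModuleCat.{0} R) ℤ)
    {n : ℤ} {Y : ModuleCat.{0} R} (f : ∀ i, (X i).X n ⟶ Y) : (dsum X).X n ⟶ Y :=
  ModuleCat.ofHom (DirectSum.toModule R ι Y (fun i => (f i).hom))

lemma dsum.hom_ext {ι : Type} {X : ι → CochainComplex (ModuleCat.{0} R) ℤ}
    {n : ℤ} {Y : ModuleCat.{0} R} {f g : (dsum X).X n ⟶ Y}
    (h : ∀ i, (dsum.inc X i).f n ≫ f = (dsum.inc X i).f n ≫ g) : f = g := by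
  classical
  ext1
  refine DirectSum.linearMap_ext _ fun i => ?_
  exact congrArg ModuleCat.Hom.hom (h i)

@[simp]
lemma dsum.inc_descX {ι : Type} (X : ι → CochainComplex (ModuleCat.{0} R) ℤ)
    {n : ℤ} {Y : ModuleCat.{0} R} (f : ∀ i, (X i).X n ⟶ Y) (i : ι) :
    (dsum.inc X i).f n ≫ dsum.descX X f = f i := by
  classical
  ext x
  exact DirectSum.toModule_lof (M := fun i => (X i).X n) (N := Y) (φ := fun i => (f i).hom) R i x

noncomputable def dsum.desc {ι : Type} {X : ι → CochainComplex (ModuleCat.{0} R) ℤ}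
    {Y : CochainComplex (ModuleCat.{0} R) ℤ} (f : ∀ i, X i ⟶ Y) : dsum X ⟶ Y where
  f n := dsum.descX X (fun i => (f i).f n)
  comm' n m _ := by
    refine dsum.hom_ext fun i => ?_
    rw [← Category.assoc, ← Category.assoc, dsum.inc_descX, HomologicalComplex.Hom.comm,
      HomologicalComplex.Hom.comm, Category.assoc, dsum.inc_descX]

@[simp]
lemma dsum.inc_desc {ι : Type} {X : ι → CochainComplex (ModuleCat.{0} R) ℤ}
    {Y : CochainComplex (ModuleCat.{0} R) ℤ} (f : ∀ i, X i ⟶ Y) (i : ι) :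
    dsum.inc X i ≫ dsum.desc f = f i := by
  ext n : 1
  simp [dsum.desc]

lemma dsum.cochain_ext {ι : Type} {X : ι → CochainComplex (ModuleCat.{0} R) ℤ}
    {Y : CochainComplex (ModuleCat.{0} R) ℤ} {f g : dsum X ⟶ Y}
    (h : ∀ i, dsum.inc X i ≫ f = dsum.inc X i ≫ g) : f = g := by
  ext n : 1
  refine dsum.hom_ext fun i => ?_
  exact HomologicalComplex.congr_hom (h i) n

noncomputable def dsum.map {ι : Type} {X Y : ι → CochainComplex (ModuleCat.{0} R) ℤ}
    (f : ∀ i, X i ⟶ Y i) : dsum X ⟶ dsum Y := dsum.desc (fun i => f i ≫ dsum.inc Y i)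

open DirectSum in
def dsum.cmp {ι : Type} {X : ι → CochainComplex (ModuleCat.{0} R) ℤ} {n : ℤ}
    (x : (dsum X).X n) (i : ι) : (X i).X n := (show ⨁ i, (X i).X n from x) i

open DirectSum in
lemma dsum.cmp_ext {ι : Type} {X : ι → CochainComplex (ModuleCat.{0} R) ℤ} {n : ℤ}
    {x y : (dsum X).X n} (h : ∀ i, dsum.cmp x i = dsum.cmp y i) : x = y :=
  DFinsupp.ext h

lemma dsum.cmp_add {ι : Type} {X : ι → CochainComplex (ModuleCat.{0} R) ℤ} {n : ℤ}
    (x y : (dsum X).X n) (i : ι) : dsum.cmp (x + y) i = dsum.cmp x i + dsum.cmp y i := rfl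

lemma dsum.cmp_zero {ι : Type} {X : ι → CochainComplex (ModuleCat.{0} R) ℤ} {n : ℤ}
    (i : ι) : dsum.cmp (0 : (dsum X).X n) i = 0 := rfl

open DirectSum in
lemma dsum.cmp_d {ι : Type} {X : ι → CochainComplex (ModuleCat.{0} R) ℤ} {n m : ℤ}
    (x : (dsum X).X n) (i : ι) :
    dsum.cmp ((dsum X).d n m x) i = (X i).d n m (dsum.cmp x i) :=
  DirectSum.lmap_apply (fun i => ((X i).d n m).hom) _ i

open DirectSum Classical in
noncomputable def dsum.mk {ι : Type} (X : ι → CochainComplex (ModuleCat.{0} R) ℤ) {n : ℤ}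
    (s : Finset ι) (x : ∀ i, (X i).X n) : (dsum X).X n :=
  (show ⨁ i, (X i).X n from DFinsupp.mk s (fun i => x i))

open DirectSum Classical in
lemma dsum.cmp_mk {ι : Type} {X : ι → CochainComplex (ModuleCat.{0} R) ℤ} {n : ℤ}
    (s : Finset ι) (x : ∀ i, (X i).X n) (i : ι) : dsum.cmp (dsum.mk X s x) i =
      if i ∈ s then x i else 0 := by
  exact DFinsupp.mk_apply (β := fun i => (X i).X n) (s := s) (x := fun i => x i) (i := i)

open Classical in
lemma dsum.exists_supp {ι : Type} {X : ι → CochainComplex (ModuleCat.{0} R) ℤ} {n : ℤ}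
    (x : (dsum X).X n) : ∃ s : Finset ι, ∀ i, i ∉ s → dsum.cmp x i = 0 :=
  ⟨DFinsupp.support x, fun i hi => by
    by_contra h
    exact hi ((DFinsupp.mem_support_toFun _ _).2 h)⟩

lemma dsum.map_apply {ι : Type} {X Y : ι → CochainComplex (ModuleCat.{0} R) ℤ}
    (f : ∀ i, X i ⟶ Y i) (n : ℤ) (x : (dsum X).X n) (i : ι) :
    dsum.cmp ((dsum.map f).f n x) i = (f i).f n (dsum.cmp x i) := by
  classical
  have : (dsum.map f).f n = ModuleCat.ofHom (DirectSum.lmap fun i => ((f i).f n).hom) := by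
    refine dsum.hom_ext fun i => ?_
    have := HomologicalComplex.congr_hom (dsum.inc_desc (fun i => f i ≫ dsum.inc Y i) i) n
    refine this.trans ?_
    ext x
    exact (DirectSum.lmap_lof (fun i => ((f i).f n).hom) i x).symm
  rw [this]
  exact DirectSum.lmap_apply (fun i => ((f i).f n).hom) _ i

lemma dsum.quasiIso_map {ι : Type} {X Y : ι → CochainComplex (ModuleCat.{0} R) ℤ}
    (f : ∀ i, X i ⟶ Y i) (hf : ∀ i, QuasiIso (f i)) : QuasiIso (dsum.map f) := by
  classical
  rw [quasiIso_iff_elem]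
  intro i j k hi hk
  have h := fun a => (quasiIso_iff_elem (f a)).1 (hf a) i j k hi hk
  constructor
  · intro x hx z hz
    have h1 : ∀ a, ∃ w, dsum.cmp x a = (X a).d i j w := fun a => by
      refine (h a).1 (dsum.cmp x a) ?_ (dsum.cmp z a) ?_
      · rw [← dsum.cmp_d, hx, dsum.cmp_zero]
      · rw [← dsum.map_apply, hz, dsum.cmp_d]
    choose w hw using h1
    obtain ⟨s, hs⟩ := dsum.exists_supp x
    refine ⟨dsum.mk X s w, dsum.cmp_ext fun a => ?_⟩
    rw [dsum.cmp_d, dsum.cmp_mk]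
    split_ifs with ha
    · exact hw a
    · rw [hs a ha, map_zero]
  · intro y hy
    have h1 := fun a => (h a).2 (dsum.cmp y a) (by rw [← dsum.cmp_d, hy, dsum.cmp_zero])
    choose x hx z hz using h1
    obtain ⟨s, hs⟩ := dsum.exists_supp y
    refine ⟨dsum.mk X s x, dsum.cmp_ext fun a => ?_, dsum.mk Y s z, dsum.cmp_ext fun a => ?_⟩
    · rw [dsum.cmp_d, dsum.cmp_mk, dsum.cmp_zero]
      split_ifs with ha
      · exact hx a
      · rw [map_zero]
    · rw [dsum.cmp_add, dsum.cmp_d, dsum.map_apply, dsum.cmp_mk, dsum.cmp_mk]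
      split_ifs with ha
      · exact hz a
      · rw [map_zero, map_zero, hs a ha, add_zero]

noncomputable def dsum.homotopy {ι : Type} {X : ι → CochainComplex (ModuleCat.{0} R) ℤ}
    {Y : CochainComplex (ModuleCat.{0} R) ℤ} (f : ∀ i, X i ⟶ Y) (h : ∀ i, Homotopy (f i) 0) :
    Homotopy (dsum.desc f) 0 where
  hom n m := dsum.descX X (fun i => (h i).hom n m)
  zero n m hnm := dsum.hom_ext fun i => by
    rw [dsum.inc_descX, (h i).zero n m hnm, comp_zero]
  comm n := dsum.hom_ext fun i => by
    have := (h i).comm n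
    have e := HomologicalComplex.congr_hom (dsum.inc_desc f i) n
    rw [HomologicalComplex.comp_f] at e
    rw [e, this]
    simp only [HomologicalComplex.zero_f, add_zero, Preadditive.comp_add, dNext_eq _ (show (ComplexShape.up ℤ).Rel n (n+1) from rfl),
      prevD_eq _ (show (ComplexShape.up ℤ).Rel (n-1) n by simp)]
    rw [← Category.assoc, HomologicalComplex.Hom.comm, ← Category.assoc, dsum.inc_descX,
      Category.assoc, dsum.inc_descX]

variable [HasDerivedCategory.{w} (ModuleCat.{0} R)]
open DerivedCategory

lemma dsum.Q_uniq0 {ι : Type} {X : ι → CochainComplex (ModuleCat.{0} R) ℤ}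
    {Y : CochainComplex (ModuleCat.{0} R) ℤ} (φ : Q.obj (dsum X) ⟶ Q.obj Y)
    (h : ∀ i, Q.map (dsum.inc X i) ≫ φ = 0) : φ = 0 := by
  obtain ⟨Y', g, s, hs, rfl⟩ := left_fac φ
  have h1 : ∀ i, Q.map (dsum.inc X i ≫ g) = 0 := fun i => by
    have := h i
    rw [← Category.assoc, ← Q.map_comp, IsIso.comp_inv_eq, zero_comp] at this
    exact this
  have h2 : ∀ i, ∃ (Z : CochainComplex (ModuleCat.{0} R) ℤ) (t : Z ⟶ X i), QuasiIso t ∧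
      Nonempty (Homotopy (t ≫ dsum.inc X i ≫ g) 0) := fun i => by
    have h3 : Qh.map ((HomotopyCategory.quotient _ _).map (dsum.inc X i ≫ g)) =
        Qh.map ((HomotopyCategory.quotient _ _).map (0 : X i ⟶ Y')) := by
      have := h1 i
      rw [← Q.map_zero] at this
      exact this
    rw [MorphismProperty.map_eq_iff_precomp Qh (HomotopyCategory.quasiIso _ _)] at h3
    obtain ⟨Z, t, ht, e⟩ := h3
    obtain ⟨Z, rfl⟩ := HomotopyCategory.quotient_obj_surjective Z
    obtain ⟨t, rfl⟩ := (HomotopyCategory.quotient _ _).map_surjective t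
    refine ⟨Z, t, ?_, ⟨?_⟩⟩
    · exact (HomotopyCategory.quotient_map_mem_quasiIso_iff t).1 ht
    · rw [← Functor.map_comp, ← Functor.map_comp, comp_zero] at e
      exact HomotopyCategory.homotopyOfEq _ _ e
  choose Z t ht H using h2
  have : IsIso (Q.map (dsum.map t)) := by
    rw [isIso_Q_map_iff_quasiIso]; exact dsum.quasiIso_map t ht
  have e : dsum.map t ≫ g = dsum.desc (fun i => t i ≫ dsum.inc X i ≫ g) := dsum.cochain_ext fun i => by
    rw [dsum.inc_desc, dsum.map, ← Category.assoc, dsum.inc_desc, Category.assoc]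
  have : Q.map g = 0 := by
    rw [← cancel_epi (Q.map (dsum.map t)), ← Q.map_comp, e,
      DerivedCategory.Q_map_eq_of_homotopy _ (dsum.homotopy _ (fun i => (H i).some)), comp_zero, Q.map_zero]
  rw [this, zero_comp]

lemma dsum.Q_exists {ι : Type} {X : ι → CochainComplex (ModuleCat.{0} R) ℤ}
    {Y : CochainComplex (ModuleCat.{0} R) ℤ} (φ : ∀ i, Q.obj (X i) ⟶ Q.obj Y) :
    ∃ ψ : Q.obj (dsum X) ⟶ Q.obj Y, ∀ i, Q.map (dsum.inc X i) ≫ ψ = φ i := by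
  choose X' s hs g e using fun i => right_fac (φ i)
  have : IsIso (Q.map (dsum.map s)) := by
    rw [isIso_Q_map_iff_quasiIso]
    exact dsum.quasiIso_map s (fun i => (isIso_Q_map_iff_quasiIso _ _).1 (hs i))
  refine ⟨inv (Q.map (dsum.map s)) ≫ Q.map (dsum.desc g), fun i => ?_⟩
  rw [e, ← cancel_epi (Q.map (s i)), IsIso.hom_inv_id_assoc, ← dsum.inc_desc g i, Q.map_comp,
    ← Category.assoc, ← Category.assoc, ← Q.map_comp]
  have : s i ≫ dsum.inc X i = dsum.inc X' i ≫ dsum.map s := by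
    rw [dsum.map, dsum.inc_desc]
  rw [this, Q.map_comp, Category.assoc _ _ (inv _), IsIso.hom_inv_id, Category.comp_id]

lemma dsum.mem {S : Set (DerivedCategory (ModuleCat.{0} R))} (hS : IsCocompletePreaisle R S)
    {ι : Type} (X : ι → CochainComplex (ModuleCat.{0} R) ℤ) (h : ∀ i, Q.obj (X i) ∈ S) :
    Q.obj (dsum X) ∈ S := by
  have ex : ∀ (Y : DerivedCategory (ModuleCat.{0} R)) (φ : ∀ i, Q.obj (X i) ⟶ Y),
      ∃ ψ : Q.obj (dsum X) ⟶ Y, ∀ i, Q.map (dsum.inc X i) ≫ ψ = φ i := by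
    intro Y φ
    obtain ⟨ψ, hψ⟩ := dsum.Q_exists (fun i => φ i ≫ (Q.objObjPreimageIso Y).inv)
    refine ⟨ψ ≫ (Q.objObjPreimageIso Y).hom, fun i => ?_⟩
    rw [← Category.assoc, hψ]; simp
  have un : ∀ (Y : DerivedCategory (ModuleCat.{0} R)) (φ : Q.obj (dsum X) ⟶ Y),
      (∀ i, Q.map (dsum.inc X i) ≫ φ = 0) → φ = 0 := by
    intro Y φ hφ
    have := dsum.Q_uniq0 (φ ≫ (Q.objObjPreimageIso Y).inv) (fun i => by
      rw [← Category.assoc, hφ, zero_comp])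
    rw [← cancel_mono (Q.objObjPreimageIso Y).inv, this, zero_comp]
  choose D hD using ex
  refine hS.coproduct_mem (fun i => Q.obj (X i)) (Cofan.mk (Q.obj (dsum X)) (fun i => Q.map (dsum.inc X i)))
    (Cofan.IsColimit.mk _ (fun s => D s.pt s.inj) (fun s j => hD _ _ j) (fun s m hm => ?_)) h
  rw [← sub_eq_zero]
  refine un _ _ fun i => ?_
  rw [Preadditive.comp_sub, hD, sub_eq_zero]
  exact hm i

end P1

section P2
variable {R : Type} [CommRing R]

structure ESES {A B C : CochainComplex (ModuleCat.{0} R) ℤ} (f : A ⟶ B) (g : B ⟶ C) : Prop where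
  inj : ∀ n (x : A.X n), f.f n x = 0 → x = 0
  surj : ∀ n (y : C.X n), ∃ x, g.f n x = y
  zero : ∀ n (x : A.X n), g.f n (f.f n x) = 0
  ker : ∀ n (x : B.X n), g.f n x = 0 → ∃ y, f.f n y = x

lemma ESES.comp {A B C : CochainComplex (ModuleCat.{0} R) ℤ} {f : A ⟶ B} {g : B ⟶ C} (h : ESES f g) :
    f ≫ g = 0 := by
  ext n x
  exact h.zero n x

lemma ESES.shortExact {A B C : CochainComplex (ModuleCat.{0} R) ℤ} {f : A ⟶ B} {g : B ⟶ C}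
    (h : ESES f g) : (ShortComplex.mk f g h.comp).ShortExact := by
  refine HomologicalComplex.shortExact_of_degreewise_shortExact _ fun n => ?_
  refine ModuleCat.shortComplex_shortExact _ ?_ ?_ ?_
  · intro x
    constructor
    · intro hx; exact h.ker n x hx
    · rintro ⟨y, rfl⟩; exact h.zero n y
  · rw [injective_iff_map_eq_zero]
    exact h.inj n
  · exact h.surj n

lemma dsum.induction {ι : Type} {X : ι → CochainComplex (ModuleCat.{0} R) ℤ} {n : ℤ}
    {p : (dsum X).X n → Prop} (h0 : p 0) (h1 : ∀ i x, p ((dsum.inc X i).f n x))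
    (h2 : ∀ x y, p x → p y → p (x + y)) (x) : p x := by
  classical
  exact DirectSum.induction_on x h0 h1 h2

open Classical in
lemma dsum.cmp_inc {ι : Type} {X : ι → CochainComplex (ModuleCat.{0} R) ℤ} {n : ℤ}
    (i j : ι) (x : (X i).X n) : dsum.cmp ((dsum.inc X i).f n x) j = if h : i = j then h ▸ x else 0 := by
  split_ifs with h
  · subst h
    exact DirectSum.of_eq_same (β := fun i => (X i).X n) i x
  · exact DirectSum.of_eq_of_ne (β := fun i => (X i).X n) i j x (Ne.symm h)

lemma dsum.desc_inc_apply {ι : Type} {X : ι → CochainComplex (ModuleCat.{0} R) ℤ}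
    {Y : CochainComplex (ModuleCat.{0} R) ℤ} (f : ∀ i, X i ⟶ Y) (i : ι) (n : ℤ) (x : (X i).X n) :
    (dsum.desc f).f n ((dsum.inc X i).f n x) = (f i).f n x :=
  ConcreteCategory.congr_hom (HomologicalComplex.congr_hom (dsum.inc_desc f i) n) x

section
variable {X : ℕ → CochainComplex (ModuleCat.{0} R) ℤ}

noncomputable def telMap (t : ∀ n, X n ⟶ X (n+1)) : dsum X ⟶ dsum X :=
  dsum.desc (fun n => dsum.inc X n - t n ≫ dsum.inc X (n+1))

lemma telMap_inc (t : ∀ n, X n ⟶ X (n+1)) (n : ℕ) (j : ℤ) (x : (X n).X j) :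
    (telMap t).f j ((dsum.inc X n).f j x) =
      (dsum.inc X n).f j x - (dsum.inc X (n+1)).f j ((t n).f j x) := by
  rw [telMap, dsum.desc_inc_apply]; rfl

lemma telMap_cmp_zero (t : ∀ n, X n ⟶ X (n+1)) (j : ℤ) (x : (dsum X).X j) :
    dsum.cmp ((telMap t).f j x) 0 = dsum.cmp x 0 := by
  induction x using dsum.induction with
  | h0 => rw [map_zero]
  | h2 x y hx hy => rw [map_add, dsum.cmp_add, hx, hy, dsum.cmp_add]
  | h1 i x =>
    rw [telMap_inc, sub_eq_add_neg, dsum.cmp_add, ← map_neg, dsum.cmp_inc (i+1), dif_neg (by simp), add_zero]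

lemma telMap_cmp_succ (t : ∀ n, X n ⟶ X (n+1)) (j : ℤ) (x : (dsum X).X j) (n : ℕ) :
    dsum.cmp ((telMap t).f j x) (n+1) = dsum.cmp x (n+1) - (t n).f j (dsum.cmp x n) := by
  induction x using dsum.induction with
  | h0 => rw [map_zero, dsum.cmp_zero, dsum.cmp_zero, map_zero, sub_zero]
  | h2 x y hx hy => rw [map_add, dsum.cmp_add, hx, hy, dsum.cmp_add, dsum.cmp_add, map_add]; abel
  | h1 i x =>
    rw [telMap_inc, sub_eq_add_neg, dsum.cmp_add, ← map_neg, dsum.cmp_inc (i+1), dsum.cmp_inc i n]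
    by_cases h : i = n
    · subst h; simp [sub_eq_add_neg]
    · simp [h]

end

variable [HasDerivedCategory.{w} (ModuleCat.{0} R)]
open DerivedCategory ZeroObject

lemma ESES.mem_mid {S : Set (DerivedCategory (ModuleCat.{0} R))} (hS : IsCocompletePreaisle R S)
    {A B C : CochainComplex (ModuleCat.{0} R) ℤ} {f : A ⟶ B} {g : B ⟶ C}
    (h : ESES f g) (hA : Q.obj A ∈ S) (hC : Q.obj C ∈ S) : Q.obj B ∈ S :=
  hS.ext_mem _ _ _ (triangleOfSES_distinguished h.shortExact) hA hC

lemma tri_mem_right {S : Set (DerivedCategory (ModuleCat.{0} R))} (hS : IsCocompletePreaisle R S)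
    (T : Triangle (DerivedCategory (ModuleCat.{0} R))) (hT : T ∈ distTriang _)
    (hA : T.obj₁ ∈ S) (hB : T.obj₂ ∈ S) : T.obj₃ ∈ S :=
  hS.ext_mem _ _ _ (rot_of_distTriang _ hT) hB (hS.shift_mem hA)

lemma ESES.mem_right {S : Set (DerivedCategory (ModuleCat.{0} R))} (hS : IsCocompletePreaisle R S)
    {A B C : CochainComplex (ModuleCat.{0} R) ℤ} {f : A ⟶ B} {g : B ⟶ C}
    (h : ESES f g) (hA : Q.obj A ∈ S) (hB : Q.obj B ∈ S) : Q.obj C ∈ S :=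
  tri_mem_right hS _ (triangleOfSES_distinguished h.shortExact) hA hB

lemma ESES.iso_of_acyclic
    {A B C : CochainComplex (ModuleCat.{0} R) ℤ} {f : A ⟶ B} {g : B ⟶ C}
    (h : ESES f g) (hB : IsZero (Q.obj B)) : Nonempty (Q.obj C ≅ (Q.obj A)⟦(1:ℤ)⟧) := by
  have : IsIso (triangleOfSESδ h.shortExact) :=
    (Triangle.isZero₂_iff_isIso₃ _ (triangleOfSES_distinguished h.shortExact)).1 hB
  exact ⟨asIso (triangleOfSESδ h.shortExact)⟩

lemma isZero_Q_of_exact (B : CochainComplex (ModuleCat.{0} R) ℤ)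
    (h : ∀ i j k : ℤ, i + 1 = j → j + 1 = k → ∀ x : B.X j, B.d j k x = 0 → ∃ w, B.d i j w = x) :
    IsZero (Q.obj B) := by
  have : QuasiIso (0 : B ⟶ 0) := by
    rw [quasiIso_iff_elem]
    intro i j k hi hk
    constructor
    · intro x hx z hz
      obtain ⟨w, hw⟩ := h i j k hi hk x hx
      exact ⟨w, hw.symm⟩
    · intro y hy
      refine ⟨0, map_zero _, 0, ?_⟩
      exact ((ModuleCat.isZero_iff_subsingleton).1 ((HomologicalComplex.eval (ModuleCat.{0} R) (ComplexShape.up ℤ) j).map_isZero (isZero_zero _))).elim _ _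
  have := (isIso_Q_map_iff_quasiIso _ (0 : B ⟶ 0)).2 this
  exact (Q.map_isZero (isZero_zero _)).of_iso (asIso (Q.map (0 : B ⟶ 0)))

lemma tel_mem {X : ℕ → CochainComplex (ModuleCat.{0} R) ℤ} {S : Set (DerivedCategory (ModuleCat.{0} R))} (hS : IsCocompletePreaisle R S)
    {Y : CochainComplex (ModuleCat.{0} R) ℤ} (t : ∀ n, X n ⟶ X (n+1)) (p : ∀ n, X n ⟶ Y)
    (hp : ∀ n, t n ≫ p (n+1) = p n)
    (hs : ∀ j (y : Y.X j), ∃ n x, (p n).f j x = y)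
    (hk : ∀ n j (x : (X n).X j), (p n).f j x = 0 → (t n).f j x = 0)
    (hX : ∀ n, Q.obj (X n) ∈ S) : Q.obj Y ∈ S := by
  have hp' : ∀ n j x, (p (n+1)).f j ((t n).f j x) = (p n).f j x := fun n j x =>
    ConcreteCategory.congr_hom (HomologicalComplex.congr_hom (hp n) j) x
  have push : ∀ j k n (a : (X n).X j), ∃ (b : (X (n+k)).X j) (z : (dsum X).X j),
      (dsum.inc X n).f j a = (dsum.inc X (n+k)).f j b + (telMap t).f j z := by
    intro j k
    induction k with
    | zero => intro n a; exact ⟨a, 0, by simp⟩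
    | succ k ih =>
      intro n a
      obtain ⟨b, z, hb⟩ := ih n a
      refine ⟨(t _).f j b, z + (dsum.inc X (n+k)).f j b, ?_⟩
      rw [map_add, telMap_inc, hb]
      change _ = (dsum.inc X (n+k+1)).f j ((t (n+k)).f j b) + _
      abel
  have main : ∀ j (x : (dsum X).X j), ∃ N0, ∀ N, N0 ≤ N → ∃ (b : (X N).X j) (z : (dsum X).X j),
      x = (dsum.inc X N).f j b + (telMap t).f j z := by
    intro j x
    induction x using dsum.induction with
    | h0 => exact ⟨0, fun N _ => ⟨0, 0, by simp⟩⟩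
    | h2 x y hx hy =>
      obtain ⟨N0, h0⟩ := hx
      obtain ⟨N1, h1⟩ := hy
      refine ⟨max N0 N1, fun N hN => ?_⟩
      obtain ⟨b, z, e⟩ := h0 N (by lia)
      obtain ⟨b', z', e'⟩ := h1 N (by lia)
      refine ⟨b + b', z + z', ?_⟩
      rw [e, e', map_add, map_add]; abel
    | h1 i x =>
      refine ⟨i, fun N hN => ?_⟩
      obtain ⟨k, rfl⟩ := Nat.exists_eq_add_of_le hN
      exact push j k i x
  have z0 : ∀ j z, (dsum.desc p).f j ((telMap t).f j z) = 0 := by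
    intro j z
    induction z using dsum.induction with
    | h0 => simp
    | h2 x y hx hy => rw [map_add, map_add, hx, hy, add_zero]
    | h1 i x => rw [telMap_inc, map_sub, dsum.desc_inc_apply, dsum.desc_inc_apply, hp', sub_self]
  have : ESES (telMap t) (dsum.desc p) :=
    { inj := by
        intro j x hx
        refine dsum.cmp_ext fun n => ?_
        rw [dsum.cmp_zero]
        induction n with
        | zero => rw [← telMap_cmp_zero t, hx, dsum.cmp_zero]
        | succ n ih =>
          have := telMap_cmp_succ t j x n
          rw [hx, dsum.cmp_zero, ih, map_zero, sub_zero] at this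
          exact this.symm
      surj := by
        intro j y
        obtain ⟨n, x, rfl⟩ := hs j y
        exact ⟨(dsum.inc X n).f j x, dsum.desc_inc_apply _ _ _ _⟩
      zero := z0
      ker := by
        intro j x hx
        obtain ⟨N, h⟩ := main j x
        obtain ⟨b, z, rfl⟩ := h N le_rfl
        rw [map_add, z0, add_zero, dsum.desc_inc_apply] at hx
        refine ⟨(dsum.inc X N).f j b + z, ?_⟩
        rw [map_add, telMap_inc, hk _ _ _ hx, map_zero, sub_zero] }
  exact this.mem_right hS (dsum.mem hS X hX) (dsum.mem hS X hX)

lemma retract_mem {S : Set (DerivedCategory (ModuleCat.{0} R))} (hS : IsCocompletePreaisle R S)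
    {Y Z : CochainComplex (ModuleCat.{0} R) ℤ} (i : Y ⟶ Z) (r : Z ⟶ Y) (h : i ≫ r = 𝟙 _)
    (hZ : Q.obj Z ∈ S) : Q.obj Y ∈ S := by
  refine tel_mem hS (X := fun _ => Z) (fun _ => r ≫ i) (fun _ => r) (fun _ => by simp [h]) ?_ ?_
    (fun _ => hZ)
  · intro j y
    refine ⟨0, i.f j y, ?_⟩
    exact ConcreteCategory.congr_hom (HomologicalComplex.congr_hom h j) y
  · intro n j x hx
    have : (r ≫ i).f j x = i.f j (r.f j x) := rfl
    rw [this, hx, map_zero]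

end P2

section P3
variable {R : Type} [CommRing R]

lemma cochain_comp_apply {A B C : CochainComplex (ModuleCat.{0} R) ℤ} (f : A ⟶ B) (g : B ⟶ C) (j : ℤ)
    (x : A.X j) : (f ≫ g).f j x = g.f j (f.f j x) := rfl

lemma cochain_d_apply {A B : CochainComplex (ModuleCat.{0} R) ℤ} (f : A ⟶ B) (j k : ℤ)
    (x : A.X j) : f.f k (A.d j k x) = B.d j k (f.f j x) :=
  (ConcreteCategory.congr_hom (f.comm j k) x).symm

lemma ESES.of_shortExact (T : ShortComplex (CochainComplex (ModuleCat.{0} R) ℤ)) (h : T.ShortExact) :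
    ESES T.f T.g := by
  have h' := (HomologicalComplex.shortExact_iff_degreewise_shortExact T).1 h
  refine ⟨?_, ?_, ?_, ?_⟩
  · intro n
    exact (injective_iff_map_eq_zero ((T.f.f n).hom)).1 (h' n).moduleCat_injective_f
  · intro n
    exact (h' n).moduleCat_surjective_g
  · intro n x
    exact ((T.map (HomologicalComplex.eval _ _ n)).moduleCat_zero_apply x)
  · intro n x hx
    exact (ShortComplex.moduleCat_exact_iff _).1 (h' n).exact x hx

lemma ESES.cokernel {A B : CochainComplex (ModuleCat.{0} R) ℤ} (f : A ⟶ B)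
    (hf : ∀ n x, f.f n x = 0 → x = 0) : ESES f (cokernel.π f) := by
  have : ∀ n, Mono (f.f n) := fun n => by
    rw [ModuleCat.mono_iff_injective]
    exact (injective_iff_map_eq_zero ((f.f n).hom)).2 (hf n)
  have : Mono f := HomologicalComplex.mono_of_mono_f f this
  exact ESES.of_shortExact (ShortComplex.mk f (cokernel.π f) (cokernel.condition f))
    { exact := ShortComplex.exact_cokernel f }

def seqComp (B : ℕ → CochainComplex (ModuleCat.{0} R) ℤ) (t : ∀ n, B n ⟶ B (n+1)) :
    ∀ n, B 0 ⟶ B n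
  | 0 => 𝟙 _
  | n + 1 => seqComp B t n ≫ t n

lemma exists_colimit (B : ℕ → CochainComplex (ModuleCat.{0} R) ℤ) (t : ∀ n, B n ⟶ B (n+1))
    (ht : ∀ n j x, (t n).f j x = 0 → x = 0) :
    ∃ (Y : CochainComplex (ModuleCat.{0} R) ℤ) (p : ∀ n, B n ⟶ Y),
      (∀ n, t n ≫ p (n+1) = p n) ∧ (∀ j (y : Y.X j), ∃ n x, (p n).f j x = y) ∧
      (∀ n j x, (p n).f j x = 0 → x = 0) := by
  let F := Functor.ofSequence t
  have inj : ∀ (k n j) (x : (B n).X j), (F.map (homOfLE (Nat.le_add_right n k))).f j x = 0 → x = 0 := by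
    intro k
    induction k with
    | zero =>
      intro n j x hx
      have : (homOfLE (Nat.le_add_right n 0)) = 𝟙 n := rfl
      rw [this, F.map_id] at hx
      exact hx
    | succ k ih =>
      intro n j x hx
      have : (homOfLE (Nat.le_add_right n (k+1))) = homOfLE (Nat.le_add_right n k) ≫
        homOfLE (Nat.le_add_right (n+k) 1) := rfl
      rw [this, F.map_comp, Functor.ofSequence_map_homOfLE_succ] at hx
      exact ih _ _ _ (ht _ _ _ hx)
  have hc := fun j => isColimitOfPreserves (HomologicalComplex.eval (ModuleCat.{0} R) (ComplexShape.up ℤ) j)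
    (colimit.isColimit F)
  refine ⟨colimit F, fun n => colimit.ι F n, ?_, ?_, ?_⟩
  · intro n
    have := colimit.w F (homOfLE (Nat.le_add_right n 1))
    rwa [Functor.ofSequence_map_homOfLE_succ] at this
  · intro j y
    obtain ⟨n, x, hx⟩ := Concrete.isColimit_exists_rep _ (hc j) y
    exact ⟨n, x, hx⟩
  · intro n j x hx
    obtain ⟨m, f, g, e⟩ := Concrete.isColimit_exists_of_rep_eq _ (hc j) x (0 : (B n).X j)
      (hx.trans (map_zero _).symm)
    obtain ⟨k, rfl⟩ := Nat.exists_eq_add_of_le (leOfHom f)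
    refine inj k n j x ?_
    have e' : (F.map f).f j x = (F.map g).f j 0 := e
    rw [map_zero] at e'
    exact e'

variable [HasDerivedCategory.{w} (ModuleCat.{0} R)]
open DerivedCategory ZeroObject

lemma zero_mem {S : Set (DerivedCategory (ModuleCat.{0} R))} (hS : IsCocompletePreaisle R S)
    {Z : DerivedCategory (ModuleCat.{0} R)} (hZ : IsZero Z) : Z ∈ S := by
  refine hS.coproduct_mem (ι := PEmpty) (fun i => i.elim) (Cofan.mk Z (fun i => i.elim))
    (Cofan.IsColimit.mk _ (fun s => 0) (fun s j => j.elim) (fun s m hm => hZ.eq_of_src _ _)) (fun i => i.elim)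

lemma tower_mem {S : Set (DerivedCategory (ModuleCat.{0} R))} (hS : IsCocompletePreaisle R S)
    (B : ℕ → CochainComplex (ModuleCat.{0} R) ℤ) (t : ∀ n, B n ⟶ B (n+1))
    (D : ℕ → CochainComplex (ModuleCat.{0} R) ℤ) (g : ∀ n, B (n+1) ⟶ D n)
    (ht : ∀ n, ESES (t n) (g n)) (hD : ∀ n, Q.obj (D n) ∈ S)
    (hB : ∀ j : ℤ, ∃ N, ∀ n, N ≤ n → ∀ i k : ℤ, i + 1 = j → j + 1 = k →
      ∀ x : (B n).X j, (B n).d j k x = 0 → ∃ w, (B n).d i j w = x) :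
    (Q.obj (B 0))⟦(1:ℤ)⟧ ∈ S := by
  obtain ⟨Y, p, hp, hps, hpi⟩ := exists_colimit B t (fun n => (ht n).inj)
  have hp' : ∀ n j x, (p (n+1)).f j ((t n).f j x) = (p n).f j x := fun n j x =>
    ConcreteCategory.congr_hom (HomologicalComplex.congr_hom (hp n) j) x
  have push : ∀ k n j x, ∃ x', (p (n + k)).f j x' = (p n).f j x := by
    intro k
    induction k with
    | zero => intro n j x; exact ⟨x, rfl⟩
    | succ k ih =>
      intro n j x
      obtain ⟨x', h⟩ := ih n j x
      exact ⟨(t (n+k)).f j x', (hp' _ _ _).trans h⟩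
  have hY : IsZero (Q.obj Y) := by
    refine isZero_Q_of_exact Y ?_
    intro i j k hi hk x hx
    obtain ⟨n, y, rfl⟩ := hps j x
    obtain ⟨N, hN⟩ := hB j
    obtain ⟨y', hy'⟩ := push N n j y
    rw [← hy'] at hx ⊢
    rw [← cochain_d_apply] at hx
    obtain ⟨w, rfl⟩ := hN (n+N) (by lia) i k hi hk y' (hpi _ _ _ hx)
    exact ⟨(p (n+N)).f i w, (cochain_d_apply _ _ _ _).symm⟩
  let a : ∀ n, B 0 ⟶ B n := seqComp B t
  have ha : ∀ n, a (n+1) = a n ≫ t n := fun n => rfl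
  have hap : ∀ n, a n ≫ p n = p 0 := by
    intro n
    induction n with
    | zero => exact Category.id_comp _
    | succ n ih => rw [ha, Category.assoc, hp, ih]
  have hap' : ∀ n j x, (p n).f j ((a n).f j x) = (p 0).f j x := fun n j x =>
    ConcreteCategory.congr_hom (HomologicalComplex.congr_hom (hap n) j) x
  have hai : ∀ n j x, (a n).f j x = 0 → x = 0 := by
    intro n j x hx
    apply hpi 0 j x
    rw [← hap' n, hx, map_zero]
  have E : ∀ n : ℕ, ESES (a n) (cokernel.π (a n)) := fun n => ESES.cokernel (a n) (hai n)
  have E0 := ESES.cokernel (p 0) (hpi 0)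
  let u : ∀ n : ℕ, cokernel (a n) ⟶ cokernel (a (n+1)) := fun n =>
    cokernel.desc (a n) (t n ≫ cokernel.π (a (n+1))) (by
      rw [← Category.assoc, ← ha, cokernel.condition])
  let v : ∀ n : ℕ, cokernel (a n) ⟶ cokernel (p 0) := fun n =>
    cokernel.desc (a n) (p n ≫ cokernel.π (p 0)) (by
      rw [← Category.assoc, hap, cokernel.condition])
  let y : ∀ n : ℕ, cokernel (a (n+1)) ⟶ D n := fun n =>
    cokernel.desc (a (n+1)) (g n) (by rw [ha, Category.assoc, (ht n).comp, comp_zero])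
  have hu : ∀ n j x, (u n).f j ((cokernel.π (a n)).f j x) = (cokernel.π (a (n+1))).f j ((t n).f j x) := by
    intro n j x
    exact ConcreteCategory.congr_hom (HomologicalComplex.congr_hom (cokernel.π_desc (a n) (t n ≫ cokernel.π (a (n+1))) _) j) x
  have hv : ∀ n j x, (v n).f j ((cokernel.π (a n)).f j x) = (cokernel.π (p 0)).f j ((p n).f j x) := by
    intro n j x
    exact ConcreteCategory.congr_hom (HomologicalComplex.congr_hom (cokernel.π_desc (a n) (p n ≫ cokernel.π (p 0)) _) j) x
  have hy : ∀ n j x, (y n).f j ((cokernel.π (a (n+1))).f j x) = (g n).f j x := by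
    intro n j x
    exact ConcreteCategory.congr_hom (HomologicalComplex.congr_hom (cokernel.π_desc (a (n+1)) (g n) _) j) x
  have EC : ∀ n, ESES (u n) (y n) := by
    intro n
    refine ⟨?_, ?_, ?_, ?_⟩
    · intro j x hx
      obtain ⟨b, rfl⟩ := (E n).surj j x
      rw [hu] at hx
      obtain ⟨c, hc⟩ := (E (n+1)).ker _ _ hx
      rw [ha, cochain_comp_apply, ← sub_eq_zero, ← map_sub] at hc
      have := (ht n).inj _ _ hc
      rw [← sub_eq_zero.1 this, (E n).zero]
    · intro j x
      obtain ⟨b, rfl⟩ := (ht n).surj j x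
      exact ⟨_, hy n j b⟩
    · intro j x
      obtain ⟨b, rfl⟩ := (E n).surj j x
      rw [hu, hy, (ht n).zero]
    · intro j x hx
      obtain ⟨b, rfl⟩ := (E (n+1)).surj j x
      rw [hy] at hx
      obtain ⟨c, rfl⟩ := (ht n).ker _ _ hx
      exact ⟨_, hu n j c⟩
  have hC : ∀ n, Q.obj (cokernel (a n)) ∈ S := by
    intro n
    induction n with
    | zero => exact zero_mem hS (Q.map_isZero (isZero_cokernel_of_epi (𝟙 (B 0))))
    | succ n ih => exact (EC n).mem_mid hS ih (hD n)
  have hCinf : Q.obj (cokernel (p 0)) ∈ S := by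
    refine tel_mem hS u v ?_ ?_ ?_ hC
    · intro n
      rw [← cancel_epi (cokernel.π (a n))]
      simp only [u, v, cokernel.π_desc, cokernel.π_desc_assoc, Category.assoc]
      rw [← Category.assoc, hp]
    · intro j x
      obtain ⟨b, rfl⟩ := E0.surj j x
      obtain ⟨n, c, rfl⟩ := hps j b
      exact ⟨n, _, hv n j c⟩
    · intro n j x hx
      obtain ⟨b, rfl⟩ := (E n).surj j x
      rw [hv] at hx
      obtain ⟨c, hc⟩ := E0.ker _ _ hx
      rw [← hap' n, ← sub_eq_zero, ← map_sub] at hc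
      have := hpi _ _ _ hc
      rw [← sub_eq_zero.1 this, (E n).zero, map_zero]
  obtain ⟨e⟩ := E0.iso_of_acyclic hY
  exact hS.mem_of_iso e hCinf

end P3

section P4
variable {R : Type} [CommRing R]
variable [HasDerivedCategory.{w} (ModuleCat.{0} R)]
open DerivedCategory ZeroObject

lemma tower_step {S : Set (DerivedCategory (ModuleCat.{0} R))} (hS : IsCocompletePreaisle R S)
    (B : CochainComplex (ModuleCat.{0} R) ℤ) (T : Triangle (DerivedCategory (ModuleCat.{0} R)))
    (hT : T ∈ distTriang _) (e : Q.obj B ≅ T.obj₂) (h1 : T.obj₁⟦(1:ℤ)⟧ ∈ S) :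
    ∃ (B' : CochainComplex (ModuleCat.{0} R) ℤ) (t : B ⟶ B') (D : CochainComplex (ModuleCat.{0} R) ℤ)
      (g : B' ⟶ D), ESES t g ∧ Q.obj D ∈ S ∧ Nonempty (Q.obj B' ≅ T.obj₃) := by
  obtain ⟨A, s, hs, g, hg⟩ := right_fac ((Q.objObjPreimageIso T.obj₁).hom ≫ T.mor₁ ≫ e.inv)
  have inj : ∀ n x, (CochainComplex.mappingCone.inr g).f n x = 0 → x = 0 := by
    intro n x hx
    have := ConcreteCategory.congr_hom (CochainComplex.mappingCone.inr_f_snd_v g n) x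
    rw [ConcreteCategory.comp_apply, hx, map_zero] at this
    exact this.symm
  have E := ESES.cokernel (CochainComplex.mappingCone.inr g) inj
  let eA : Q.obj A ≅ T.obj₁ := asIso (Q.map s) ≪≫ Q.objObjPreimageIso T.obj₁
  have tri := mappingCone_triangle_distinguished g
  let i1 := isoTriangleOfIso₁₂ _ _ tri hT eA e (by
    have h2 : Q.map s ≫ (Q.objObjPreimageIso T.obj₁).hom ≫ T.mor₁ = Q.map g ≫ e.hom := by
      rw [← cancel_mono e.inv]
      simp only [Category.assoc, e.hom_inv_id, Category.comp_id]
      rw [hg, IsIso.hom_inv_id_assoc]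
    refine Eq.trans h2.symm ?_
    exact (Category.assoc _ _ _).symm)
  refine ⟨CochainComplex.mappingCone g, CochainComplex.mappingCone.inr g, _, _, E, ?_, ⟨Triangle.π₃.mapIso i1⟩⟩
  let i2 := isoTriangleOfIso₁₂ _ _ (triangleOfSES_distinguished E.shortExact)
    (rot_of_distTriang _ tri) (Iso.refl _) (Iso.refl _) (by
      exact (Category.comp_id _).trans (Category.id_comp _).symm)
  have i3 : Q.obj (cokernel (CochainComplex.mappingCone.inr g)) ≅ (Q.obj A)⟦(1:ℤ)⟧ := Triangle.π₃.mapIso i2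
  exact hS.mem_of_iso (i3 ≪≫ (shiftFunctor _ (1:ℤ)).mapIso eA).symm h1

lemma exact_of_isLE (B : CochainComplex (ModuleCat.{0} R) ℤ) (c : ℤ) (hB : (Q.obj B).IsLE c)
    (i j k : ℤ) (hi : i + 1 = j) (hk : j + 1 = k) (hc : c < j) (x : B.X j) (hx : B.d j k x = 0) :
    ∃ w, B.d i j w = x := by
  rw [isLE_Q_obj_iff, CochainComplex.isLE_iff] at hB
  have := hB j hc
  rw [HomologicalComplex.exactAt_iff' _ i j k (by simp; lia) (by simp; lia),
    ShortComplex.moduleCat_exact_iff] at this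
  exact this x hx

lemma Dtower {S : Set (DerivedCategory (ModuleCat.{0} R))} (hS : IsCocompletePreaisle R S)
    (K : ℕ → DerivedCategory (ModuleCat.{0} R)) (T : ℕ → Triangle (DerivedCategory (ModuleCat.{0} R)))
    (hT : ∀ n, T n ∈ distTriang _) (e2 : ∀ n, K n ≅ (T n).obj₂) (e3 : ∀ n, (T n).obj₃ ≅ K (n+1))
    (h1 : ∀ n, (T n).obj₁⟦(1:ℤ)⟧ ∈ S)
    (hK : ∀ j : ℤ, ∃ N, ∀ n, N ≤ n → ∃ c, c < j ∧ (K n).IsLE c) : (K 0)⟦(1:ℤ)⟧ ∈ S := by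
  have step := fun (n : ℕ) (B : {B : CochainComplex (ModuleCat.{0} R) ℤ // Nonempty (Q.obj B ≅ K n)}) =>
    tower_step hS B.1 (T n) (hT n) (B.2.some ≪≫ e2 n) (h1 n)
  choose B' t D g hE hD hB' using step
  let B : ∀ n, {B : CochainComplex (ModuleCat.{0} R) ℤ // Nonempty (Q.obj B ≅ K n)} := fun n =>
    Nat.rec ⟨_, ⟨Q.objObjPreimageIso (K 0)⟩⟩ (fun n b => ⟨B' n b, ⟨(hB' n b).some ≪≫ e3 n⟩⟩) n
  have := tower_mem hS (fun n => (B n).1) (fun n => t n (B n)) (fun n => D n (B n)) (fun n => g n (B n))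
    (fun n => hE n (B n)) (fun n => hD n (B n)) (by
      intro j
      obtain ⟨N, hN⟩ := hK j
      refine ⟨N, fun n hn i k hi hk x hx => ?_⟩
      obtain ⟨c, hc, hc'⟩ := hN n hn
      exact exact_of_isLE _ c (TStructure.t.isLE_of_iso (B n).2.some.symm c) i j k hi hk hc x hx)
  exact hS.mem_of_iso ((shiftFunctor _ (1:ℤ)).mapIso (Q.objObjPreimageIso (K 0))) this

lemma shift_nat_mem {S : Set (DerivedCategory (ModuleCat.{0} R))} (hS : IsCocompletePreaisle R S)
    (X : DerivedCategory (ModuleCat.{0} R)) (hX : X ∈ S) (n : ℕ) : X⟦(n:ℤ)⟧ ∈ S := by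
  induction n with
  | zero => exact hS.mem_of_iso ((shiftFunctorZero' _ _ (by simp)).symm.app X) hX
  | succ n ih =>
    exact hS.mem_of_iso ((shiftFunctorAdd' _ (n:ℤ) 1 ((n+1 : ℕ):ℤ) (by simp)).symm.app X) (hS.shift_mem ih)

lemma Rtower {S : Set (DerivedCategory (ModuleCat.{0} R))} (hS : IsCocompletePreaisle R S)
    (K : ℕ → DerivedCategory (ModuleCat.{0} R)) (T : ℕ → Triangle (DerivedCategory (ModuleCat.{0} R)))
    (hT : ∀ n, T n ∈ distTriang _) (e1 : ∀ n, (T n).obj₁ = K (n+1)) (e3 : ∀ n, (T n).obj₃ = K n)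
    (h2 : ∀ n, (T n).obj₂ ∈ S) (b : ℤ)
    (hK : ∀ n, (K n).IsLE b) : K 0 ∈ S := by
  have := Dtower hS (fun n => (K n)⟦(n:ℤ) - 1⟧)
    (fun n => ((Triangle.shiftFunctor _ ((n:ℤ) - 1)).obj (T n)).rotate)
    (fun n => rot_of_distTriang _ (Triangle.shift_distinguished _ (hT n) _))
    (fun n => (shiftFunctor _ ((n:ℤ) - 1)).mapIso (eqToIso (e3 n).symm))
    (fun n => (shiftFunctor _ (1:ℤ)).mapIso ((shiftFunctor _ ((n:ℤ) - 1)).mapIso (eqToIso (e1 n))) ≪≫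
      (shiftFunctorAdd' _ ((n:ℤ) - 1) 1 (((n+1 : ℕ):ℤ) - 1) (by push_cast; ring)).symm.app _)
    (fun n => hS.mem_of_iso ((shiftFunctorAdd' _ ((n:ℤ) - 1) 1 (n : ℤ) (by ring)).app _)
      (shift_nat_mem hS _ (h2 n) n))
    (by
      intro j
      refine ⟨(b - j + 2).toNat, fun n hn => ⟨b - (n - 1), by lia, ?_⟩⟩
      have := hK n
      exact TStructure.t.isLE_shift (K n) b _ _ (by lia))
  refine hS.mem_of_iso (?_ : ((K 0)⟦((0:ℕ):ℤ) - 1⟧)⟦(1:ℤ)⟧ ≅ K 0) this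
  exact (shiftFunctorAdd' _ (((0:ℕ):ℤ) - 1) 1 0 (by simp)).symm.app _ ≪≫ (shiftFunctorZero _ _).app _

end P4

section P5
variable {R : Type} [CommRing R]
open TensorProduct

noncomputable def tens (P : CochainComplex (ModuleCat.{0} R) ℤ) (X : Type) [AddCommGroup X] [Module R X] :
    CochainComplex (ModuleCat.{0} R) ℤ where
  X n := ModuleCat.of R (P.X n ⊗[R] X)
  d n m := ModuleCat.ofHom (LinearMap.rTensor X (P.d n m).hom)
  shape n m h := by
    rw [P.shape n m h]
    ext1
    simp
  d_comp_d' n m k _ _ := by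
    rw [← ModuleCat.ofHom_comp, ← LinearMap.rTensor_comp, ← ModuleCat.hom_comp, P.d_comp_d]
    ext1
    simp

noncomputable def tensMap (P : CochainComplex (ModuleCat.{0} R) ℤ) {X Y : Type} [AddCommGroup X] [Module R X]
    [AddCommGroup Y] [Module R Y] (f : X →ₗ[R] Y) : tens P X ⟶ tens P Y where
  f n := ModuleCat.ofHom (LinearMap.lTensor (P.X n) f)
  comm' n m _ := by
    ext1
    exact (LinearMap.rTensor_comp_lTensor _ _ _).trans (LinearMap.lTensor_comp_rTensor _ _ _).symm

lemma tens_eses (P : CochainComplex (ModuleCat.{0} R) ℤ) (hP : ∀ n, Module.Flat R (P.X n))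
    {X Y Z : Type} [AddCommGroup X] [Module R X]
    [AddCommGroup Y] [Module R Y] [AddCommGroup Z] [Module R Z] (f : X →ₗ[R] Y) (g : Y →ₗ[R] Z)
    (hf : Function.Injective f) (hg : Function.Surjective g) (hfg : Function.Exact f g) :
    ESES (tensMap P f) (tensMap P g) where
  inj n := (injective_iff_map_eq_zero (LinearMap.lTensor (P.X n) f)).1
    (Module.Flat.lTensor_preserves_injective_linearMap f hf)
  surj n := LinearMap.lTensor_surjective (P.X n) hg
  zero n x := (lTensor_exact (P.X n) hfg hg).apply_apply_eq_zero x
  ker n x hx := (lTensor_exact (P.X n) hfg hg x).1 hx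

open Classical in
noncomputable def tensFree (P : CochainComplex (ModuleCat.{0} R) ℤ) (I : Type) :
    tens P (I →₀ R) ≅ dsum (fun _ : I => P) :=
  HomologicalComplex.Hom.isoOfComponents
    (fun n => LinearEquiv.toModuleIso
      ((TensorProduct.finsuppScalarRight R R (P.X n) I).trans (finsuppLEquivDirectSum R (P.X n) I)))
    (by
      intro n m _
      ext1
      refine TensorProduct.ext (LinearMap.ext fun p => Finsupp.lhom_ext fun i r => ?_)
      change DirectSum.lmap (fun _ => (P.d n m).hom) (finsuppLEquivDirectSum R (P.X n) I
        (TensorProduct.finsuppScalarRight R R (P.X n) I (p ⊗ₜ Finsupp.single i r))) =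
        finsuppLEquivDirectSum R (P.X m) I
        (TensorProduct.finsuppScalarRight R R (P.X m) I ((P.d n m).hom p ⊗ₜ Finsupp.single i r))
      rw [TensorProduct.finsuppScalarRight_apply_tmul, TensorProduct.finsuppScalarRight_apply_tmul,
        Finsupp.sum_single_index (by simp), Finsupp.sum_single_index (by simp),
        finsuppLEquivDirectSum_single, finsuppLEquivDirectSum_single, DirectSum.lmap_lof, map_smul])

variable [HasDerivedCategory.{w} (ModuleCat.{0} R)]
open DerivedCategory ZeroObject

noncomputable def Kseq (X : ModuleCat.{0} R) : ℕ → ModuleCat.{0} R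
  | 0 => X
  | n + 1 => ModuleCat.of R (LinearMap.ker (Finsupp.linearCombination R (id : Kseq X n → Kseq X n)))

noncomputable def Kpr (X : ModuleCat.{0} R) (n : ℕ) : (Kseq X n →₀ R) →ₗ[R] Kseq X n :=
  Finsupp.linearCombination R (id : Kseq X n → Kseq X n)

noncomputable def Kin (X : ModuleCat.{0} R) (n : ℕ) : Kseq X (n + 1) →ₗ[R] (Kseq X n →₀ R) :=
  (LinearMap.ker (Finsupp.linearCombination R (id : Kseq X n → Kseq X n))).subtype

lemma Kin_inj (X : ModuleCat.{0} R) (n : ℕ) : Function.Injective (Kin X n) :=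
  Submodule.injective_subtype _

lemma Kpr_surj (X : ModuleCat.{0} R) (n : ℕ) : Function.Surjective (Kpr X n) :=
  fun x => ⟨Finsupp.single x 1, by simp [Kpr]⟩

lemma K_exact (X : ModuleCat.{0} R) (n : ℕ) : Function.Exact (Kin X n) (Kpr X n) := by
  rw [LinearMap.exact_iff]
  exact (Submodule.range_subtype _).symm

lemma tens_mem {S : Set (DerivedCategory (ModuleCat.{0} R))} (hS : IsCocompletePreaisle R S)
    (P : CochainComplex (ModuleCat.{0} R) ℤ) (hP : ∀ n, Module.Flat R (P.X n)) (b : ℤ)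
    (hb : ∀ n, b < n → Subsingleton (P.X n)) (hPS : Q.obj P ∈ S) (X : Type) [AddCommGroup X] [Module R X] :
    Q.obj (tens P X) ∈ S := by
  have E : ∀ n, ESES (tensMap P (Kin (ModuleCat.of R X) n)) (tensMap P (Kpr (ModuleCat.of R X) n)) := fun n =>
    tens_eses P hP _ _ (Kin_inj _ n) (Kpr_surj _ n) (K_exact _ n)
  refine Rtower hS (fun n => Q.obj (tens P (Kseq (ModuleCat.of R X) n)))
    (fun n => triangleOfSES (E n).shortExact) (fun n => triangleOfSES_distinguished _) (fun n => rfl) (fun n => rfl)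
    (fun n => ?_) b (fun n => ?_)
  · exact hS.mem_of_iso (Q.mapIso (tensFree P _)).symm (dsum.mem hS _ (fun _ => hPS))
  · rw [isLE_Q_obj_iff, CochainComplex.isLE_iff]
    intro i hi
    refine ShortComplex.exact_of_isZero_X₂ _ ?_
    have := hb i hi
    have : Subsingleton (P.X i ⊗[R] (Kseq (ModuleCat.of R X) n)) := by
      refine ⟨fun a b => ?_⟩
      have h0 : ∀ a : P.X i ⊗[R] (Kseq (ModuleCat.of R X) n), a = 0 := by
        intro a
        induction a using TensorProduct.induction_on with
        | zero => rfl
        | tmul x y => rw [Subsingleton.elim x 0, zero_tmul]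
        | add x y hx hy => rw [hx, hy, add_zero]
      rw [h0 a, h0 b]
    exact ModuleCat.isZero_of_subsingleton (ModuleCat.of R (P.X i ⊗[R] (Kseq (ModuleCat.of R X) n)))

end P5

section P6
open Opposite

variable {C : Type*} [Category C] [Abelian C]

def unV (L : CochainComplex Cᵒᵖ ℤ) : CochainComplex C ℤ where
  X n := unop (L.X (-n))
  d n m := (L.d (-m) (-n)).unop
  shape n m h := by
    rw [L.shape]
    · rfl
    · intro h'
      apply h
      simp only [ComplexShape.up_Rel] at h' ⊢
      omega
  d_comp_d' n m k _ _ := by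
    rw [← unop_comp, L.d_comp_d]
    rfl

def opV (K : CochainComplex C ℤ) : CochainComplex Cᵒᵖ ℤ where
  X n := op (K.X (-n))
  d n m := (K.d (-m) (-n)).op
  shape n m h := by
    rw [K.shape]
    · rfl
    · intro h'
      apply h
      simp only [ComplexShape.up_Rel] at h' ⊢
      omega
  d_comp_d' n m k _ _ := by
    rw [← op_comp, K.d_comp_d]
    rfl

def unVmap {L L' : CochainComplex Cᵒᵖ ℤ} (f : L ⟶ L') : unV L' ⟶ unV L where
  f n := (f.f (-n)).unop
  comm' n m _ := by
    change (f.f (-n)).unop ≫ (L.d (-m) (-n)).unop = (L'.d (-m) (-n)).unop ≫ (f.f (-m)).unop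
    rw [← unop_comp, ← unop_comp, f.comm]

lemma unVmap_quasiIso {L L' : CochainComplex Cᵒᵖ ℤ} (f : L ⟶ L') [QuasiIso f] : QuasiIso (unVmap f) := by
  rw [quasiIso_iff]
  intro n
  rw [quasiIsoAt_iff' _ (n - 1) n (n + 1) (by simp) (by simp)]
  have h : QuasiIsoAt f (-n) := inferInstance
  rw [quasiIsoAt_iff' _ (-(n+1)) (-n) (-(n-1)) (by simp; omega) (by simp; omega)] at h
  exact (ShortComplex.quasiIso_opMap_iff (ShortComplex.unopMap ((HomologicalComplex.shortComplexFunctor' _ _ (-(n+1)) (-n) (-(n-1))).map f))).1 h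

def unopV (K : CochainComplex C ℤ) : unV (opV K) ≅ K :=
  HomologicalComplex.Hom.isoOfComponents (fun n => K.XIsoOfEq (by simp)) (by
    intro i j _
    change (K.XIsoOfEq _).hom ≫ K.d i j = K.d (- -i) (- -j) ≫ (K.XIsoOfEq _).hom
    simp)

lemma exists_proj [EnoughProjectives C] (K : CochainComplex C ℤ) (b : ℤ) [K.IsStrictlyLE b] :
    ∃ (P : CochainComplex C ℤ) (f : P ⟶ K), QuasiIso f ∧ (∀ n, Projective (P.X n)) ∧
      ∀ n, b < n → IsZero (P.X n) := by
  have : (opV K).IsStrictlyGE (-b) := by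
    rw [CochainComplex.isStrictlyGE_iff]
    intro i hi
    exact (K.isZero_of_isStrictlyLE b _ (by lia)).op
  obtain ⟨L, i, hi, hL, hL'⟩ := CochainComplex.Plus.modelCategoryQuillen.exists_quasiIso_injective (opV K) (-b)
  have := unVmap_quasiIso i
  refine ⟨unV L, unVmap i ≫ (unopV K).hom, inferInstance, fun n => ?_, fun n hn => ?_⟩
  · have := hL (-n)
    exact inferInstanceAs (Projective (unop (L.X (-n))))
  · exact (L.isZero_of_isStrictlyGE (-b) _ (by lia)).unop
end P6

section P6b
variable {R : Type} [CommRing R] [HasDerivedCategory.{w} (ModuleCat.{0} R)]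
open DerivedCategory

lemma exists_res (M : DerivedCategory (ModuleCat.{0} R)) (b : ℤ) (hM : M.IsLE b) :
    ∃ (P : CochainComplex (ModuleCat.{0} R) ℤ) (_ : Q.obj P ≅ M), (∀ n, Module.Flat R (P.X n)) ∧
      ∀ n, b < n → Subsingleton (P.X n) := by
  obtain ⟨K, hK, ⟨e⟩⟩ := DerivedCategory.exists_iso_Q_obj_of_isLE M b
  obtain ⟨P, f, hf, hP, hP'⟩ := exists_proj K b
  have : IsIso (Q.map f) := inferInstance
  refine ⟨P, asIso (Q.map f) ≪≫ e.symm, fun n => ?_, fun n hn => ?_⟩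
  · have := hP n
    have : Module.Projective R (P.X n) := (IsProjective.iff_projective _).2 inferInstance
    infer_instance
  · exact ModuleCat.subsingleton_of_isZero (hP' n hn)
end P6b

section P7
variable {R : Type} [CommRing R]
open TensorProduct

noncomputable def kEquiv (q : Ideal R) [q.IsPrime] :
    LocalizedModule q.primeCompl (R ⧸ q) ≃ₗ[R] q.ResidueField := by
  have hS : Algebra.algebraMapSubmonoid (R ⧸ q) q.primeCompl = nonZeroDivisors (R ⧸ q) := by
    ext x
    obtain ⟨x, rfl⟩ := Ideal.Quotient.mk_surjective x
    rw [mem_nonZeroDivisors_iff_ne_zero, ne_eq, Ideal.Quotient.eq_zero_iff_mem]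
    constructor
    · rintro ⟨y, hy, h⟩ hx
      apply hy
      have h' : Ideal.Quotient.mk q y = Ideal.Quotient.mk q x := h
      rw [← Ideal.Quotient.eq_zero_iff_mem] at hx
      have := h'.trans hx
      rwa [Ideal.Quotient.eq_zero_iff_mem] at this
    · intro hx
      exact ⟨x, hx, rfl⟩
  have : IsLocalization (Algebra.algebraMapSubmonoid (R ⧸ q) q.primeCompl) q.ResidueField := by
    rw [hS]; infer_instance
  have : IsLocalizedModule q.primeCompl (IsScalarTower.toAlgHom R (R ⧸ q) q.ResidueField).toLinearMap :=
    isLocalizedModule_iff_isLocalization.2 this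
  exact IsLocalizedModule.iso q.primeCompl (IsScalarTower.toAlgHom R (R ⧸ q) q.ResidueField).toLinearMap

lemma nontriv_of_ass {H : Type} [AddCommGroup H] [Module R H] [Module.Finite R H] (q q' : Ideal R) [hq : q.IsPrime]
    (h : q' ∈ associatedPrimes R H) (hqq : q' ≤ q) : (⟨q, hq⟩ : PrimeSpectrum R) ∈ Module.support R H := by
  rw [Module.mem_support_iff_of_finite]
  rw [← Submodule.annihilator_top]
  exact (IsAssociatedPrime.annihilator_le h).trans hqq

lemma nontriv_iff {H : Type} [AddCommGroup H] [Module R H] (q : Ideal R) [hq : q.IsPrime] :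
    (⟨q, hq⟩ : PrimeSpectrum R) ∈ Module.support R H ↔ Nontrivial (H ⊗[R] Localization.AtPrime q) := by
  rw [Module.mem_support_iff, (LocalizedModule.equivTensorProduct q.primeCompl H).nontrivial_congr,
    (TensorProduct.comm R _ _).nontrivial_congr]

lemma exists_map {H : Type} [AddCommGroup H] [Module R H] [Module.Finite R H] (q : Ideal R) [hq : q.IsPrime]
    (h : (⟨q, hq⟩ : PrimeSpectrum R) ∈ Module.support R H) :
    ∃ f : (H ⊗[R] Localization.AtPrime q) →ₗ[R] q.ResidueField, f ≠ 0 := by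
  rw [Module.mem_support_iff_nontrivial_residueField_tensorProduct] at h
  change Nontrivial (q.ResidueField ⊗[R] H) at h
  obtain ⟨v, hv⟩ := exists_ne (0 : q.ResidueField ⊗[R] H)
  obtain ⟨ψ, hψ⟩ : ∃ ψ : Module.Dual q.ResidueField (q.ResidueField ⊗[R] H), ψ v ≠ 0 := by
    by_contra! hc
    exact hv ((Module.forall_dual_apply_eq_zero_iff q.ResidueField v).1 hc)
  let χ : H →ₗ[R] q.ResidueField := (ψ.restrictScalars R).comp (TensorProduct.mk R q.ResidueField H 1)
  refine ⟨TensorProduct.lift ((LinearMap.mul R q.ResidueField).compl₁₂ χ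
    (IsScalarTower.toAlgHom R (Localization.AtPrime q) q.ResidueField).toLinearMap), ?_⟩
  intro h0
  apply hψ
  have h1 : ∀ x, χ x = 0 := by
    intro x
    have := LinearMap.congr_fun h0 (x ⊗ₜ 1)
    rw [TensorProduct.lift.tmul, LinearMap.compl₁₂_apply] at this
    simpa using this
  clear hψ hv
  induction v using TensorProduct.induction_on with
  | zero => exact map_zero _
  | tmul x y =>
    have e : x ⊗ₜ[R] y = x • ((1 : q.ResidueField) ⊗ₜ[R] y) := by rw [smul_tmul', smul_eq_mul, mul_one]
    rw [e, map_smul]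
    have : ψ (1 ⊗ₜ y) = 0 := h1 y
    rw [this, smul_zero]
  | add x y hx hy => rw [map_add, hx, hy, add_zero]
end P7

section P8
variable {R : Type} [CommRing R]
open TensorProduct

noncomputable def tensHomologyIso (P : CochainComplex (ModuleCat.{0} R) ℤ) (A : Type) [AddCommGroup A] [Module R A]
    [Module.Flat R A] (n : ℤ) : (tens P A).homology n ≅ ModuleCat.of R (P.homology n ⊗[R] A) := by
  have : Module.Flat R (ModuleCat.of R A) := inferInstanceAs (Module.Flat R A)
  have : PreservesFiniteColimits (MonoidalCategory.tensorRight (ModuleCat.of R A)) :=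
    preservesFiniteColimits_of_natIso (BraidedCategory.tensorLeftIsoTensorRight (ModuleCat.of R A))
  exact (P.sc n).mapHomologyIso (MonoidalCategory.tensorRight (ModuleCat.of R A))

lemma exists_phi (P : CochainComplex (ModuleCat.{0} R) ℤ) (n : ℤ) (hP : IsZero (P.X (n+1)))
    (k : ModuleCat.{0} R) (f : P.homology n ⟶ k) (hf : f ≠ 0) :
    ∃ φ : P.X n ⟶ k, φ ≠ 0 ∧ ∀ i, (ComplexShape.up ℤ).Rel i n → P.d i n ≫ φ = 0 := by
  have : IsIso (P.iCycles n) := P.isIso_iCycles n (n+1) (by simp) (hP.eq_of_tgt _ _)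
  refine ⟨inv (P.iCycles n) ≫ P.homologyπ n ≫ f, ?_, ?_⟩
  · intro h
    rw [IsIso.inv_comp_eq, comp_zero] at h
    apply hf
    rw [← cancel_epi (P.homologyπ n), h, comp_zero]
  · intro i hi
    have : P.d i n = P.toCycles i n ≫ P.iCycles n := by simp
    rw [this, Category.assoc, IsIso.hom_inv_id_assoc, ← Category.assoc, P.toCycles_comp_homologyπ, zero_comp]

variable [HasDerivedCategory.{w} (ModuleCat.{0} R)]
open DerivedCategory

lemma single_mem {S : Set (DerivedCategory (ModuleCat.{0} R))} (hS : IsCocompletePreaisle R S)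
    (P : CochainComplex (ModuleCat.{0} R) ℤ) (n : ℤ) (hP : IsZero (P.X (n+1))) (κ : Type) [Field κ] [Algebra R κ]
    (φ : P.X n ⟶ ModuleCat.of R κ) (hφ0 : φ ≠ 0) (hφ : ∀ i, (ComplexShape.up ℤ).Rel i n → P.d i n ≫ φ = 0)
    (h : Q.obj (tens P κ) ∈ S) :
    Q.obj ((HomologicalComplex.single (ModuleCat.{0} R) (ComplexShape.up ℤ) n).obj (ModuleCat.of R κ)) ∈ S := by
  obtain ⟨a, ha⟩ : ∃ a, φ a ≠ 0 := by
    by_contra! hc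
    exact hφ0 (by ext x; exact hc x)
  let c : κ := φ a
  have hc : c ≠ 0 := ha
  let φ' : P.X n →ₗ[R] κ := φ.hom
  let r : (tens P κ).X n ⟶ ModuleCat.of R κ := ModuleCat.ofHom
    (TensorProduct.lift ((LinearMap.mul R κ).comp φ'))
  let i : ModuleCat.of R κ ⟶ (tens P κ).X n := ModuleCat.ofHom
    ((TensorProduct.mk R (P.X n) κ a).comp (LinearMap.mulLeft R (c⁻¹)))
  have hr : ∀ j, (ComplexShape.up ℤ).Rel j n → (tens P κ).d j n ≫ r = 0 := by
    intro j hj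
    ext1
    refine TensorProduct.ext' fun x y => ?_
    change φ (P.d j n x) * y = 0
    have : φ (P.d j n x) = 0 := by
      rw [← ConcreteCategory.comp_apply, hφ j hj]; rfl
    rw [this]
    exact zero_mul y
  have hi : ∀ j, (ComplexShape.up ℤ).Rel n j → i ≫ (tens P κ).d n j = 0 := by
    intro j hj
    obtain rfl : n + 1 = j := hj
    have := ModuleCat.subsingleton_of_isZero hP
    ext x
    change P.d n (n+1) a ⊗ₜ[R] _ = 0
    rw [Subsingleton.elim (P.d n (n+1) a) 0, zero_tmul]

  refine retract_mem hS (HomologicalComplex.mkHomFromSingle i hi) (HomologicalComplex.mkHomToSingle r hr) ?_ h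
  apply HomologicalComplex.from_single_hom_ext
  have hir : i ≫ r = 𝟙 _ := by
    ext x
    change c * (c⁻¹ * x) = x
    rw [← mul_assoc, mul_inv_cancel₀ hc, one_mul]
  rw [HomologicalComplex.comp_f, HomologicalComplex.mkHomFromSingle_f, HomologicalComplex.mkHomToSingle_f,
    Category.assoc, reassoc_of% hir]
  simp
end P8

section P9
open TensorProduct DerivedCategory

noncomputable def homIso {R : Type} [CommRing R] [HasDerivedCategory.{w} (ModuleCat.{0} R)]
    {P : CochainComplex (ModuleCat.{0} R) ℤ} {M : DerivedCategory (ModuleCat.{0} R)} (e : Q.obj P ≅ M) (n : ℤ) :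
    P.homology n ≅ (homologyFunctor (ModuleCat.{0} R) n).obj M :=
  ((homologyFunctorFactors (ModuleCat.{0} R) n).app P).symm ≪≫ (homologyFunctor (ModuleCat.{0} R) n).mapIso e

end P9
open TensorProduct DerivedCategory

/-- Let `R` be Noetherian, `M ∈ D_qc(R)` and `q` a prime in the
specialization closure of `Ass H_0(M)`. Then `k(q)` (the fraction field of `R/q`,
in homological degree `0`) lies in every cocomplete preaisle of `D(R)` containing `M`. -/
theorem stmt9 (R : Type) [CommRing R] [IsNoetherianRing R]
    [HasDerivedCategory.{w} (ModuleCat R)]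
    (M : DerivedCategory (ModuleCat R)) (hM : memDqc R M)
    (q : Ideal R) (hq : q.IsPrime)
    (hass : ∃ q' ∈ associatedPrimes R ↥(Hh R 0 M), q' ≤ q) :
    ∀ S : Set (DerivedCategory (ModuleCat R)), IsCocompletePreaisle R S → M ∈ S →
      sdeg R 0 (ModuleCat.of R (LocalizedModule q.primeCompl (R ⧸ q))) ∈ S := by
  intro S hS hMS

  let H : ℤ → ModuleCat.{0} R := fun n => (homologyFunctor (ModuleCat.{0} R) n).obj M
  have hfin : ∀ n, Module.Finite R (H n) := by
    intro n
    have := hM.1 (-n)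
    rw [Hh, neg_neg] at this
    exact this
  have hN : {n : ℤ | ¬ IsZero (H n)}.Finite := by
    have := (hM.2.image (fun n => -n))
    refine this.subset ?_
    intro n hn
    refine ⟨-n, ?_, neg_neg n⟩
    change ¬ IsZero ((homologyFunctor (ModuleCat.{0} R) (- -n)).obj M)
    rw [neg_neg]
    exact hn
  let A := Localization.AtPrime q
  let T : Set ℤ := {n : ℤ | Nontrivial (H n ⊗[R] A)}
  have hT : T.Finite := by
    refine hN.subset ?_
    intro n hn hz
    have := ModuleCat.subsingleton_of_isZero hz
    have h1 : Nontrivial (H n ⊗[R] A) := hn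
    obtain ⟨x, hx⟩ := exists_ne (0 : H n ⊗[R] A)
    apply hx
    clear hx
    induction x using TensorProduct.induction_on with
    | zero => rfl
    | tmul x y => rw [Subsingleton.elim x 0, zero_tmul]
    | add x y hx hy => rw [hx, hy, add_zero]
  have h0 : (0 : ℤ) ∈ T := by
    obtain ⟨q', hq', hle⟩ := hass
    have : Module.Finite R (Hh R 0 M) := hM.1 0
    exact (nontriv_iff q).1 (nontriv_of_ass q q' hq' hle)
  obtain ⟨n0, hn0, hmax⟩ := hT.exists_maximalFor id T ⟨0, h0⟩
  have hmax' : ∀ n, n0 < n → Subsingleton (H n ⊗[R] A) := by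
    intro n hn
    by_contra hc
    rw [not_subsingleton_iff_nontrivial] at hc
    have := hmax (j := n) hc hn.le
    simp only [id] at this
    omega
  have hn0' : 0 ≤ n0 := by
    by_contra hc
    have := hmax (j := 0) h0 (by simp only [id]; omega)
    simp only [id] at this
    omega
  obtain ⟨b, hb⟩ := hN.bddAbove
  have hMb : M.IsLE b := by
    rw [isLE_iff]
    intro i hi
    by_contra hc
    have := hb (show i ∈ {n : ℤ | ¬ IsZero (H n)} from hc)
    omega
  obtain ⟨P, eP, hPflat, hPb⟩ := exists_res M b hMb
  have hPS : Q.obj P ∈ S := hS.mem_of_iso eP.symm hMS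
  have hNS := tens_mem hS P hPflat b hPb hPS A
  have eN : ∀ n, (tens P A).homology n ≅ ModuleCat.of R (H n ⊗[R] A) := fun n =>
    tensHomologyIso P A n ≪≫ (LinearEquiv.rTensor A (homIso eP n).toLinearEquiv).toModuleIso
  have hNle : (Q.obj (tens P A)).IsLE n0 := by
    rw [isLE_Q_obj_iff, CochainComplex.isLE_iff]
    intro i hi
    rw [HomologicalComplex.exactAt_iff_isZero_homology]
    have := hmax' i hi
    exact (ModuleCat.isZero_of_subsingleton (ModuleCat.of R (H i ⊗[R] A))).of_iso (eN i)
  obtain ⟨P', eP', hPflat', hPb'⟩ := exists_res _ n0 hNle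
  have hPS' : Q.obj P' ∈ S := hS.mem_of_iso eP'.symm hNS
  have hZ := tens_mem hS P' hPflat' n0 hPb' hPS' q.ResidueField
  obtain ⟨f, hf⟩ := exists_map (H := H n0) q ((nontriv_iff q).2 hn0)
  have eH : P'.homology n0 ≅ ModuleCat.of R (H n0 ⊗[R] A) :=
    homIso eP' n0 ≪≫ (homIso (Iso.refl _) n0).symm ≪≫ eN n0
  have hz : IsZero (P'.X (n0 + 1)) := by
    have := hPb' (n0 + 1) (by omega)
    exact ModuleCat.isZero_of_subsingleton _
  obtain ⟨φ, hφ0, hφ⟩ := exists_phi P' n0 hz (ModuleCat.of R q.ResidueField) (eH.hom ≫ ModuleCat.ofHom f) (by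
    intro h
    rw [← comp_zero (f := eH.hom), cancel_epi] at h
    exact hf (congrArg ModuleCat.Hom.hom h))
  have hsingle := single_mem hS P' n0 hz q.ResidueField φ hφ0 hφ hZ
  rw [Q_obj_single_obj] at hsingle
  obtain ⟨m, rfl⟩ := Int.eq_ofNat_of_zero_le hn0'
  have hfinal := shift_nat_mem hS _ hsingle m
  have h1 := hS.mem_of_iso (((singleFunctors (ModuleCat.{0} R)).shiftIso (m : ℤ) 0 (m : ℤ) (by simp)).app _) hfinal
  have h2 := hS.mem_of_iso ((singleFunctor (ModuleCat.{0} R) 0).mapIso (kEquiv q).symm.toModuleIso) h1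
  exact h2
end

section
/- Let R be a commutative Noetherian ring of finite Krull dimension, let S ∈ D_qc(R), let p ∈ Ass H_0(S), and let q be a prime ideal with p ⊆ q. Then s^d(R/q), where d is the Krull dimension of R/q, lies in every cocomplete preaisle of D(R) that contains S. In particular, s^{dim R}(R/q) lies in every cocomplete preaisle of D(R) that contains S. -/
open CategoryTheory CategoryTheory.Limits CategoryTheory.Pretriangulated

universe w

namespace Stmt10
section coprod
variable {R : Type} [CommRing R]

open Classical in
lemma sum_fin {ι : Type} (X : ι → CochainComplex (ModuleCat.{0} R) ℤ) (k : ℤ)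
    (z : (∐ X).X k) :
    ∃ s : Finset ι, z = ∑ i ∈ s, ((Sigma.π X i ≫ Sigma.ι X i).f k).hom z := by
  let e : ι → ((∐ X).X k →ₗ[R] (∐ X).X k) := fun i => ((Sigma.π X i ≫ Sigma.ι X i).f k).hom
  let N : Submodule R ((∐ X).X k) :=
    { carrier := {z | ∃ s : Finset ι, ∀ t, s ⊆ t → z = ∑ i ∈ t, e i z}
      zero_mem' := ⟨∅, fun t _ => by simp⟩
      add_mem' := by
        rintro a b ⟨s, hs⟩ ⟨s', hs'⟩
        refine ⟨s ∪ s', fun t ht => ?_⟩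
        simp only [map_add, Finset.sum_add_distrib]
        rw [← hs t (Finset.union_subset_left ht), ← hs' t (Finset.union_subset_right ht)]
      smul_mem' := by
        rintro r a ⟨s, hs⟩
        refine ⟨s, fun t ht => ?_⟩
        simp only [map_smul, ← Finset.smul_sum]
        rw [← hs t ht] }
  have hN : ModuleCat.ofHom N.mkQ = 0 := by
    refine (isColimitOfPreserves (HomologicalComplex.eval (ModuleCat.{0} R) (ComplexShape.up ℤ) k)
      (coproductIsCoproduct X)).hom_ext ?_
    rintro ⟨i⟩
    ext x
    change N.mkQ (((Sigma.ι X i).f k).hom x) = 0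
    rw [Submodule.mkQ_apply, Submodule.Quotient.mk_eq_zero]
    refine ⟨{i}, fun t ht => ?_⟩
    have hi : i ∈ t := ht (Finset.mem_singleton_self i)
    have h1 : ∀ j, e j (((Sigma.ι X i).f k).hom x) =
        ((Sigma.ι X i ≫ Sigma.π X j ≫ Sigma.ι X j).f k).hom x := fun j => rfl
    rw [Finset.sum_eq_single i]
    · rw [h1, Sigma.ι_π_eq_id_assoc]
    · intro j _ hj
      rw [h1, Sigma.ι_π_of_ne_assoc _ (Ne.symm hj)]
      simp
      rfl
    · exact fun h => absurd hi h
  have hz : z ∈ N := by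
    rw [← Submodule.Quotient.mk_eq_zero, ← Submodule.mkQ_apply]
    exact congr($(hN).hom z)
  obtain ⟨s, hs⟩ := hz
  exact ⟨s, hs s subset_rfl⟩

open Classical in
lemma sum_fin_homology {ι : Type} (X : ι → CochainComplex (ModuleCat.{0} R) ℤ) (k : ℤ)
    (z : (∐ X).homology k) :
    ∃ s : Finset ι, z = ∑ i ∈ s,
      (HomologicalComplex.homologyMap (Sigma.π X i ≫ Sigma.ι X i) k).hom z := by
  obtain ⟨c, rfl⟩ := (ModuleCat.epi_iff_surjective ((∐ X).homologyπ k)).1 inferInstance z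
  obtain ⟨s, hs⟩ := sum_fin X k (((∐ X).iCycles k).hom c)
  refine ⟨s, ?_⟩
  have h1 : c = ∑ i ∈ s, (HomologicalComplex.cyclesMap (Sigma.π X i ≫ Sigma.ι X i) k).hom c := by
    apply (ModuleCat.mono_iff_injective ((∐ X).iCycles k)).1 inferInstance
    refine hs.trans ?_
    change _ = ((∐ X).iCycles k).hom _
    rw [map_sum]
    refine Finset.sum_congr rfl fun i _ => ?_
    exact congr($(HomologicalComplex.cyclesMap_i (Sigma.π X i ≫ Sigma.ι X i) k).hom c).symm
  change ((∐ X).homologyπ k).hom c = _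
  conv_lhs => rw [h1]
  rw [map_sum]
  refine Finset.sum_congr rfl fun i _ => ?_
  exact congr($(HomologicalComplex.homologyπ_naturality (Sigma.π X i ≫ Sigma.ι X i) k).hom c).symm

lemma quasiIso_sigma {ι : Type} {X Y : ι → CochainComplex (ModuleCat.{0} R) ℤ}
    (f : ∀ i, X i ⟶ Y i) (hf : ∀ i, QuasiIso (f i)) : QuasiIso (Limits.Sigma.map f) := by
  classical
  rw [quasiIso_iff]
  intro k
  rw [quasiIsoAt_iff_isIso_homologyMap, ConcreteCategory.isIso_iff_bijective]
  have hb : ∀ i, Function.Bijective (HomologicalComplex.homologyMap (f i) k).hom := fun i => by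
    have := hf i
    exact (ConcreteCategory.isIso_iff_bijective (HomologicalComplex.homologyMap (f i) k)).1
      inferInstance
  have hπ : ∀ i, Limits.Sigma.map f ≫ Sigma.π Y i = Sigma.π X i ≫ f i := by
    intro i
    apply Sigma.hom_ext
    intro j
    by_cases h : j = i
    · subst h
      simp
    · simp [Sigma.ι_π_of_ne_assoc _ h, Sigma.ι_π_of_ne _ h]
  constructor
  · change Function.Injective (HomologicalComplex.homologyMap (Limits.Sigma.map f) k).hom
    rw [injective_iff_map_eq_zero]
    intro z hz
    obtain ⟨s, hs⟩ := sum_fin_homology X k z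
    rw [hs]
    refine Finset.sum_eq_zero fun i _ => ?_
    rw [HomologicalComplex.homologyMap_comp, ModuleCat.hom_comp, LinearMap.comp_apply]
    suffices h : (HomologicalComplex.homologyMap (Sigma.π X i) k).hom z = 0 by rw [h, map_zero]
    apply (hb i).1
    rw [map_zero]
    have := congr((HomologicalComplex.homologyMap $(hπ i) k).hom z)
    simp only [HomologicalComplex.homologyMap_comp, ModuleCat.hom_comp, LinearMap.comp_apply] at this
    rw [← this, hz, map_zero]
  · intro z
    obtain ⟨s, hs⟩ := sum_fin_homology Y k z
    have h : ∀ i, ∃ y, (HomologicalComplex.homologyMap (Limits.Sigma.map f) k).hom y =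
        (HomologicalComplex.homologyMap (Sigma.π Y i ≫ Sigma.ι Y i) k).hom z := by
      intro i
      obtain ⟨x, hx⟩ := (hb i).2 ((HomologicalComplex.homologyMap (Sigma.π Y i) k).hom z)
      refine ⟨(HomologicalComplex.homologyMap (Sigma.ι X i) k).hom x, ?_⟩
      have := congr((HomologicalComplex.homologyMap $(Sigma.ι_map f i) k).hom x)
      simp only [HomologicalComplex.homologyMap_comp, ModuleCat.hom_comp, LinearMap.comp_apply] at this ⊢
      rw [this, hx]
    choose y hy using h
    refine ⟨∑ i ∈ s, y i, ?_⟩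
    change (HomologicalComplex.homologyMap (Limits.Sigma.map f) k).hom _ = z
    rw [map_sum]
    conv_rhs => rw [hs]
    exact Finset.sum_congr rfl fun i _ => hy i

end coprod
end Stmt10


namespace Stmt10
section dcoprod
variable {R : Type} [CommRing R] [HasDerivedCategory.{w} (ModuleCat.{0} R)]
open DerivedCategory

lemma span_Q {ι : Type} (K : ι → CochainComplex (ModuleCat.{0} R) ℤ) (k : ℤ)
    (z : (homologyFunctor (ModuleCat.{0} R) k).obj (Q.obj (∐ K))) :
    ∃ (s : Finset ι) (y : ∀ i, (homologyFunctor (ModuleCat.{0} R) k).obj (Q.obj (K i))),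
      z = ∑ i ∈ s, ((homologyFunctor (ModuleCat.{0} R) k).map (Q.map (Sigma.ι K i))).hom (y i) := by
  classical
  let e := (homologyFunctorFactors (ModuleCat.{0} R) k)
  obtain ⟨s, hs⟩ := sum_fin_homology K k ((e.hom.app (∐ K)).hom z)
  refine ⟨s, fun i => (e.inv.app (K i)).hom ((HomologicalComplex.homologyMap (Sigma.π K i) k).hom
    ((e.hom.app (∐ K)).hom z)), ?_⟩
  have hz : z = (e.inv.app (∐ K)).hom ((e.hom.app (∐ K)).hom z) := by
    have := congr($(e.hom_inv_id_app (∐ K)).hom z)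
    exact this.symm
  let w : (∐ K).homology k := (e.hom.app (∐ K)).hom z
  have hs' : w = ∑ i ∈ s, (HomologicalComplex.homologyMap (Sigma.π K i ≫ Sigma.ι K i) k).hom w := hs
  let E : (∐ K).homology k →ₗ[R] ((homologyFunctor (ModuleCat.{0} R) k).obj (Q.obj (∐ K))) :=
    (e.inv.app (∐ K)).hom
  refine hz.trans ?_
  refine (congrArg E hs').trans ?_
  rw [map_sum]
  refine Finset.sum_congr rfl fun i _ => ?_
  rw [HomologicalComplex.homologyMap_comp, ModuleCat.hom_comp, LinearMap.comp_apply]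
  exact congr($(e.inv.naturality (Sigma.ι K i)).hom
    ((HomologicalComplex.homologyMap (Sigma.π K i) k).hom w))

lemma isIso_of_span {ι : Type} (K : ι → CochainComplex (ModuleCat.{0} R) ℤ)
    (e : Q.obj (∐ K) ⟶ Q.obj (∐ K)) (he : ∀ i, Q.map (Sigma.ι K i) ≫ e = Q.map (Sigma.ι K i)) :
    IsIso e := by
  rw [DerivedCategory.isIso_iff]
  intro k
  have : (homologyFunctor (ModuleCat.{0} R) k).map e = 𝟙 _ := by
    ext z
    obtain ⟨s, y, hz⟩ := span_Q K k z
    rw [hz]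
    simp only [map_sum]
    refine Finset.sum_congr rfl fun i _ => ?_
    have := congr(((homologyFunctor (ModuleCat.{0} R) k).map $(he i)).hom (y i))
    simp only [Functor.map_comp, ModuleCat.hom_comp, LinearMap.comp_apply] at this
    exact this
  rw [this]
  infer_instance

lemma exists_desc {ι : Type} (K : ι → CochainComplex (ModuleCat.{0} R) ℤ)
    (Y : DerivedCategory (ModuleCat.{0} R)) (f : ∀ i, Q.obj (K i) ⟶ Y) :
    ∃ g : Q.obj (∐ K) ⟶ Y, ∀ i, Q.map (Sigma.ι K i) ≫ g = f i := by
  obtain ⟨L, ⟨eL⟩⟩ : ∃ L, Nonempty (Q.obj L ≅ Y) := ⟨_, ⟨Q.objObjPreimageIso Y⟩⟩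
  choose X' s hs g hg using fun i => right_fac (f i ≫ eL.inv)
  have hq : QuasiIso (Limits.Sigma.map s) := quasiIso_sigma s fun i =>
    (isIso_Q_map_iff_quasiIso _ (s i)).1 (hs i)
  refine ⟨inv (Q.map (Limits.Sigma.map s)) ≫ Q.map (Sigma.desc g) ≫ eL.hom, fun i => ?_⟩
  have := hs i
  rw [← cancel_epi (Q.map (s i)), ← Functor.map_comp_assoc, ← Sigma.ι_map, Functor.map_comp_assoc,
    IsIso.hom_inv_id_assoc, ← Functor.map_comp_assoc, Sigma.ι_desc, ← cancel_mono eL.inv]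
  simp [hg]

lemma desc_unique {ι : Type} (K : ι → CochainComplex (ModuleCat.{0} R) ℤ)
    (Y : DerivedCategory (ModuleCat.{0} R)) (h : Q.obj (∐ K) ⟶ Y)
    (hh : ∀ i, Q.map (Sigma.ι K i) ≫ h = 0) : h = 0 := by
  obtain ⟨Z, a, b, hT⟩ := distinguished_cocone_triangle₁ h
  choose t ht using fun i => Triangle.coyoneda_exact₂ _ hT (Q.map (Sigma.ι K i)) (hh i)
  obtain ⟨σ, hσ⟩ := exists_desc K Z t
  have := isIso_of_span K (σ ≫ a) (fun i => by
    rw [← Category.assoc, hσ]; exact (ht i).symm)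
  have h0 : a ≫ h = 0 := comp_distTriang_mor_zero₁₂ _ hT
  rw [← cancel_epi (σ ≫ a), Category.assoc, h0]
  simp

noncomputable def qIsColimit {ι : Type} (K : ι → CochainComplex (ModuleCat.{0} R) ℤ) :
    IsColimit (Cofan.mk (Q.obj (∐ K)) (fun i => Q.map (Sigma.ι K i)) :
      Cofan (fun i => Q.obj (K i))) :=
  Cofan.IsColimit.mk _ (fun t => (exists_desc K t.pt t.inj).choose)
    (fun t i => (exists_desc K t.pt t.inj).choose_spec i)
    (fun t m hm => by
      rw [← sub_eq_zero]
      apply desc_unique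
      intro i
      rw [Preadditive.comp_sub, (exists_desc K t.pt t.inj).choose_spec i, sub_eq_zero]
      exact hm i)

instance : HasCoproducts.{0} (DerivedCategory (ModuleCat.{0} R)) := by
  apply hasCoproducts_of_colimit_cofans
    (fun f => Cofan.mk (Q.obj (∐ fun i => Q.objPreimage (f i)))
      (fun i => (Q.objObjPreimageIso (f i)).inv ≫ Q.map (Sigma.ι (fun i => Q.objPreimage (f i)) i)))
  intro ι f
  refine Cofan.IsColimit.mk _ (fun t => (qIsColimit (fun i => Q.objPreimage (f i))).desc
    (Cofan.mk t.pt fun i => (Q.objObjPreimageIso (f i)).hom ≫ t.inj i)) ?_ ?_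
  · intro t i
    have := (qIsColimit (fun i => Q.objPreimage (f i))).fac
      (Cofan.mk t.pt fun i => (Q.objObjPreimageIso (f i)).hom ≫ t.inj i) ⟨i⟩
    change (_ ≫ Q.map (Sigma.ι (fun i => Q.objPreimage (f i)) i)) ≫ _ = _
    rw [Category.assoc, Iso.inv_comp_eq]
    exact this
  · intro t m hm
    refine Cofan.IsColimit.hom_ext (qIsColimit (fun i => Q.objPreimage (f i))) _ _ fun i => ?_
    have := (qIsColimit (fun i => Q.objPreimage (f i))).fac
      (Cofan.mk t.pt fun i => (Q.objObjPreimageIso (f i)).hom ≫ t.inj i) ⟨i⟩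
    refine Eq.trans ?_ this.symm
    have h2 : ((Q.objObjPreimageIso (f i)).inv ≫
      Q.map (Sigma.ι (fun i => Q.objPreimage (f i)) i)) ≫ m = t.inj i := hm i
    rw [Category.assoc, Iso.inv_comp_eq] at h2
    exact h2

/-- homology of a coproduct is spanned by the summands -/
lemma span_H {ι : Type} (X : ι → DerivedCategory (ModuleCat.{0} R)) (k : ℤ)
    (z : (homologyFunctor (ModuleCat.{0} R) k).obj (∐ X)) :
    ∃ (s : Finset ι) (y : ∀ i, (homologyFunctor (ModuleCat.{0} R) k).obj (X i)),
      z = ∑ i ∈ s, ((homologyFunctor (ModuleCat.{0} R) k).map (Sigma.ι X i)).hom (y i) := by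
  let K := fun i => Q.objPreimage (X i)
  obtain ⟨a, ha⟩ := exists_desc K (∐ X) (fun i => (Q.objObjPreimageIso (X i)).hom ≫ Sigma.ι X i)
  let b : ∐ X ⟶ Q.obj (∐ K) := Sigma.desc fun i => (Q.objObjPreimageIso (X i)).inv ≫
    Q.map (Sigma.ι K i)
  have hb : ∀ i, Sigma.ι X i ≫ b = (Q.objObjPreimageIso (X i)).inv ≫ Q.map (Sigma.ι K i) :=
    fun i => by simp [b]
  have hab : b ≫ a = 𝟙 _ := by
    apply Sigma.hom_ext
    intro i
    rw [reassoc_of% (hb i), ha]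
    simp
  obtain ⟨s, y, hy⟩ := span_Q K k (((homologyFunctor (ModuleCat.{0} R) k).map b).hom z)
  refine ⟨s, fun i => ((homologyFunctor (ModuleCat.{0} R) k).map
    (Q.objObjPreimageIso (X i)).hom).hom (y i), ?_⟩
  have hz : z = ((homologyFunctor (ModuleCat.{0} R) k).map a).hom
      (((homologyFunctor (ModuleCat.{0} R) k).map b).hom z) := by
    have := congr(((homologyFunctor (ModuleCat.{0} R) k).map $hab).hom z)
    rw [CategoryTheory.Functor.map_id, Functor.map_comp] at this
    exact this.symm
  rw [hz, hy, map_sum]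
  refine Finset.sum_congr rfl fun i _ => ?_
  have := congr(((homologyFunctor (ModuleCat.{0} R) k).map $(ha i)).hom (y i))
  simpa only [Functor.map_comp, ModuleCat.hom_comp, LinearMap.comp_apply] using this

end dcoprod
end Stmt10


namespace Stmt10
section tri
universe v' u'
variable {C : Type u'} [Category.{v'} C] [HasZeroObject C] [HasShift C ℤ] [Preadditive C]
  [∀ n : ℤ, (shiftFunctor C n).Additive] [Pretriangulated C] [HasCoproducts.{0} C]

lemma shift_desc {ι : Type} (X : ι → C) {A : C} (f : ∀ i, (X i)⟦(1 : ℤ)⟧ ⟶ A) :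
    ∃ g : (∐ X)⟦(1 : ℤ)⟧ ⟶ A, ∀ i, (Sigma.ι X i)⟦(1 : ℤ)⟧' ≫ g = f i := by
  let h := isColimitCofanMkObjOfIsColimit (shiftFunctor C (1 : ℤ)) _ _ (coproductIsCoproduct X)
  exact ⟨h.desc (Cofan.mk A f), fun i => h.fac (Cofan.mk A f) ⟨i⟩⟩

lemma shift_ext {ι : Type} (X : ι → C) {A : C} (f g : (∐ X)⟦(1 : ℤ)⟧ ⟶ A)
    (h : ∀ i, (Sigma.ι X i)⟦(1 : ℤ)⟧' ≫ f = (Sigma.ι X i)⟦(1 : ℤ)⟧' ≫ g) : f = g :=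
  Cofan.IsColimit.hom_ext (isColimitCofanMkObjOfIsColimit (shiftFunctor C (1 : ℤ)) _ _ (coproductIsCoproduct X)) _ _ h

variable {X Y Z A : C} {f : X ⟶ Y} {g : Y ⟶ Z} {h : Z ⟶ X⟦(1 : ℤ)⟧}

lemma yon2 (hT : Triangle.mk f g h ∈ distTriang C) (k : Y ⟶ A) (hk : f ≫ k = 0) :
    ∃ l : Z ⟶ A, k = g ≫ l := Triangle.yoneda_exact₂ _ hT k hk

lemma yon3 (hT : Triangle.mk f g h ∈ distTriang C) (k : Z ⟶ A) (hk : g ≫ k = 0) :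
    ∃ l : X⟦(1 : ℤ)⟧ ⟶ A, k = h ≫ l := Triangle.yoneda_exact₃ _ hT k hk

lemma yon1 (hT : Triangle.mk f g h ∈ distTriang C) (k : X⟦(1 : ℤ)⟧ ⟶ A) (hk : h ≫ k = 0) :
    ∃ l : Y⟦(1 : ℤ)⟧ ⟶ A, k = f⟦(1 : ℤ)⟧' ≫ l := by
  obtain ⟨l, hl⟩ : ∃ l : Y⟦(1 : ℤ)⟧ ⟶ A, k = (-f⟦(1 : ℤ)⟧') ≫ l :=
    Triangle.yoneda_exact₃ _ (rot_of_distTriang _ hT) k hk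
  exact ⟨-l, by rw [hl, Preadditive.neg_comp, Preadditive.comp_neg]⟩

lemma tri_rot (hT : Triangle.mk f g h ∈ distTriang C) :
    Triangle.mk g h (-f⟦(1 : ℤ)⟧') ∈ distTriang C := rot_of_distTriang _ hT

lemma tri_iso {X' Y' Z' : C} {f' : X' ⟶ Y'} {g' : Y' ⟶ Z'} {h' : Z' ⟶ X'⟦(1 : ℤ)⟧}
    (hT : Triangle.mk f g h ∈ distTriang C) (e1 : X' ≅ X) (e2 : Y' ≅ Y) (e3 : Z' ≅ Z)
    (h1 : f' ≫ e2.hom = e1.hom ≫ f) (h2 : g' ≫ e3.hom = e2.hom ≫ g)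
    (h3 : h' ≫ e1.hom⟦(1 : ℤ)⟧' = e3.hom ≫ h) :
    Triangle.mk f' g' h' ∈ distTriang C :=
  isomorphic_distinguished _ hT _ (Triangle.isoMk _ _ e1 e2 e3 h1 h2 h3)

lemma coprod_tri {ι : Type} (X Y Z : ι → C) (a : ∀ i, X i ⟶ Y i) (b : ∀ i, Y i ⟶ Z i)
    (c : ∀ i, Z i ⟶ (X i)⟦(1 : ℤ)⟧) (hT : ∀ i, Triangle.mk (a i) (b i) (c i) ∈ distTriang C) :
    ∃ w, Triangle.mk (Limits.Sigma.map a) (Limits.Sigma.map b) w ∈ distTriang C := by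
  obtain ⟨Z', f2, f3, hT'⟩ := distinguished_cocone_triangle (Limits.Sigma.map a)
  have key : ∀ i, ∃ t : Z i ⟶ Z', b i ≫ t = Sigma.ι Y i ≫ f2 ∧
      c i ≫ (Sigma.ι X i)⟦(1 : ℤ)⟧' = t ≫ f3 := fun i =>
    complete_distinguished_triangle_morphism _ _ (hT i) hT'
      (Sigma.ι X i) (Sigma.ι Y i) (Sigma.ι_map a i).symm
  choose t ht1 ht2 using key
  have hz' : f3 ≫ (Limits.Sigma.map a)⟦(1:ℤ)⟧' = 0 := comp_distTriang_mor_zero₃₁ _ hT'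
  have hz : ∀ i, a i ≫ b i = 0 := fun i => comp_distTriang_mor_zero₁₂ _ (hT i)
  let φ : ∐ Z ⟶ Z' := Sigma.desc t
  have hφ : ∀ i, Sigma.ι Z i ≫ φ = t i := fun i => by simp [φ]
  have inj : ∀ (A : C) (h : Z' ⟶ A), φ ≫ h = 0 → h = 0 := by
    intro A h hh
    have h1 : ∀ i, t i ≫ h = 0 := fun i => by rw [← hφ, Category.assoc, hh, comp_zero]
    have h2 : f2 ≫ h = 0 := by
      apply Sigma.hom_ext
      intro i
      rw [← Category.assoc, ← ht1, Category.assoc, h1, comp_zero, comp_zero]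
    obtain ⟨h', e'⟩ := yon3 hT' h h2
    have h3 : ∀ i, c i ≫ (Sigma.ι X i)⟦(1:ℤ)⟧' ≫ h' = 0 := fun i => by
      rw [← Category.assoc, ht2, Category.assoc, ← e', h1]
    choose k hk using fun i => yon1 (hT i) ((Sigma.ι X i)⟦(1:ℤ)⟧' ≫ h') (h3 i)
    obtain ⟨K, hK⟩ := shift_desc Y k
    have : h' = (Limits.Sigma.map a)⟦(1:ℤ)⟧' ≫ K := by
      apply shift_ext
      intro i
      rw [← Functor.map_comp_assoc, Sigma.ι_map, Functor.map_comp_assoc, hK, hk]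
    rw [e', this, reassoc_of% hz']
    simp
  have surj : ∀ (A : C) (h : ∐ Z ⟶ A), ∃ h', φ ≫ h' = h := by
    intro A h
    obtain ⟨h', e'⟩ := yon2 hT' (Limits.Sigma.map b ≫ h) (by
      apply Sigma.hom_ext
      intro i
      simp [reassoc_of% (hz i)])
    choose m hm using fun i => yon3 (hT i) (Sigma.ι Z i ≫ h - t i ≫ h') (by
      have := congr(Sigma.ι Y i ≫ $e')
      rw [Sigma.ι_map_assoc, ← reassoc_of% (ht1 i)] at this
      rw [Preadditive.comp_sub, this, sub_self])
    obtain ⟨M, hM⟩ := shift_desc X m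
    refine ⟨h' + f3 ≫ M, ?_⟩
    apply Sigma.hom_ext
    intro i
    rw [reassoc_of% (hφ i), Preadditive.comp_add, ← reassoc_of% (ht2 i), hM, ← hm]
    abel
  obtain ⟨ψ, hψ⟩ := surj _ (𝟙 _)
  have hψ' : ψ ≫ φ = 𝟙 _ := by
    rw [← sub_eq_zero]
    apply inj
    rw [Preadditive.comp_sub, reassoc_of% hψ]
    simp
  refine ⟨φ ≫ f3, tri_iso hT' (Iso.refl _) (Iso.refl _) ⟨φ, ψ, hψ, hψ'⟩ (by simp) ?_ (by simp)⟩
  apply Sigma.hom_ext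
  intro i
  dsimp
  rw [Sigma.ι_map_assoc, hφ, ht1]
  simp

/-- split triangle -/
lemma split_tri {W A : C} (v ρ : W ⟶ W) (u : W ⟶ A) (s : A ⟶ W) (h1 : v ≫ ρ = 𝟙 _)
    (h2 : ρ ≫ v + u ≫ s = 𝟙 _) (h3 : v ≫ u = 0) (h4 : s ≫ u = 𝟙 _) :
    Triangle.mk v u (0 : A ⟶ W⟦(1 : ℤ)⟧) ∈ distTriang C := by
  have h5 : s ≫ ρ = 0 := by
    have := congr((s ≫ $h2) ≫ ρ)
    simp only [Preadditive.comp_add, Preadditive.add_comp, Category.assoc, h1, Category.comp_id,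
      reassoc_of% h4] at this
    simpa using this
  let e : W ≅ W ⊞ A := ⟨biprod.lift ρ u, biprod.desc v s, by simp [biprod.lift_desc, h2],
    by ext <;> simp [h1, h3, h4, h5]⟩
  have e1 : v ≫ e.hom = biprod.inl := by ext <;> simp [e, h1, h3]
  have e2 : u = e.hom ≫ biprod.snd := by simp [e]
  refine isomorphic_distinguished _ (binaryBiproductTriangle_distinguished W A) _
    (Triangle.isoMk _ _ (Iso.refl _) e (Iso.refl _) ?_ ?_ ?_)
  · exact e1.trans (Category.id_comp _).symm
  · exact (Category.comp_id _).trans e2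
  · exact zero_comp.trans comp_zero.symm

end tri
end Stmt10


namespace Stmt10
section retr
universe v' u'
variable {C : Type u'} [Category.{v'} C] [HasZeroObject C] [HasShift C ℤ] [Preadditive C]
  [∀ n : ℤ, (shiftFunctor C n).Additive] [Pretriangulated C] [HasCoproducts.{0} C]

lemma retract_tri {A X : C} (i : A ⟶ X) (r : X ⟶ A) (hir : i ≫ r = 𝟙 A) :
    Triangle.mk (Limits.Sigma.desc (fun n : ℕ => Sigma.ι (fun _ : ℕ => X) n -
        r ≫ i ≫ Sigma.ι (fun _ : ℕ => X) (n + 1)))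
      (Limits.Sigma.desc (fun _ : ℕ => r)) (0 : A ⟶ (∐ (fun _ : ℕ => X))⟦(1 : ℤ)⟧) ∈
      distTriang C := by
  set v : (∐ (fun _ : ℕ => X)) ⟶ (∐ (fun _ : ℕ => X)) := (Limits.Sigma.desc
    (fun n : ℕ => Sigma.ι (fun _ : ℕ => X) n - r ≫ i ≫ Sigma.ι (fun _ : ℕ => X) (n + 1))) with hv
  set u : (∐ (fun _ : ℕ => X)) ⟶ A := Limits.Sigma.desc (fun _ : ℕ => r) with hu
  let ρ : (∐ (fun _ : ℕ => X)) ⟶ (∐ (fun _ : ℕ => X)) := Limits.Sigma.desc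
    (fun n : ℕ => Sigma.ι (fun _ : ℕ => X) n - r ≫ i ≫ Sigma.ι (fun _ : ℕ => X) n -
      ∑ k ∈ Finset.range n, r ≫ i ≫ Sigma.ι (fun _ : ℕ => X) k)
  have v1 : ∀ n, Sigma.ι (fun _ : ℕ => X) n ≫ v = Sigma.ι (fun _ : ℕ => X) n -
      r ≫ i ≫ Sigma.ι (fun _ : ℕ => X) (n + 1) := fun n => by simp [hv]
  have u1 : ∀ n, Sigma.ι (fun _ : ℕ => X) n ≫ u = r := fun n => by simp [hu]
  have r1 : ∀ n, Sigma.ι (fun _ : ℕ => X) n ≫ ρ = Sigma.ι (fun _ : ℕ => X) n -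
      r ≫ i ≫ Sigma.ι (fun _ : ℕ => X) n -
      ∑ k ∈ Finset.range n, r ≫ i ≫ Sigma.ι (fun _ : ℕ => X) k := fun n => by simp [ρ]
  have hir' : ∀ {Y : C} (f : A ⟶ Y), i ≫ r ≫ f = f := fun f => by
    rw [reassoc_of% hir]
  refine split_tri v ρ u (i ≫ Sigma.ι (fun _ : ℕ => X) 0) ?_ ?_ ?_ ?_
  · apply Sigma.hom_ext
    intro n
    rw [reassoc_of% (v1 n), Preadditive.sub_comp, r1, Category.assoc, Category.assoc, r1,
      Finset.sum_range_succ]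
    simp only [Preadditive.comp_sub, Preadditive.comp_add, Preadditive.comp_sum, hir',
      Category.comp_id]
    abel
  · apply Sigma.hom_ext
    intro n
    rw [Preadditive.comp_add, reassoc_of% (r1 n), reassoc_of% (u1 n), Preadditive.sub_comp,
      Preadditive.sub_comp, Preadditive.sum_comp, v1]
    simp only [Category.assoc, v1]
    simp only [Preadditive.comp_sub, hir', Category.comp_id]
    rw [Finset.sum_range_sub']
    abel
  · apply Sigma.hom_ext
    intro n
    rw [reassoc_of% (v1 n), Preadditive.sub_comp, u1, Category.assoc, Category.assoc, u1, hir]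
    simp
  · rw [Category.assoc, u1, hir]
end retr

section preaisle
variable {R : Type} [CommRing R] [HasDerivedCategory.{w} (ModuleCat.{0} R)]
open DerivedCategory
variable {U : Set (DerivedCategory (ModuleCat.{0} R))}

lemma U_coprod (hU : IsCocompletePreaisle R U) {ι : Type} (X : ι → DerivedCategory (ModuleCat.{0} R))
    (h : ∀ i, X i ∈ U) : (∐ X) ∈ U := hU.coproduct_mem X _ (coproductIsCoproduct X) h

lemma U_cone (hU : IsCocompletePreaisle R U) {X Y Z : DerivedCategory (ModuleCat.{0} R)}
    {f : X ⟶ Y} {g : Y ⟶ Z} {h : Z ⟶ X⟦(1 : ℤ)⟧}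
    (hT : Triangle.mk f g h ∈ distTriang _) (hX : X ∈ U) (hY : Y ∈ U) : Z ∈ U :=
  hU.ext_mem _ _ _ (tri_rot hT) hY (hU.shift_mem hX)

lemma U_retract (hU : IsCocompletePreaisle R U) {A X : DerivedCategory (ModuleCat.{0} R)}
    (i : A ⟶ X) (r : X ⟶ A) (hir : i ≫ r = 𝟙 A) (hX : X ∈ U) : A ∈ U :=
  U_cone hU (retract_tri i r hir) (U_coprod hU _ fun _ => hX) (U_coprod hU _ fun _ => hX)

lemma U_zero (hU : IsCocompletePreaisle R U) {Z : DerivedCategory (ModuleCat.{0} R)}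
    (hZ : IsZero Z) : Z ∈ U := by
  refine hU.coproduct_mem (ι := Empty) (fun e => e.elim) (Cofan.mk Z (fun e => e.elim))
    (Cofan.IsColimit.mk _ (fun t => 0) (fun t e => e.elim) (fun t m _ => hZ.eq_of_src _ _))
    (fun e => e.elim)

/-- the fibre of a map lies in U -/
def FibIn (U : Set (DerivedCategory (ModuleCat.{0} R))) {Y Z : DerivedCategory (ModuleCat.{0} R)}
    (g : Y ⟶ Z) : Prop :=
  ∃ (X : _) (f : X ⟶ Y) (h : Z ⟶ X⟦(1 : ℤ)⟧), X ∈ U ∧ Triangle.mk f g h ∈ distTriang _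

lemma FibIn.comp (hU : IsCocompletePreaisle R U) {X Y Z : DerivedCategory (ModuleCat.{0} R)}
    {f : X ⟶ Y} {g : Y ⟶ Z} (hf : FibIn U f) (hg : FibIn U g) : FibIn U (f ≫ g) := by
  obtain ⟨A, a, a', hA, hTA⟩ := hf
  obtain ⟨B, b, b', hB, hTB⟩ := hg
  obtain ⟨E, e, e', hTE⟩ := distinguished_cocone_triangle₁ (f ≫ g)
  refine ⟨E, e, e', ?_, hTE⟩
  exact hU.ext_mem _ _ _ (Triangulated.someOctahedron' rfl hTA hTB hTE).mem hA hB

lemma FibIn.id (hU : IsCocompletePreaisle R U) (X : DerivedCategory (ModuleCat.{0} R)) :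
    FibIn U (𝟙 X) :=
  ⟨_, _, _, U_zero hU (isZero_zero _), contractible_distinguished₁ X⟩

lemma FibIn.coprod (hU : IsCocompletePreaisle R U) {ι : Type}
    {X Y : ι → DerivedCategory (ModuleCat.{0} R)} (f : ∀ i, X i ⟶ Y i) (h : ∀ i, FibIn U (f i)) :
    FibIn U (Limits.Sigma.map f) := by
  choose Z a c hZ hT using h
  obtain ⟨w, hw⟩ := coprod_tri _ _ _ a f c hT
  exact ⟨_, _, _, U_coprod hU _ hZ, hw⟩

/-- The key square argument. -/
lemma square (hU : IsCocompletePreaisle R U) {B Y C : DerivedCategory (ModuleCat.{0} R)}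
    {b : B ⟶ B} {u : B ⟶ Y} {w : Y ⟶ B⟦(1 : ℤ)⟧} (hb : Triangle.mk b u w ∈ distTriang _)
    (g : B ⟶ C) (hg : FibIn U g) (c : C ⟶ C) [IsIso c] (hc : b ≫ g = g ≫ c) : Y ∈ U := by
  obtain ⟨A, a, a', hA, hTA⟩ := hg
  obtain ⟨F, f, f', hF⟩ := distinguished_cocone_triangle₁ b
  have h13 : Triangle.mk a (b ≫ g) (inv c ≫ a') ∈ distTriang _ :=
    tri_iso hTA (Iso.refl _) (Iso.refl _) (asIso (inv c)) (by simp) (by simp [hc]) (by simp)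
  have hT := (Triangulated.someOctahedron' rfl hF hTA h13).mem
  have hF1 : F⟦(1 : ℤ)⟧ ∈ U := U_cone hU (tri_rot hT) hA hA
  let e := isoTriangleOfIso₁₂ _ _ (tri_rot hF) hb (Iso.refl B) (Iso.refl B)
    ((Category.comp_id b).trans (Category.id_comp b).symm)
  exact hU.mem_of_iso (Triangle.π₃.mapIso e) hF1

lemma bij_of_pow {M : Type} [AddCommGroup M] [Module R M] (T : M →ₗ[R] M) (n : ℕ)
    (h : T ^ n = 0) : Function.Bijective ((1 : Module.End R M) - T) := by
  have h1 := mul_neg_geom_sum T n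
  have h2 := geom_sum_mul_neg T n
  rw [h, sub_zero] at h1 h2
  refine Function.bijective_iff_has_inverse.2 ⟨(∑ i ∈ Finset.range n, T ^ i : Module.End R M),
    fun x => ?_, fun x => ?_⟩
  · exact congr($h2 x)
  · exact congr($h1 x)

lemma isIso_tele (Y : ℕ → DerivedCategory (ModuleCat.{0} R)) (θ : ∀ n, Y n ⟶ Y (n + 1))
    (hv : ∀ k : ℤ, ∃ n0, ∀ n ≥ n0, IsZero ((homologyFunctor (ModuleCat.{0} R) k).obj (Y n))) :
    IsIso (𝟙 (∐ Y) - Limits.Sigma.desc (fun n => θ n ≫ Sigma.ι Y (n + 1))) := by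
  set σ : ∐ Y ⟶ ∐ Y := Limits.Sigma.desc (fun n => θ n ≫ Sigma.ι Y (n + 1)) with hσ
  have hι : ∀ n, Sigma.ι Y n ≫ σ = θ n ≫ Sigma.ι Y (n + 1) := fun n => by simp [hσ]
  rw [DerivedCategory.isIso_iff]
  intro k
  obtain ⟨n0, h0⟩ := hv k
  let H := homologyFunctor (ModuleCat.{0} R) k
  let T : Module.End R (H.obj (∐ Y)) := (H.map σ).hom
  have hT1 : ∀ (n : ℕ) (y : H.obj (Y n)), T ((H.map (Sigma.ι Y n)).hom y) =
      (H.map (Sigma.ι Y (n + 1))).hom ((H.map (θ n)).hom y) := fun n y => by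
    have := congr((H.map $(hι n)).hom y)
    rw [H.map_comp, H.map_comp] at this
    exact this
  have hT2 : ∀ (N n : ℕ) (y : H.obj (Y n)), ∃ y' : H.obj (Y (n + N)),
      (T ^ N) ((H.map (Sigma.ι Y n)).hom y) = (H.map (Sigma.ι Y (n + N))).hom y' := by
    intro N
    induction N with
    | zero => intro n y; exact ⟨y, rfl⟩
    | succ N ih =>
      intro n y
      obtain ⟨y', hy'⟩ := ih n y
      refine ⟨(H.map (θ (n + N))).hom y', ?_⟩
      rw [pow_succ', Module.End.mul_apply, hy', hT1]
      rfl
  have hT3 : T ^ n0 = 0 := by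
    ext z
    obtain ⟨s, y, hz⟩ := span_H Y k z
    rw [hz, map_sum]
    refine Finset.sum_eq_zero fun i _ => ?_
    obtain ⟨y', hy'⟩ := hT2 n0 i (y i)
    refine hy'.trans ?_
    have : Subsingleton (H.obj (Y (i + n0))) :=
      ModuleCat.subsingleton_of_isZero (h0 _ (Nat.le_add_left _ _))
    rw [Subsingleton.elim y' 0, map_zero]
  have := bij_of_pow T n0 hT3
  rw [Functor.map_sub, ConcreteCategory.isIso_iff_bijective, CategoryTheory.Functor.map_id]
  exact this

lemma tele_mem (hU : IsCocompletePreaisle R U) (Y : ℕ → DerivedCategory (ModuleCat.{0} R))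
    (θ : ∀ n, Y n ⟶ Y (n + 1)) (hθ : ∀ n, FibIn U (θ n))
    (hv : ∀ k : ℤ, ∃ n0, ∀ n ≥ n0, IsZero ((homologyFunctor (ModuleCat.{0} R) k).obj (Y n))) :
    Y 0 ∈ U := by
  let g : ∀ n, Y 0 ⟶ Y n := fun n => Nat.rec (𝟙 _) (fun n f => f ≫ θ n) n
  have hg : ∀ n, FibIn U (g n) := by
    intro n
    induction n with
    | zero => exact FibIn.id hU _
    | succ n ih => exact ih.comp hU (hθ n)
  have hgs : ∀ n, g (n + 1) = g n ≫ θ n := fun n => rfl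
  have := isIso_tele Y θ hv
  refine square hU (retract_tri (𝟙 (Y 0)) (𝟙 (Y 0)) (by simp)) (Limits.Sigma.map g)
    (FibIn.coprod hU g hg) (𝟙 (∐ Y) - Limits.Sigma.desc (fun n => θ n ≫ Sigma.ι Y (n + 1))) ?_
  apply Sigma.hom_ext
  intro n
  simp [hgs]

end preaisle
end Stmt10


namespace Stmt10
section res
variable {R : Type} [CommRing R] [HasDerivedCategory.{w} (ModuleCat.{0} R)]
open DerivedCategory
variable {U : Set (DerivedCategory (ModuleCat.{0} R))}

lemma FibIn.ofIso (hU : IsCocompletePreaisle R U) {X Y : DerivedCategory (ModuleCat.{0} R)}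
    (e : X ≅ Y) : FibIn U e.hom := by
  obtain ⟨Z, a, c, hZ, hT⟩ := FibIn.id hU X
  refine ⟨Z, a, e.inv ≫ c, hZ, tri_iso hT (Iso.refl _) (Iso.refl _) e.symm (by simp) (by simp)
    (by simp)⟩

lemma FibIn.shift (hU : IsCocompletePreaisle R U) {X Y : DerivedCategory (ModuleCat.{0} R)}
    (g : X ⟶ Y) (hg : FibIn U g) : FibIn U (g⟦(1 : ℤ)⟧') := by
  obtain ⟨Z, a, c, hZ, hT⟩ := hg
  have h1 : FibIn U (-g⟦(1 : ℤ)⟧') :=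
    ⟨_, _, _, hU.shift_mem hZ, tri_rot (tri_rot (tri_rot hT))⟩
  have h2 := h1.comp hU (FibIn.ofIso hU (⟨-𝟙 _, -𝟙 _, by simp, by simp⟩ : Y⟦(1 : ℤ)⟧ ≅ Y⟦(1 : ℤ)⟧))
  simpa using h2

/-- iterated shift -/
noncomputable def shF (R : Type) [CommRing R] [HasDerivedCategory.{w} (ModuleCat.{0} R)] :
    ℕ → (DerivedCategory (ModuleCat.{0} R) ⥤ DerivedCategory (ModuleCat.{0} R))
  | 0 => 𝟭 _
  | n + 1 => shiftFunctor _ (1 : ℤ) ⋙ shF R n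

lemma FibIn.shF (hU : IsCocompletePreaisle R U) (n : ℕ) : ∀ {X Y : DerivedCategory (ModuleCat.{0} R)}
    (g : X ⟶ Y) (_ : FibIn U g), FibIn U ((shF R n).map g) := by
  induction n with
  | zero => intro X Y g hg; exact hg
  | succ n ih => intro X Y g hg; exact ih (g⟦(1 : ℤ)⟧') (hg.shift hU)

lemma isZero_shift (X : DerivedCategory (ModuleCat.{0} R)) (k : ℤ)
    (h : IsZero ((homologyFunctor (ModuleCat.{0} R) (k + 1)).obj X)) :
    IsZero ((homologyFunctor (ModuleCat.{0} R) k).obj (X⟦(1 : ℤ)⟧)) :=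
  h.of_iso (((homologyFunctor (ModuleCat.{0} R) 0).shiftIso 1 k (k + 1) (by lia)).app X)

lemma isZero_shF (n : ℕ) : ∀ (X : DerivedCategory (ModuleCat.{0} R)) (k : ℤ)
    (_ : IsZero ((homologyFunctor (ModuleCat.{0} R) (k + n)).obj X)),
    IsZero ((homologyFunctor (ModuleCat.{0} R) k).obj ((shF R n).obj X)) := by
  induction n with
  | zero =>
    intro X k h
    have h1 : IsZero ((homologyFunctor (ModuleCat.{0} R) k).obj X) := by simpa using h
    exact h1
  | succ n ih =>
    intro X k h
    refine ih _ _ (isZero_shift _ _ ?_)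
    convert h using 3
    push_cast
    ring

lemma isZero_HQ (A : CochainComplex (ModuleCat.{0} R) ℤ) (k : ℤ) (h : IsZero (A.homology k)) :
    IsZero ((homologyFunctor (ModuleCat.{0} R) k).obj (Q.obj A)) :=
  h.of_iso ((homologyFunctorFactors (ModuleCat.{0} R) k).app A)

lemma ses_tri {A' G A : CochainComplex (ModuleCat.{0} R) ℤ} (f : A' ⟶ G) (g : G ⟶ A)
    (w : f ≫ g = 0) (hS : (ShortComplex.mk f g w).ShortExact) :
    ∃ δ, Triangle.mk (Q.map f) (Q.map g) δ ∈ distTriang (DerivedCategory (ModuleCat.{0} R)) :=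
  ⟨_, triangleOfSES_distinguished hS⟩

lemma res_mem (hU : IsCocompletePreaisle R U) (𝒞 : CochainComplex (ModuleCat.{0} R) ℤ → Prop)
    (b : ℤ) (hb : ∀ A, 𝒞 A → ∀ k, b < k → IsZero (A.homology k))
    (h : ∀ A, 𝒞 A → ∃ (A' G : CochainComplex (ModuleCat.{0} R) ℤ) (f : A' ⟶ G) (g : G ⟶ A)
      (w : f ≫ g = 0), (ShortComplex.mk f g w).ShortExact ∧ 𝒞 A' ∧ Q.obj G ∈ U)
    (A : CochainComplex (ModuleCat.{0} R) ℤ) (hA : 𝒞 A) : Q.obj A ∈ U := by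
  have h' : ∀ A : {A // 𝒞 A}, ∃ (A' : {A // 𝒞 A}) (δ : Q.obj A.1 ⟶ (Q.obj A'.1)⟦(1 : ℤ)⟧),
      FibIn U δ := by
    rintro ⟨A, hA⟩
    obtain ⟨A', G, f, g, w, hS, hA', hG⟩ := h A hA
    obtain ⟨δ, hδ⟩ := ses_tri f g w hS
    exact ⟨⟨A', hA'⟩, δ, _, _, _, hG, tri_rot hδ⟩
  choose st δ hδ using h'
  let a : ℕ → {A // 𝒞 A} := fun n => Nat.rec ⟨A, hA⟩ (fun _ x => st x) n
  refine tele_mem hU (fun n => (shF R n).obj (Q.obj (a n).1)) (fun n => (shF R n).map (δ (a n)))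
    (fun n => FibIn.shF hU n _ (hδ _)) (fun k => ⟨(b - k + 1).toNat, fun n hn => ?_⟩)
  apply isZero_shF
  apply isZero_HQ
  apply hb _ (a n).2
  lia

end res
end Stmt10


namespace Stmt10
section proj

lemma quasiIso_of_op {C : Type*} [Category* C] [Abelian C] {K L : CochainComplex C ℤ} (g : K ⟶ L)
    (h : QuasiIso ((CochainComplex.opEquivalence C).functor.map g.op)) : QuasiIso g := by
  rw [quasiIso_iff] at h ⊢
  intro j
  obtain ⟨m, rfl⟩ : ∃ m, j = -m := ⟨-j, by simp⟩
  have := h m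
  rw [quasiIsoAt_iff' _ (m - 1) m (m + 1) (by simp) (by simp)] at this
  rw [quasiIsoAt_iff' _ (-(m + 1)) (-m) (-(m - 1)) (by simp; ring) (by simp; ring)]
  exact (ShortComplex.quasiIso_opMap_iff _).1 this

lemma exists_proj {C : Type*} [Category* C] [Abelian C] [EnoughProjectives C]
    (K : CochainComplex C ℤ) (b : ℤ) (hK : K.IsStrictlyLE b) :
    ∃ (P : CochainComplex C ℤ) (g : P ⟶ K), QuasiIso g ∧ (∀ i, Projective (P.X i)) ∧
      ∀ i, b < i → IsZero (P.X i) := by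
  let F := (CochainComplex.opEquivalence C).functor
  let K' := F.obj (Opposite.op K)
  have hK' : K'.IsStrictlyGE (-b) := by
    rw [CochainComplex.isStrictlyGE_iff]
    intro i hi
    have : IsZero (K.X (-i)) := CochainComplex.isZero_of_isStrictlyLE K b (-i) (by lia)
    exact this.op
  obtain ⟨L, i, hi, hL, hL'⟩ := CochainComplex.Plus.modelCategoryQuillen.exists_quasiIso_injective K' (-b)
  let P := ((CochainComplex.opEquivalence C).inverse.obj L).unop
  let e : F.obj (Opposite.op P) ≅ L := (CochainComplex.opEquivalence C).counitIso.app L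
  obtain ⟨g, hg⟩ := F.map_surjective (i ≫ e.inv)
  have hPX : ∀ n, P.X n = (L.X (-n)).unop := fun n => rfl
  refine ⟨P, g.unop, ?_, ?_, ?_⟩
  · apply quasiIso_of_op
    rw [Quiver.Hom.op_unop]
    change QuasiIso (F.map g)
    rw [hg]
    infer_instance
  · intro n
    rw [hPX]
    have := hL (-n)
    infer_instance
  · intro n hn
    rw [hPX]
    exact (CochainComplex.isZero_of_isStrictlyGE L (-b) (-n) (by lia)).unop

variable {R : Type} [CommRing R] [HasDerivedCategory.{w} (ModuleCat.{0} R)]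
open DerivedCategory

lemma exists_resolution (S : DerivedCategory (ModuleCat.{0} R)) (hS : memDqc R S) :
    ∃ (P : CochainComplex (ModuleCat.{0} R) ℤ) (b : ℤ), (∀ i, Module.Flat R (P.X i)) ∧
      (∀ i, b < i → IsZero (P.X i)) ∧ Nonempty (Q.obj P ≅ S) := by
  obtain ⟨c, hc⟩ := hS.2.bddBelow
  have hb : S.IsLE (-c) := by
    rw [isLE_iff]
    intro i hi
    by_contra h
    have h2 : -i ∈ {n : ℤ | ¬ IsZero (Hh R n S)} := by
      simpa [Hh] using h
    have := hc h2
    lia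
  obtain ⟨K, hK, ⟨e⟩⟩ := exists_iso_Q_obj_of_isLE S (-c)
  obtain ⟨P, g, hg, hP, hP'⟩ := exists_proj K (-c) hK
  refine ⟨P, -c, fun i => ?_, hP', ⟨asIso (Q.map g) ≪≫ e.symm⟩⟩
  have := (IsProjective.iff_projective (P.X i)).2 (hP i)
  infer_instance

end proj
end Stmt10


namespace Stmt10
section tensor
open TensorProduct
variable {R : Type} [CommRing R]

/-- the complex `M ⊗ P` -/
noncomputable def tens (M : Type) [AddCommGroup M] [Module R M]
    (P : CochainComplex (ModuleCat.{0} R) ℤ) : CochainComplex (ModuleCat.{0} R) ℤ where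
  X i := ModuleCat.of R (M ⊗[R] P.X i)
  d i j := ModuleCat.ofHom ((P.d i j).hom.lTensor M)
  shape i j h := by
    rw [P.shape i j h]
    ext
    simp
  d_comp_d' i j k _ _ := by
    rw [← ModuleCat.ofHom_comp, ← LinearMap.lTensor_comp, ← ModuleCat.hom_comp, P.d_comp_d]
    ext
    simp

variable {M N L : Type} [AddCommGroup M] [Module R M] [AddCommGroup N] [Module R N]
  [AddCommGroup L] [Module R L]

/-- functoriality in `M` -/
noncomputable def tensMap (f : M →ₗ[R] N) (P : CochainComplex (ModuleCat.{0} R) ℤ) :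
    tens M P ⟶ tens N P where
  f i := ModuleCat.ofHom (f.rTensor (P.X i))
  comm' i j _ := by
    ext x
    have h : (P.d i j).hom.lTensor N ∘ₗ f.rTensor _ = f.rTensor _ ∘ₗ (P.d i j).hom.lTensor M := by
      rw [LinearMap.lTensor_comp_rTensor, LinearMap.rTensor_comp_lTensor]
    exact congr($h x)

lemma tens_ses (P : CochainComplex (ModuleCat.{0} R) ℤ) (hP : ∀ i, Module.Flat R (P.X i))
    (f : M →ₗ[R] N) (g : N →ₗ[R] L) (hf : Function.Injective f) (hfg : Function.Exact f g)
    (hg : Function.Surjective g) :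
    ∃ w : tensMap f P ≫ tensMap g P = 0,
      (ShortComplex.mk (tensMap f P) (tensMap g P) w).ShortExact := by
  have w : tensMap f P ≫ tensMap g P = 0 := by
    ext i x
    have h : g.rTensor (P.X i) ∘ₗ f.rTensor (P.X i) = 0 := by
      rw [← LinearMap.rTensor_comp, hfg.linearMap_comp_eq_zero, LinearMap.rTensor_zero]
    exact congr($h x)
  refine ⟨w, HomologicalComplex.shortExact_of_degreewise_shortExact _ fun i => ?_⟩
  have := hP i
  have h1 : Function.Injective (f.rTensor (P.X i)) :=
    Module.Flat.rTensor_preserves_injective_linearMap f hf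
  have h2 := rTensor_exact (P.X i) hfg hg
  have h3 := LinearMap.rTensor_surjective (P.X i) hg
  exact ShortComplex.ShortExact.mk' ((ShortComplex.ShortExact.moduleCat_exact_iff_function_exact _).2 h2)
    ((ModuleCat.mono_iff_injective _).2 h1) ((ModuleCat.epi_iff_surjective _).2 h3)

/-- the inclusion of the i-th summand -/
noncomputable def tensInc {ι : Type} (P : CochainComplex (ModuleCat.{0} R) ℤ) (i : ι) :
    P ⟶ tens (ι →₀ R) P where
  f n := ModuleCat.ofHom (TensorProduct.mk R (ι →₀ R) (P.X n) (Finsupp.single i 1))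
  comm' n m _ := by
    ext x
    rfl

/-- universal map -/
noncomputable def tensDesc {ι : Type} (P T : CochainComplex (ModuleCat.{0} R) ℤ)
    (s : ι → (P ⟶ T)) : tens (ι →₀ R) P ⟶ T where
  f n := ModuleCat.ofHom (TensorProduct.lift (Finsupp.lsum R fun i =>
    LinearMap.toSpanSingleton R (P.X n →ₗ[R] T.X n) ((s i).f n).hom))
  comm' n m _ := by
    apply ModuleCat.hom_ext
    refine TensorProduct.ext (Finsupp.lhom_ext fun i r => ?_)
    ext x
    have := congr(($((s i).comm n m)).hom x)
    have h2 : (T.d n m).hom (((s i).f n).hom x) = ((s i).f m).hom ((P.d n m).hom x) := this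
    change (T.d n m).hom (TensorProduct.lift (Finsupp.lsum R fun i =>
        LinearMap.toSpanSingleton R (P.X n →ₗ[R] T.X n) ((s i).f n).hom)
          (Finsupp.single i r ⊗ₜ[R] x)) =
      TensorProduct.lift (Finsupp.lsum R fun i =>
        LinearMap.toSpanSingleton R (P.X m →ₗ[R] T.X m) ((s i).f m).hom)
          (Finsupp.single i r ⊗ₜ[R] (P.d n m).hom x)
    simp [h2]

noncomputable def tensIsColimit {ι : Type} (P : CochainComplex (ModuleCat.{0} R) ℤ) :
    IsColimit (Cofan.mk (tens (ι →₀ R) P) (tensInc P) : Cofan (fun _ : ι => P)) :=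
  Cofan.IsColimit.mk _ (fun t => tensDesc P t.pt t.inj)
    (fun t i => by
      ext n x
      change TensorProduct.lift (Finsupp.lsum R fun i =>
        LinearMap.toSpanSingleton R (P.X n →ₗ[R] t.pt.X n) ((t.inj i).f n).hom)
          (Finsupp.single i 1 ⊗ₜ[R] x) = ((t.inj i).f n).hom x
      simp)
    (fun t m hm => by
      ext n : 1
      apply ModuleCat.hom_ext
      refine TensorProduct.ext (Finsupp.lhom_ext fun i r => ?_)
      ext x
      have h1 := congr((($(hm i)).f n).hom x)
      have h2 : (m.f n).hom ((Finsupp.single i (1 : R)) ⊗ₜ[R] x) = ((t.inj i).f n).hom x := h1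
      change (m.f n).hom ((Finsupp.single i r) ⊗ₜ[R] x) = TensorProduct.lift (Finsupp.lsum R fun i =>
        LinearMap.toSpanSingleton R (P.X n →ₗ[R] t.pt.X n) ((t.inj i).f n).hom)
          (Finsupp.single i r ⊗ₜ[R] x)
      have h3 : (Finsupp.single i r) ⊗ₜ[R] x = r • ((Finsupp.single i (1 : R)) ⊗ₜ[R] x) := by
        rw [TensorProduct.smul_tmul', Finsupp.smul_single, smul_eq_mul, mul_one]
      rw [h3]
      refine ((m.f n).hom.map_smul _ _).trans ?_
      rw [h2]
      simp)

variable [HasDerivedCategory.{w} (ModuleCat.{0} R)]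
open DerivedCategory
variable {U : Set (DerivedCategory (ModuleCat.{0} R))}

lemma tens_free_mem (hU : IsCocompletePreaisle R U) (P : CochainComplex (ModuleCat.{0} R) ℤ)
    (hP : Q.obj P ∈ U) (ι : Type) : Q.obj (tens (ι →₀ R) P) ∈ U := by
  have h1 : Q.obj (∐ fun _ : ι => P) ∈ U :=
    hU.coproduct_mem _ _ (qIsColimit (fun _ : ι => P)) (fun _ => hP)
  exact hU.mem_of_iso (Q.mapIso ((coproductIsCoproduct (fun _ : ι => P)).coconePointUniqueUpToIso
    (tensIsColimit P))) h1

lemma tens_mem (hU : IsCocompletePreaisle R U) (P : CochainComplex (ModuleCat.{0} R) ℤ)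
    (hP : Q.obj P ∈ U) (hflat : ∀ i, Module.Flat R (P.X i)) (b : ℤ)
    (hb : ∀ i, b < i → IsZero (P.X i)) (M : Type) [AddCommGroup M] [Module R M] :
    Q.obj (tens M P) ∈ U := by
  refine res_mem hU (fun A => ∃ M : ModuleCat.{0} R, A = tens M P) b ?_ ?_ _
    ⟨ModuleCat.of R M, rfl⟩
  · rintro _ ⟨M, rfl⟩ k hk
    refine ShortComplex.isZero_homology_of_isZero_X₂ _ ?_
    have : Subsingleton (P.X k) := ModuleCat.subsingleton_of_isZero (hb k hk)
    exact @ModuleCat.isZero_of_subsingleton R _ (ModuleCat.of R (M ⊗[R] P.X k))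
      (inferInstanceAs (Subsingleton (M ⊗[R] P.X k)))
  · rintro _ ⟨M, rfl⟩
    let g : (M →₀ R) →ₗ[R] M := Finsupp.linearCombination R id
    have hg : Function.Surjective g := Finsupp.linearCombination_id_surjective R M
    obtain ⟨w, hw⟩ := tens_ses (M := LinearMap.ker g) (N := M →₀ R) (L := M) P hflat (LinearMap.ker g).subtype g
      (Submodule.subtype_injective _) (LinearMap.exact_subtype_ker_map g) hg
    exact ⟨_, _, _, _, w, hw, ⟨ModuleCat.of R (LinearMap.ker g), rfl⟩, tens_free_mem hU P hP M⟩

end tensor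
end Stmt10


namespace Stmt10
section nak
open TensorProduct
variable {R : Type} [CommRing R]

/-- exactness of `M ⊗ P` at `j` -/
def Ex (P : CochainComplex (ModuleCat.{0} R) ℤ) (i j k : ℤ) (M : Type) [AddCommGroup M]
    [Module R M] : Prop :=
  ∀ x : M ⊗[R] P.X j, (P.d j k).hom.lTensor M x = 0 →
    ∃ y : M ⊗[R] P.X i, (P.d i j).hom.lTensor M y = x

variable (P : CochainComplex (ModuleCat.{0} R) ℤ)

lemma dd (M : Type) [AddCommGroup M] [Module R M] (i j k : ℤ) (x : M ⊗[R] P.X i) :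
    (P.d j k).hom.lTensor M ((P.d i j).hom.lTensor M x) = 0 := by
  rw [← LinearMap.comp_apply, ← LinearMap.lTensor_comp, ← ModuleCat.hom_comp, P.d_comp_d]
  simp

variable {M N L : Type} [AddCommGroup M] [Module R M] [AddCommGroup N] [Module R N]
  [AddCommGroup L] [Module R L]

lemma dnat (f : M →ₗ[R] N) (i j : ℤ) (x : M ⊗[R] P.X i) :
    (P.d i j).hom.lTensor N (f.rTensor _ x) = f.rTensor _ ((P.d i j).hom.lTensor M x) := by
  rw [← LinearMap.comp_apply, ← LinearMap.comp_apply, LinearMap.lTensor_comp_rTensor,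
    LinearMap.rTensor_comp_lTensor]

lemma lift_cycle (hP : ∀ i, Module.Flat R (P.X i)) (f : M →ₗ[R] N) (g : N →ₗ[R] L)
    (hf : Function.Injective f) (hfg : Function.Exact f g) (hg : Function.Surjective g)
    (j k l : ℤ) (hE : Ex P j k l M) (x : L ⊗[R] P.X j)
    (hx : (P.d j k).hom.lTensor L x = 0) :
    ∃ y : N ⊗[R] P.X j, (P.d j k).hom.lTensor N y = 0 ∧ g.rTensor _ y = x := by
  obtain ⟨y, rfl⟩ := LinearMap.rTensor_surjective (P.X j) hg x
  rw [dnat] at hx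
  obtain ⟨u, hu⟩ := (rTensor_exact (P.X k) hfg hg _).1 hx
  have := hP l
  have h0 : (P.d k l).hom.lTensor M u = 0 := by
    apply Module.Flat.rTensor_preserves_injective_linearMap (M := P.X l) f hf
    rw [← dnat, hu, dd, map_zero]
  obtain ⟨v, rfl⟩ := hE u h0
  refine ⟨y - f.rTensor _ v, ?_, ?_⟩
  · rw [map_sub, dnat, hu, sub_self]
  · rw [map_sub, (rTensor_exact (P.X j) hfg hg _).2 ⟨v, rfl⟩, sub_zero]

open Classical in
lemma finsupp_decomp {ι : Type} (j : ℤ) (v : (ι →₀ M) ⊗[R] P.X j) :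
    ∃ s : Finset ι, v = ∑ i ∈ s, (Finsupp.lsingle i).rTensor (P.X j)
      ((Finsupp.lapply (R := R) (M := M) i).rTensor (P.X j) v) := by
  let e := TensorProduct.finsuppLeft R R M (P.X j) ι
  refine ⟨(e v).support, e.injective ?_⟩
  ext i
  rw [map_sum, Finsupp.finsetSum_apply]
  have h1 : ∀ k, e ((Finsupp.lsingle k).rTensor (P.X j)
      ((Finsupp.lapply (R := R) (M := M) k).rTensor (P.X j) v)) i = if k = i then e v i else 0 := by
    intro k
    rw [TensorProduct.finsuppLeft_apply, ← LinearMap.comp_apply, ← LinearMap.rTensor_comp]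
    split_ifs with h
    · subst h
      rw [TensorProduct.finsuppLeft_apply]
      have : (Finsupp.lapply (R := R) (M := M) k) ∘ₗ Finsupp.lsingle k = LinearMap.id := by
        ext; simp
      rw [this]; simp
    · have : (Finsupp.lapply (R := R) (M := M) i) ∘ₗ Finsupp.lsingle k = 0 := by
        ext; simp [h]
      rw [this]; simp
  simp only [h1]
  rw [Finset.sum_ite_eq' ]
  split_ifs with h
  · rfl
  · simpa using h

lemma ex_finsupp {ι : Type} (i j k : ℤ) (h : Ex P i j k M) : Ex P i j k (ι →₀ M) := by
  intro x hx
  obtain ⟨s, hs⟩ := finsupp_decomp P j x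
  have : ∀ a : ι, ∃ y : M ⊗[R] P.X i, (P.d i j).hom.lTensor M y =
      (Finsupp.lapply (R := R) (M := M) a).rTensor (P.X j) x := fun a =>
    h _ (by rw [dnat, hx, map_zero])
  choose y hy using this
  refine ⟨∑ a ∈ s, (Finsupp.lsingle a).rTensor (P.X i) (y a), ?_⟩
  rw [map_sum]
  conv_rhs => rw [hs]
  exact Finset.sum_congr rfl fun a _ => by rw [dnat, hy]

section loc
variable (A : Type) [CommRing A] [Algebra R A]

lemma ex_all (hP : ∀ i, Module.Flat R (P.X i)) (i j k l : ℤ)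
    (hA : Ex P i j k A)
    (ih : ∀ (M : Type) [AddCommGroup M] [Module R M] [Module A M] [IsScalarTower R A M],
      Ex P j k l M)
    (M : Type) [AddCommGroup M] [Module R M] [Module A M] [IsScalarTower R A M] :
      Ex P i j k M := by
  intro x hx
  let g : (M →₀ A) →ₗ[A] M := Finsupp.linearCombination A id
  have hg : Function.Surjective g := Finsupp.linearCombination_id_surjective A M
  obtain ⟨y, hy, rfl⟩ := lift_cycle (M := LinearMap.ker g) P hP
    ((LinearMap.ker g).subtype.restrictScalars R) (g.restrictScalars R)
    (Submodule.subtype_injective _) (LinearMap.exact_subtype_ker_map g) hg j k l (ih _) x hx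
  obtain ⟨z, rfl⟩ := ex_finsupp P i j k hA y hy
  exact ⟨_, dnat P _ _ _ z⟩

end loc
end nak
end Stmt10


namespace Stmt10
section nak
open TensorProduct
variable {R : Type} [CommRing R]
variable (P : CochainComplex (ModuleCat.{0} R) ℤ)
variable (A : Type) [CommRing A] [Algebra R A]

lemma d_smul (i j : ℤ) (a : A) (x : A ⊗[R] P.X i) :
    (P.d i j).hom.lTensor A (a • x) = a • (P.d i j).hom.lTensor A x :=
  ((P.d i j).hom.baseChange A).map_smul a x

/-- localization: cycles of `A ⊗ P` come from cycles of `P` -/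
lemma loc_cycle (q : Ideal R) [q.IsPrime] [IsLocalization.AtPrime A q] (j k : ℤ)
    (x : A ⊗[R] P.X j) (hx : (P.d j k).hom.lTensor A x = 0) :
    ∃ s : q.primeCompl, ∃ y : P.X j, (P.d j k).hom y = 0 ∧ s • x = (1 : A) ⊗ₜ[R] y := by
  have I : ∀ n, IsLocalizedModule q.primeCompl (TensorProduct.mk R A (P.X n) 1) := fun n =>
    inferInstance
  obtain ⟨⟨y, s⟩, h⟩ := (I j).surj x
  have h : s • x = (1 : A) ⊗ₜ[R] y := h
  have h2 : TensorProduct.mk R A (P.X k) 1 ((P.d j k).hom y) =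
      TensorProduct.mk R A (P.X k) 1 0 := by
    have := congr((P.d j k).hom.lTensor A $h)
    rw [LinearMap.lTensor_tmul, Submonoid.smul_def, map_smul, hx, smul_zero] at this
    simpa using this.symm
  obtain ⟨c, hc⟩ := (I k).exists_of_eq h2
  refine ⟨c * s, c • y, ?_, ?_⟩
  · rw [Submonoid.smul_def, map_smul]
    exact hc.trans (smul_zero c)
  · rw [mul_smul, h, Submonoid.smul_def, Submonoid.smul_def]
    simp

lemma ex_nak (q : Ideal R) [q.IsPrime] [IsLocalization.AtPrime A q] [IsLocalRing A]
    (hP : ∀ i, Module.Flat R (P.X i)) (i j k l : ℤ)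
    (ih : ∀ (M : Type) [AddCommGroup M] [Module R M] [Module A M] [IsScalarTower R A M],
      Ex P j k l M)
    (hK : Ex P i j k (A ⧸ IsLocalRing.maximalIdeal A))
    (hfg : ∃ t : Finset (P.X j), (∀ y ∈ t, (P.d j k).hom y = 0) ∧
      ∀ y, (P.d j k).hom y = 0 → ∃ w, y - (P.d i j).hom w ∈ Submodule.span R (t : Set (P.X j))) :
    Ex P i j k A := by
  classical
  obtain ⟨t, ht, hsp⟩ := hfg
  let 𝔪 := IsLocalRing.maximalIdeal A
  let Z : Submodule A (A ⊗[R] P.X j) := LinearMap.ker ((P.d j k).hom.baseChange A)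
  let B : Submodule A (A ⊗[R] P.X j) := LinearMap.range ((P.d i j).hom.baseChange A)
  let F : Submodule A (A ⊗[R] P.X j) :=
    Submodule.span A ((t.image fun y => (1 : A) ⊗ₜ[R] y : Finset (A ⊗[R] P.X j)) : Set _)
  have hF : F.FG := ⟨_, rfl⟩
  have hFZ : F ≤ Z := by
    refine Submodule.span_le.2 ?_
    intro x hx
    simp only [Finset.coe_image, Set.mem_image, Finset.mem_coe] at hx
    obtain ⟨y, hy, rfl⟩ := hx
    change (P.d j k).hom.lTensor A _ = 0
    rw [LinearMap.lTensor_tmul, ht y hy, tmul_zero]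
  have hsF : ∀ y ∈ Submodule.span R (t : Set (P.X j)), (1 : A) ⊗ₜ[R] y ∈ F := by
    intro y hy
    induction hy using Submodule.span_induction with
    | mem y hy => exact Submodule.subset_span (by simpa using ⟨y, hy, rfl⟩)
    | zero => simp
    | add x y _ _ hx hy => rw [tmul_add]; exact F.add_mem hx hy
    | smul a x _ hx =>
      rw [tmul_smul, ← algebraMap_smul A]
      exact F.smul_mem _ hx
  have hZ : Z ≤ B ⊔ F := by
    intro x hx
    obtain ⟨s, y, hy, h⟩ := loc_cycle P A q j k x hx
    obtain ⟨w, hw⟩ := hsp y hy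
    have h1 : (1 : A) ⊗ₜ[R] y ∈ B ⊔ F := by
      have : (1 : A) ⊗ₜ[R] y = (1 : A) ⊗ₜ[R] ((P.d i j).hom w) +
        (1 : A) ⊗ₜ[R] (y - (P.d i j).hom w) := by rw [← tmul_add, add_sub_cancel]
      rw [this]
      exact Submodule.add_mem_sup ⟨(1 : A) ⊗ₜ[R] w, rfl⟩ (hsF _ hw)
    obtain ⟨u, hu⟩ := IsLocalization.map_units A s
    have h2 : x = (↑u⁻¹ : A) • ((1 : A) ⊗ₜ[R] y) := by
      rw [← h, Submonoid.smul_def, ← algebraMap_smul A (s : R) x, ← hu, smul_smul]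
      simp
    rw [h2]
    exact Submodule.smul_mem _ _ h1
  have hZ2 : Z ≤ B ⊔ 𝔪 • Z := by
    intro x hx
    have hx' : (P.d j k).hom.lTensor A x = 0 := hx
    let π : A →ₗ[A] (A ⧸ 𝔪) := 𝔪.mkQ
    have hπ : Function.Surjective π := 𝔪.mkQ_surjective
    obtain ⟨w, hw⟩ := hK ((π.restrictScalars R).rTensor _ x) (by rw [dnat, hx', map_zero])
    obtain ⟨w, rfl⟩ := LinearMap.rTensor_surjective (g := π.restrictScalars R) (P.X i) hπ w
    have hex : Function.Exact (𝔪.subtype.restrictScalars R) (π.restrictScalars R) :=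
      LinearMap.exact_subtype_mkQ 𝔪
    rw [dnat] at hw
    obtain ⟨u, hu⟩ := (rTensor_exact (P.X j) hex hπ (x - (P.d i j).hom.lTensor A w)).1
      (by rw [map_sub, hw, sub_self])
    have hu0 : (P.d j k).hom.lTensor 𝔪 u = 0 := by
      have := hP k
      apply Module.Flat.rTensor_preserves_injective_linearMap (M := P.X k)
        (𝔪.subtype.restrictScalars R) (Submodule.subtype_injective _)
      rw [← dnat, hu, map_sub, dd, hx', map_zero, sub_zero]
    let g : (𝔪 →₀ A) →ₗ[A] 𝔪 := Finsupp.linearCombination A id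
    have hg : Function.Surjective g := Finsupp.linearCombination_id_surjective A 𝔪
    obtain ⟨v, hv, rfl⟩ := lift_cycle (M := LinearMap.ker g) P hP
      ((LinearMap.ker g).subtype.restrictScalars R) (g.restrictScalars R)
      (Submodule.subtype_injective _) (LinearMap.exact_subtype_ker_map g) hg j k l (ih _) u hu0
    obtain ⟨s, hs⟩ := finsupp_decomp P j v
    have hm : x - (P.d i j).hom.lTensor A w ∈ 𝔪 • Z := by
      rw [← hu, hs, map_sum, map_sum]
      refine Submodule.sum_mem _ fun a _ => ?_
      have e : ∀ z : A ⊗[R] P.X j, (𝔪.subtype.restrictScalars R).rTensor (P.X j)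
          ((g.restrictScalars R).rTensor (P.X j) ((Finsupp.lsingle a).rTensor (P.X j) z)) =
          (a : A) • z := by
        intro z
        induction z with
        | zero => simp
        | add x y hx hy => simp only [map_add, hx, hy, smul_add]
        | tmul b y =>
          simp only [LinearMap.rTensor_tmul]
          rw [smul_tmul']
          congr 1
          change ((g (Finsupp.single a b) : 𝔪) : A) = _
          simp [g, mul_comm]
      rw [e]
      refine Submodule.smul_mem_smul a.2 ?_
      change (P.d j k).hom.lTensor A _ = 0
      rw [dnat, hv, map_zero]
    have : x = (P.d i j).hom.lTensor A w + (x - (P.d i j).hom.lTensor A w) := by abel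
    rw [this]
    exact Submodule.add_mem_sup ⟨w, rfl⟩ hm
  have hFB : F ≤ B := by
    refine Submodule.le_of_le_smul_of_le_jacobson_bot (I := 𝔪) hF
      (IsLocalRing.maximalIdeal_le_jacobson _) ?_
    calc F ≤ Z := hFZ
      _ ≤ B ⊔ 𝔪 • Z := hZ2
      _ ≤ B ⊔ 𝔪 • (B ⊔ F) := sup_le_sup_left (smul_mono_right _ hZ) _
      _ ≤ B ⊔ 𝔪 • F := by
        rw [Submodule.smul_sup]
        exact sup_le le_sup_left (sup_le (Submodule.smul_le_right.trans le_sup_left) le_sup_right)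
  intro x hx
  have : x ∈ B := (hZ.trans (sup_le le_rfl hFB)) hx
  exact this

/-- the descending induction -/
lemma ex_down (q : Ideal R) [q.IsPrime] [IsLocalization.AtPrime A q] [IsLocalRing A]
    (hP : ∀ i, Module.Flat R (P.X i)) (b : ℤ) (hb : ∀ i, b < i → IsZero (P.X i))
    (hK : ∀ j : ℤ, 0 ≤ j → Ex P (j - 1) j (j + 1) (A ⧸ IsLocalRing.maximalIdeal A))
    (hfg : ∀ j : ℤ, ∃ t : Finset (P.X j), (∀ y ∈ t, (P.d j (j + 1)).hom y = 0) ∧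
      ∀ y, (P.d j (j + 1)).hom y = 0 →
        ∃ w, y - (P.d (j - 1) j).hom w ∈ Submodule.span R (t : Set (P.X j))) :
    Ex P (0 - 1) 0 (0 + 1) A := by
  have key : ∀ n : ℕ, ∀ j : ℤ, 0 ≤ j → b < j + n →
      ∀ (M : Type) [AddCommGroup M] [Module R M] [Module A M] [IsScalarTower R A M],
      Ex P (j - 1) j (j + 1) M := by
    intro n
    induction n with
    | zero =>
      intro j hj hbj M _ _ _ _ x hx
      have : Subsingleton (P.X j) := ModuleCat.subsingleton_of_isZero (hb j (by simpa using hbj))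
      exact ⟨0, Subsingleton.elim _ _⟩
    | succ n ihn =>
      intro j hj hbj
      have ih : ∀ (M : Type) [AddCommGroup M] [Module R M] [Module A M] [IsScalarTower R A M],
          Ex P j (j + 1) (j + 1 + 1) M := by
        intro M _ _ _ _
        have := ihn (j + 1) (by lia) (by push_cast at hbj; lia) M
        rwa [add_sub_cancel_right] at this
      intro M _ _ _ _
      exact ex_all P A hP _ _ _ _ (ex_nak P A q hP _ _ _ _ ih (hK j hj) (hfg j)) ih M
  exact key (b + 1).toNat 0 le_rfl (by lia) A

end nak
end Stmt10


namespace Stmt10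
section hom
open TensorProduct DerivedCategory
variable {R : Type} [CommRing R]

lemma sc_fg (T : ShortComplex (ModuleCat.{0} R)) (hT : Module.Finite R T.homology) :
    ∃ t : Finset T.X₂, (∀ y ∈ t, T.g.hom y = 0) ∧
      ∀ y, T.g.hom y = 0 →
        ∃ w, y - T.f.hom w ∈ Submodule.span R (t : Set T.X₂) := by
  classical
  have hfin : Module.Finite R (LinearMap.ker T.g.hom ⧸ LinearMap.range T.moduleCatToCycles) :=
    Module.Finite.equiv T.moduleCatHomologyIso.toLinearEquiv
  obtain ⟨t, ht⟩ := hfin.fg_top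
  let π := (LinearMap.range T.moduleCatToCycles).mkQ
  have hπ : Function.Surjective π := Submodule.mkQ_surjective _
  choose σ hσ using hπ
  refine ⟨t.image fun x => (σ x : T.X₂), ?_, ?_⟩
  · intro y hy
    obtain ⟨x, _, rfl⟩ := Finset.mem_image.1 hy
    exact (σ x).2
  · intro y hy
    let y' : LinearMap.ker T.g.hom := ⟨y, hy⟩
    have h1 : Submodule.span R (t.image σ : Set _) ⊔
        LinearMap.range T.moduleCatToCycles = ⊤ := by
      have h2 : (Submodule.span R (t.image σ : Set _)).map π = ⊤ := by
        rw [Submodule.map_span, ← ht]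
        congr 1
        ext x
        simp [hσ]
      have h3 := congr(Submodule.comap π $h2)
      rwa [Submodule.comap_map_eq, Submodule.ker_mkQ, Submodule.comap_top] at h3
    have h4 : y' ∈ Submodule.span R (t.image σ : Set _) ⊔
        LinearMap.range T.moduleCatToCycles := by
      rw [h1]; trivial
    obtain ⟨a, ha, b, ⟨w, hw⟩, hab⟩ := Submodule.mem_sup.1 h4
    refine ⟨w, ?_⟩
    have h5 : (b : T.X₂) = T.f.hom w := congr($(hw.symm).1)
    have h6 : (a : T.X₂) + b = y := congr($(hab).1)
    rw [← h5, ← h6, add_sub_cancel_right]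
    have h7 := Submodule.mem_map_of_mem (f := (LinearMap.ker T.g.hom).subtype) ha
    rw [Submodule.map_span] at h7
    have h8 : ((t.image fun x => (σ x : T.X₂) : Finset T.X₂) : Set T.X₂) =
        (LinearMap.ker T.g.hom).subtype '' (t.image σ : Finset _) := by
      ext x
      simp
    rw [h8]
    exact h7

lemma sc_ass [IsNoetherianRing R] (T : ShortComplex (ModuleCat.{0} R))
    (p : Ideal R) (hp : p ∈ associatedPrimes R ↥T.homology) :
    ∃ y : T.X₂, T.g.hom y = 0 ∧ ∀ (r : R) (w : T.X₁), r • y = T.f.hom w → r ∈ p := by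
  have hp2 : p ∈ associatedPrimes R (LinearMap.ker T.g.hom ⧸
      LinearMap.range T.moduleCatToCycles) := by
    have h : associatedPrimes R T.homology = associatedPrimes R (LinearMap.ker T.g.hom ⧸
      LinearMap.range T.moduleCatToCycles) :=
      LinearEquiv.AssociatedPrimes.eq T.moduleCatHomologyIso.toLinearEquiv
    rw [← h]
    exact hp
  obtain ⟨_, x, rfl⟩ := isAssociatedPrime_iff.1 hp2
  obtain ⟨y, rfl⟩ := Submodule.mkQ_surjective _ x
  refine ⟨y, y.2, fun r w h => ?_⟩
  rw [Submodule.mem_colon_singleton, Submodule.mem_bot, ← map_smul, Submodule.mkQ_apply,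
    Submodule.Quotient.mk_eq_zero]
  exact ⟨w, Subtype.ext h.symm⟩

variable [HasDerivedCategory.{w} (ModuleCat.{0} R)]

noncomputable def HhIso (P : CochainComplex (ModuleCat.{0} R) ℤ)
    (S : DerivedCategory (ModuleCat.{0} R)) (e : Q.obj P ≅ S) (n j : ℤ) (h : j = -n) :
    Hh R n S ≅ (P.sc' (j - 1) j (j + 1)).homology :=
  ((homologyFunctor (ModuleCat.{0} R) (-n)).mapIso e.symm).trans
    (((homologyFunctorFactors (ModuleCat.{0} R) (-n)).app P).trans
    ((eqToIso (by subst h; rfl) : _ ≅ P.homology j).trans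
      (ShortComplex.homologyMapIso (P.isoSc' (j - 1) j (j + 1) (by simp) (by simp)))))

lemma fg_cycles (P : CochainComplex (ModuleCat.{0} R) ℤ)
    (S : DerivedCategory (ModuleCat.{0} R)) (e : Q.obj P ≅ S) (hS : memDqc R S) (j : ℤ) :
    ∃ t : Finset (P.X j), (∀ y ∈ t, (P.d j (j + 1)).hom y = 0) ∧
      ∀ y, (P.d j (j + 1)).hom y = 0 →
        ∃ w, y - (P.d (j - 1) j).hom w ∈ Submodule.span R (t : Set (P.X j)) := by
  have := hS.1 (-j)
  exact sc_fg (P.sc' (j - 1) j (j + 1))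
    (Module.Finite.equiv (HhIso P S e (-j) j (by simp)).toLinearEquiv)

lemma ass_cycle [IsNoetherianRing R] (P : CochainComplex (ModuleCat.{0} R) ℤ)
    (S : DerivedCategory (ModuleCat.{0} R)) (e : Q.obj P ≅ S)
    (p : Ideal R) (hp : p ∈ associatedPrimes R ↥(Hh R 0 S)) :
    ∃ y : P.X 0, (P.d 0 (0 + 1)).hom y = 0 ∧ ∀ (r : R) (w : P.X (0 - 1)),
      r • y = (P.d (0 - 1) 0).hom w → r ∈ p := by
  rw [LinearEquiv.AssociatedPrimes.eq (HhIso P S e 0 0 (by simp)).toLinearEquiv] at hp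
  exact sc_ass (P.sc' (0 - 1) 0 (0 + 1)) p hp

lemma exists_not_ex [IsNoetherianRing R] (P : CochainComplex (ModuleCat.{0} R) ℤ)
    (hP : ∀ i, Module.Flat R (P.X i)) (b : ℤ) (hb : ∀ i, b < i → IsZero (P.X i))
    (S : DerivedCategory (ModuleCat.{0} R)) (e : Q.obj P ≅ S) (hS : memDqc R S)
    (p : Ideal R) (hp : p ∈ associatedPrimes R ↥(Hh R 0 S))
    (q : Ideal R) [q.IsPrime] (hpq : p ≤ q) :
    ∃ j : ℤ, 0 ≤ j ∧ ¬ Ex P (j - 1) j (j + 1) q.ResidueField := by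
  by_contra! hcon
  have hE := ex_down P (Localization.AtPrime q) q hP b hb hcon (fg_cycles P S e hS)
  obtain ⟨y, hy, hann⟩ := ass_cycle P S e p hp
  obtain ⟨w, hw⟩ := hE ((1 : Localization.AtPrime q) ⊗ₜ[R] y)
    (by rw [LinearMap.lTensor_tmul, hy, tmul_zero])
  have I : ∀ n, IsLocalizedModule q.primeCompl
      (TensorProduct.mk R (Localization.AtPrime q) (P.X n) 1) := fun n => inferInstance
  obtain ⟨⟨w', s⟩, h⟩ := (I _).surj w
  have h : s • w = (1 : Localization.AtPrime q) ⊗ₜ[R] w' := h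
  have h2 : TensorProduct.mk R (Localization.AtPrime q) (P.X 0) 1 (s • y) =
      TensorProduct.mk R (Localization.AtPrime q) (P.X 0) 1 ((P.d (0 - 1) 0).hom w') := by
    have := congr((P.d (0 - 1) 0).hom.lTensor (Localization.AtPrime q) $h)
    rw [LinearMap.lTensor_tmul, Submonoid.smul_def, map_smul, hw] at this
    rw [Submonoid.smul_def, map_smul]
    exact this
  obtain ⟨c, hc⟩ := (I 0).exists_of_eq h2
  have h3 : (c * s : R) • y = (P.d (0 - 1) 0).hom ((c : R) • w') := by
    rw [map_smul, mul_smul]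
    exact hc
  exact (c * s).2 (hpq (hann _ _ h3))

lemma single_retract (T : CochainComplex (ModuleCat.{0} R) ℤ) (j : ℤ) (A : ModuleCat.{0} R)
    (φ : A ⟶ T.X j) (ψ : T.X j ⟶ A) (h : φ ≫ ψ = 𝟙 A)
    (hφ : ∀ k, (ComplexShape.up ℤ).Rel j k → φ ≫ T.d j k = 0)
    (hψ : ∀ k, (ComplexShape.up ℤ).Rel k j → T.d k j ≫ ψ = 0) :
    ∃ (a : (HomologicalComplex.single (ModuleCat.{0} R) (ComplexShape.up ℤ) j).obj A ⟶ T)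
      (r : T ⟶ _), a ≫ r = 𝟙 _ := by
  refine ⟨HomologicalComplex.mkHomFromSingle φ hφ, HomologicalComplex.mkHomToSingle ψ hψ,
    HomologicalComplex.from_single_hom_ext ?_⟩
  rw [HomologicalComplex.comp_f, HomologicalComplex.mkHomFromSingle_f,
    HomologicalComplex.mkHomToSingle_f, Category.assoc, reassoc_of% h]
  simp

lemma exists_retract (P : CochainComplex (ModuleCat.{0} R) ℤ)
    (K : Type) [Field K] [Algebra R K] (j : ℤ)
    (h : ¬ Ex P (j - 1) j (j + 1) K) :
    ∃ (a : (HomologicalComplex.single (ModuleCat.{0} R) (ComplexShape.up ℤ) j).obj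
        (ModuleCat.of R K) ⟶ tens K P) (r : tens K P ⟶ _), a ≫ r = 𝟙 _ := by
  unfold Ex at h
  push Not at h
  obtain ⟨z, hz, hzB⟩ := h
  let B : Submodule K (K ⊗[R] P.X j) := LinearMap.range ((P.d (j - 1) j).hom.baseChange K)
  have hzB' : z ∉ B := by
    rintro ⟨y, hy⟩
    exact hzB y hy
  obtain ⟨f, hf, hfB⟩ := Submodule.exists_le_ker_of_notMem hzB'
  let α : K →ₗ[R] (K ⊗[R] P.X j) := ((LinearMap.toSpanSingleton K (K ⊗[R] P.X j) ((f z)⁻¹ • z))).restrictScalars R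
  let β : (K ⊗[R] P.X j) →ₗ[R] K := f.restrictScalars R
  have hβα : β ∘ₗ α = LinearMap.id := by
    ext x
    change f (x • (f z)⁻¹ • z) = x
    rw [map_smul, map_smul, smul_eq_mul, smul_eq_mul, inv_mul_cancel₀ hf, mul_one]
  have hα : ∀ k, (P.d j (j + 1)).hom.lTensor K (α k) = 0 := by
    intro k
    change (P.d j (j + 1)).hom.lTensor K (k • (f z)⁻¹ • z) = 0
    rw [d_smul, d_smul, hz, smul_zero, smul_zero]
  have hβ : ∀ k, β ((P.d (j - 1) j).hom.lTensor K k) = 0 := fun k => hfB ⟨k, rfl⟩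
  exact single_retract (tens K P) j (ModuleCat.of R K) (ModuleCat.ofHom α) (ModuleCat.ofHom β)
    (by
      ext x
      exact congr($hβα x))
    (by
      intro k hk
      have hk : j + 1 = k := hk
      subst hk
      ext x
      exact hα x)
    (by
      intro k hk
      have hk : k + 1 = j := hk
      obtain rfl : k = j - 1 := by lia
      ext x
      exact hβ x)

variable {U : Set (DerivedCategory (ModuleCat.{0} R))}

lemma sdeg_shift (hU : IsCocompletePreaisle R U) (n m : ℤ) (h : m = n + 1) (M : ModuleCat.{0} R)
    (hM : sdeg R n M ∈ U) : sdeg R m M ∈ U :=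
  hU.mem_of_iso (((singleFunctors (ModuleCat.{0} R)).shiftIso 1 (-m) (-n) (by lia)).app M)
    (hU.shift_mem hM)

lemma sdeg_up (hU : IsCocompletePreaisle R U) (n m : ℤ) (h : n ≤ m) (M : ModuleCat.{0} R)
    (hM : sdeg R n M ∈ U) : sdeg R m M ∈ U := by
  obtain ⟨k, rfl⟩ := Int.le.dest h
  clear h
  induction k with
  | zero => simpa using hM
  | succ k ih => exact sdeg_shift hU _ _ (by push_cast; ring) M ih

lemma residue_mem [IsNoetherianRing R] (hU : IsCocompletePreaisle R U)
    (S : DerivedCategory (ModuleCat.{0} R)) (hS : memDqc R S) (hSU : S ∈ U)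
    (p : Ideal R) (hp : p ∈ associatedPrimes R ↥(Hh R 0 S))
    (q : Ideal R) [q.IsPrime] (hpq : p ≤ q) (n : ℤ) (hn : 0 ≤ n) :
    sdeg R n (ModuleCat.of R q.ResidueField) ∈ U := by
  obtain ⟨P, b, hP, hb, ⟨e⟩⟩ := exists_resolution S hS
  obtain ⟨j, hj, hE⟩ := exists_not_ex P hP b hb S e hS p hp q hpq
  obtain ⟨a, r, har⟩ := exists_retract P q.ResidueField j hE
  have h1 := tens_mem hU P (hU.mem_of_iso e.symm hSU) hP b hb q.ResidueField
  have h2 := U_retract hU (Q.map a) (Q.map r) (by rw [← Q.map_comp, har, Q.map_id]) h1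
  have h3 : sdeg R (-j) (ModuleCat.of R q.ResidueField) ∈ U := by
    refine hU.mem_of_iso (((singleFunctorIsoCompQ (ModuleCat.{0} R) (-(-j))).app _).symm) ?_
    rw [neg_neg]
    exact h2
  exact sdeg_up hU _ _ (by lia) _ h3

end hom
end Stmt10


namespace Stmt10
section dev
open DerivedCategory DirectSum
variable {R : Type} [CommRing R] [HasDerivedCategory.{w} (ModuleCat.{0} R)]
variable {U : Set (DerivedCategory (ModuleCat.{0} R))}

/-- stalk complex -/
noncomputable abbrev sg (m : ℤ) (M : Type) [AddCommGroup M] [Module R M] :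
    CochainComplex (ModuleCat.{0} R) ℤ :=
  (HomologicalComplex.single (ModuleCat.{0} R) (ComplexShape.up ℤ) m).obj (ModuleCat.of R M)

lemma sdeg_iff (hU : IsCocompletePreaisle R U) (n : ℤ) (M : Type) [AddCommGroup M] [Module R M] :
    sdeg R n (ModuleCat.of R M) ∈ U ↔ Q.obj (sg (R := R) (-n) M) ∈ U :=
  ⟨fun h => hU.mem_of_iso ((singleFunctorIsoCompQ (ModuleCat.{0} R) (-n)).app _) h,
   fun h => hU.mem_of_iso ((singleFunctorIsoCompQ (ModuleCat.{0} R) (-n)).app _).symm h⟩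

variable {M N L : Type} [AddCommGroup M] [Module R M] [AddCommGroup N] [Module R N]
  [AddCommGroup L] [Module R L]

lemma sg_ses (m : ℤ) (f : M →ₗ[R] N) (g : N →ₗ[R] L) (hf : Function.Injective f)
    (hfg : Function.Exact f g) (hg : Function.Surjective g) :
    ∃ (a : sg (R := R) m M ⟶ sg m N) (b : sg (R := R) m N ⟶ sg m L) (w : a ≫ b = 0),
      (ShortComplex.mk a b w).ShortExact := by
  let T : ShortComplex (ModuleCat.{0} R) := ShortComplex.mk (ModuleCat.ofHom f) (ModuleCat.ofHom g)
    (by rw [← ModuleCat.ofHom_comp, hfg.linearMap_comp_eq_zero]; rfl)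
  have hT : T.ShortExact := ShortComplex.ShortExact.mk'
    ((ShortComplex.ShortExact.moduleCat_exact_iff_function_exact _).2 hfg)
    ((ModuleCat.mono_iff_injective _).2 hf) ((ModuleCat.epi_iff_surjective _).2 hg)
  have := hT.map_of_exact
    (HomologicalComplex.single (ModuleCat.{0} R) (ComplexShape.up ℤ) m)
  exact ⟨_, _, _, this⟩

lemma sg_iso (hU : IsCocompletePreaisle R U) (m : ℤ) (e : M ≃ₗ[R] N)
    (h : Q.obj (sg (R := R) m M) ∈ U) : Q.obj (sg (R := R) m N) ∈ U :=
  hU.mem_of_iso (Q.mapIso ((HomologicalComplex.single (ModuleCat.{0} R)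
    (ComplexShape.up ℤ) m).mapIso e.toModuleIso)) h

lemma sg_sum (hU : IsCocompletePreaisle R U) (m : ℤ) {ι : Type} (Z : ι → ModuleCat.{0} R)
    (h : ∀ i, Q.obj (sg (R := R) m (Z i)) ∈ U) : Q.obj (sg (R := R) m (⨁ i, Z i)) ∈ U := by
  classical
  let F := HomologicalComplex.single (ModuleCat.{0} R) (ComplexShape.up ℤ) m
  have h1 : Q.obj (∐ fun i => F.obj (Z i)) ∈ U :=
    hU.coproduct_mem _ _ (qIsColimit (fun i => F.obj (Z i))) h
  exact hU.mem_of_iso (Q.mapIso ((PreservesCoproduct.iso F Z).symm.trans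
    (F.mapIso (ModuleCat.coprodIsoDirectSum Z)))) h1

/-- modules killed by `q` all of whose elements are killed by something outside `q` -/
def Cq (q : Ideal R) (N : Type) [AddCommGroup N] [Module R N] : Prop :=
  ∀ x : N, (∀ r ∈ q, r • x = 0) ∧ ∃ r, r ∉ q ∧ r • x = 0

lemma fg_mem [IsNoetherianRing R] (hU : IsCocompletePreaisle R U) (m : ℤ) (q : Ideal R)
    (h : ∀ q' : Ideal R, q'.IsPrime → q < q' → Q.obj (sg (R := R) m (R ⧸ q')) ∈ U)
    (N : Type) [AddCommGroup N] [Module R N] (hfin : Module.Finite R N) (hN : Cq q N) :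
    Q.obj (sg (R := R) m N) ∈ U := by
  revert hN
  induction hfin using IsNoetherianRing.induction_on_isQuotientEquivQuotientPrime R with
  | subsingleton N =>
    intro _
    have h0 : IsZero (ModuleCat.of R N) := ModuleCat.isZero_of_subsingleton _
    exact U_zero hU (Functor.map_isZero Q (Functor.map_isZero _ h0))
  | quotient N p e =>
    intro hN
    refine sg_iso hU m e.symm (h p.1 p.2 ?_)
    have key : ∀ r : R, r • e.symm 1 = 0 → r ∈ p.1 := by
      intro r hr
      rw [← map_smul, LinearEquiv.map_eq_zero_iff] at hr
      rw [← Ideal.Quotient.eq_zero_iff_mem, ← hr, Algebra.smul_def, mul_one]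
      rfl
    obtain ⟨h1, r, hr, hr2⟩ := hN (e.symm 1)
    refine lt_of_le_of_ne (fun r hr => key r (h1 r hr)) ?_
    rintro rfl
    exact hr (key r hr2)
  | exact N₁ N₂ N₃ f g hf hg hfg h₁ h₃ =>
    intro hN
    have c1 : Cq q N₁ := by
      intro x
      obtain ⟨a, r, hr, hr2⟩ := hN (f x)
      refine ⟨fun r hr => hf ?_, r, hr, hf ?_⟩
      · rw [map_smul, a r hr, map_zero]
      · rw [map_smul, hr2, map_zero]
    have c3 : Cq q N₃ := by
      intro x
      obtain ⟨x, rfl⟩ := hg x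
      obtain ⟨a, r, hr, hr2⟩ := hN x
      refine ⟨fun r hr => ?_, r, hr, ?_⟩
      · rw [← map_smul, a r hr, map_zero]
      · rw [← map_smul, hr2, map_zero]
    obtain ⟨a, b, w, hw⟩ := sg_ses (R := R) m f g hf hfg hg
    obtain ⟨δ, hδ⟩ := ses_tri a b w hw
    exact hU.ext_mem _ _ _ hδ (h₁ c1) (h₃ c3)

lemma Cq_mem [IsNoetherianRing R] (hU : IsCocompletePreaisle R U) (m : ℤ) (q : Ideal R)
    (hq : q.IsPrime)
    (h : ∀ q' : Ideal R, q'.IsPrime → q < q' → Q.obj (sg (R := R) m (R ⧸ q')) ∈ U)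
    (N : Type) [AddCommGroup N] [Module R N] (hN : Cq q N) :
    Q.obj (sg (R := R) m N) ∈ U := by
  classical
  refine res_mem hU (fun A => ∃ N : ModuleCat.{0} R, Cq q N ∧ A = sg m N) m ?_ ?_ _
    ⟨ModuleCat.of R N, hN, rfl⟩
  · rintro _ ⟨N, _, rfl⟩ k hk
    refine ShortComplex.isZero_homology_of_isZero_X₂ _ ?_
    exact HomologicalComplex.isZero_single_obj_X (ComplexShape.up ℤ) _ _ _ hk.ne'
  · rintro _ ⟨N, hN, rfl⟩
    let Z : N → ModuleCat.{0} R := fun x => ModuleCat.of R (Submodule.span R {x})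
    let g : (⨁ x, Z x) →ₗ[R] N := DirectSum.toModule R N N
      (fun x => (Submodule.span R {x}).subtype)
    have hg : Function.Surjective g := by
      intro x
      refine ⟨DirectSum.lof R N (fun x => Z x) x
        (⟨x, Submodule.mem_span_singleton_self x⟩ : Submodule.span R {x}), ?_⟩
      exact DirectSum.toModule_lof (M := fun x => Z x) R x _
    have hZ : ∀ x, Cq q (Z x) := by
      intro x y
      obtain ⟨a, r, hr, hr2⟩ := hN ((y : Submodule.span R {x}) : N)
      exact ⟨fun r hr => Subtype.ext (a r hr), r, hr, Subtype.ext hr2⟩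
    have hG : Cq q (⨁ x, Z x) := by
      intro y
      induction y using DirectSum.induction_on with
      | zero => exact ⟨fun r _ => smul_zero r, 1, hq.one_notMem, smul_zero _⟩
      | of i y =>
        obtain ⟨a, r, hr, hr2⟩ := hZ i y
        have e : ∀ r : R, r • DirectSum.of (fun x => Z x) i y = DirectSum.lof R N (fun x => Z x) i (r • y) :=
          fun r => ((DirectSum.lof R N (fun x => Z x) i).map_smul r y).symm
        refine ⟨fun r hr => ?_, r, hr, ?_⟩
        · rw [e, a r hr, map_zero]
        · rw [e, hr2, map_zero]
      | add x y hx hy =>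
        obtain ⟨a, r, hr, hr2⟩ := hx
        obtain ⟨a', r', hr', hr2'⟩ := hy
        refine ⟨fun r hr => by rw [smul_add, a r hr, a' r hr, add_zero], r * r',
          fun hh => (hq.mem_or_mem hh).elim hr hr', ?_⟩
        rw [smul_add, mul_smul r r' y, hr2', mul_comm, mul_smul, hr2]
        simp
    have hK : Cq q (LinearMap.ker g) := by
      intro y
      obtain ⟨a, r, hr, hr2⟩ := hG (y : ⨁ x, Z x)
      exact ⟨fun r hr => Subtype.ext (a r hr), r, hr, Subtype.ext hr2⟩
    obtain ⟨a, b, w, hw⟩ := sg_ses (M := LinearMap.ker g) (N := ⨁ x, Z x) (L := N) m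
      (LinearMap.ker g).subtype g
      (Submodule.subtype_injective _) (LinearMap.exact_subtype_ker_map g) hg
    refine ⟨_, _, a, b, w, hw, ⟨ModuleCat.of R (LinearMap.ker g), hK, rfl⟩, sg_sum hU m Z ?_⟩
    intro x
    exact fg_mem hU m q h (Z x) (inferInstanceAs (Module.Finite R (Submodule.span R {x}))) (hZ x)

lemma dim_lt (q q' : Ideal R) (hq : q.IsPrime) (hlt : q < q') (d : ℕ)
    (hd : ringKrullDim (R ⧸ q) ≤ (d : ℕ)) : ringKrullDim (R ⧸ q') + 1 ≤ (d : ℕ) := by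
  obtain ⟨r, hr, hr'⟩ := SetLike.exists_of_lt hlt
  refine le_trans (ringKrullDim_succ_le_of_surjective (Ideal.Quotient.factor hlt.le)
    (Ideal.Quotient.factor_surjective hlt.le) (r := Ideal.Quotient.mk q r) ?_ ?_) hd
  · rw [mem_nonZeroDivisors_iff_ne_zero]
    rwa [Ne, Ideal.Quotient.eq_zero_iff_mem]
  · rw [Ideal.Quotient.factor_mk, Ideal.Quotient.eq_zero_iff_mem]
    exact hr

lemma step [IsNoetherianRing R] (hU : IsCocompletePreaisle R U) (q : Ideal R) [hq : q.IsPrime]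
    (d : ℤ) (hres : sdeg R d (ModuleCat.of R q.ResidueField) ∈ U)
    (h : ∀ q' : Ideal R, q'.IsPrime → q < q' → sdeg R (d - 1) (ModuleCat.of R (R ⧸ q')) ∈ U) :
    sdeg R d (ModuleCat.of R (R ⧸ q)) ∈ U := by
  have hker : LinearMap.ker (Algebra.linearMap R q.ResidueField) = q := by
    ext r
    rw [LinearMap.mem_ker, Algebra.linearMap_apply, ← RingHom.mem_ker,
      Ideal.ker_algebraMap_residueField]
  let f : (R ⧸ q) →ₗ[R] q.ResidueField :=
    Submodule.liftQ q (Algebra.linearMap R q.ResidueField) hker.ge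
  have hf : Function.Injective f := LinearMap.ker_eq_bot.1
    (Submodule.ker_liftQ_eq_bot _ _ _ hker.le)
  have hmk : ∀ a : R, f (Submodule.Quotient.mk a) = algebraMap R q.ResidueField a := fun a => rfl
  let g := (LinearMap.range f).mkQ
  have hg : Function.Surjective g := Submodule.mkQ_surjective _
  have hfg : Function.Exact f g := LinearMap.exact_map_mkQ_range f
  have hN : Cq q (q.ResidueField ⧸ LinearMap.range f) := by
    intro x
    obtain ⟨y, rfl⟩ := Submodule.mkQ_surjective _ x
    refine ⟨fun r hr => ?_, ?_⟩
    · have : algebraMap R q.ResidueField r = 0 := by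
        rw [← RingHom.mem_ker, Ideal.ker_algebraMap_residueField]
        exact hr
      rw [← map_smul, Algebra.smul_def, this, zero_mul, map_zero]
    · obtain ⟨y, rfl⟩ := IsLocalRing.residue_surjective y
      obtain ⟨⟨a, s⟩, hs⟩ := IsLocalization.surj q.primeCompl y
      refine ⟨s, s.2, ?_⟩
      rw [← map_smul, Submodule.mkQ_apply, Submodule.Quotient.mk_eq_zero]
      refine ⟨Submodule.Quotient.mk a, ?_⟩
      rw [hmk, Algebra.smul_def,
        IsScalarTower.algebraMap_apply R (Localization.AtPrime q) q.ResidueField,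
        IsScalarTower.algebraMap_apply R (Localization.AtPrime q) q.ResidueField]
      have := congr(IsLocalRing.residue _ $hs)
      rw [map_mul, mul_comm] at this
      exact this.symm
  have hNU : sdeg R (d - 1) (ModuleCat.of R (q.ResidueField ⧸ LinearMap.range f)) ∈ U :=
    (sdeg_iff hU _ _).2 (Cq_mem hU _ q hq
      (fun q' h1 h2 => (sdeg_iff hU _ _).1 (h q' h1 h2)) _ hN)
  obtain ⟨a, b, w, hw⟩ := sg_ses (R := R) (-d) f g hf hfg hg
  obtain ⟨δ, hδ⟩ := ses_tri a b w hw
  have hinv := inv_rot_of_distTriang _ hδ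
  have hZ : (Q.obj (sg (R := R) (-d) (q.ResidueField ⧸ LinearMap.range f)))⟦(-1 : ℤ)⟧ ∈ U := by
    refine hU.mem_of_iso ?_ hNU
    exact (((singleFunctors (ModuleCat.{0} R)).shiftIso (-1) (-(d - 1)) (-d) (by lia)).app
      (ModuleCat.of R (q.ResidueField ⧸ LinearMap.range f))).symm.trans
      ((shiftFunctor _ (-1 : ℤ)).mapIso ((singleFunctorIsoCompQ (ModuleCat.{0} R) (-d)).app _))
  exact (sdeg_iff hU _ _).2 (hU.ext_mem _ _ _ hinv hZ ((sdeg_iff hU _ _).1 hres))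

lemma main [IsNoetherianRing R] (hU : IsCocompletePreaisle R U) (p : Ideal R)
    (hres : ∀ q : Ideal R, ∀ _ : q.IsPrime, p ≤ q → ∀ n : ℤ, 0 ≤ n →
      sdeg R n (ModuleCat.of R q.ResidueField) ∈ U) (d : ℕ) :
    ∀ q : Ideal R, q.IsPrime → p ≤ q → ringKrullDim (R ⧸ q) ≤ (d : ℕ) →
      sdeg R d (ModuleCat.of R (R ⧸ q)) ∈ U := by
  induction d with
  | zero =>
    intro q hq hpq hd
    refine step hU q _ (hres q hq hpq _ (by simp)) fun q' hq' hlt => ?_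
    have h1 := dim_lt q q' hq hlt 0 hd
    have h2 : 0 ≤ ringKrullDim (R ⧸ q') := ringKrullDim_nonneg_of_nontrivial
    have h3 : (0 : WithBot ℕ∞) + 1 ≤ 0 := le_trans (by gcongr) h1
    exact absurd h3 (by decide)
  | succ d ih =>
    intro q hq hpq hd
    refine step hU q _ (hres q hq hpq _ (by lia)) fun q' hq' hlt => ?_
    have h1 := dim_lt q q' hq hlt (d + 1) hd
    have h2 : ringKrullDim (R ⧸ q') ≤ (d : ℕ) := by
      push_cast at h1
      exact ENat.WithBot.add_le_add_one_right_iff.1 h1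
    have := ih q' hq' (hpq.trans hlt.le) h2
    simpa using this

end dev
end Stmt10



/-- Let `R` be Noetherian of finite Krull dimension `D`, `S ∈ D_qc(R)`,
`p ∈ Ass H_0(S)` and `q` a prime containing `p`, with `d` the Krull dimension of `R/q`.
Then `s^d (R/q)` lies in every cocomplete preaisle of `D(R)` containing `S`; in
particular so does `s^D (R/q)`. -/
theorem stmt10 (R : Type) [CommRing R] [IsNoetherianRing R]
    [HasDerivedCategory.{w} (ModuleCat R)]
    (D : ℕ) (hD : ringKrullDim R = D)
    (S : DerivedCategory (ModuleCat R)) (hS : memDqc R S)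
    (p : Ideal R) (hp : p ∈ associatedPrimes R ↥(Hh R 0 S))
    (q : Ideal R) (hq : q.IsPrime) (hpq : p ≤ q)
    (d : ℕ) (hd : ringKrullDim (R ⧸ q) = d) :
    ∀ U : Set (DerivedCategory (ModuleCat R)), IsCocompletePreaisle R U → S ∈ U →
      sdeg R (d : ℤ) (ModuleCat.of R (R ⧸ q)) ∈ U ∧
        sdeg R (D : ℤ) (ModuleCat.of R (R ⧸ q)) ∈ U := by
  intro U hU hSU
  have hres : ∀ q : Ideal R, ∀ _ : q.IsPrime, p ≤ q → ∀ n : ℤ, 0 ≤ n →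
      sdeg R n (ModuleCat.of R q.ResidueField) ∈ U := fun q _ hpq n hn =>
    Stmt10.residue_mem hU S hS hSU p hp q hpq n hn
  refine ⟨Stmt10.main hU p hres d q hq hpq hd.le, Stmt10.main hU p hres D q hq hpq ?_⟩
  rw [← hD]
  exact ringKrullDim_quotient_le q
end

section
/- Let R be a commutative Noetherian ring of finite Krull dimension, M ∈ D_qc(R), n ∈ ℤ, and let p', p be primes with p' ⊆ p and p' ∈ Ass H_n(M). Then there exists N ∈ D_qc(R) such that: p ∈ Ass H_n(N); N lies in every cocomplete preaisle of D(R) containing M; and for every i ∈ ℤ and every p'' ∈ Ass H_i(N), one has p ⊆ p''. -/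
open CategoryTheory CategoryTheory.Limits CategoryTheory.Pretriangulated

universe w

theorem ass_step.{v} {R : Type} [CommRing R] [IsNoetherianRing R] {H : Type v} [AddCommGroup H]
    [Module R H] [Module.Finite R H] (p' q : Ideal R) (x : R)
    (hass : p' ∈ associatedPrimes R H) (hq : q ∈ (p' ⊔ Ideal.span {x}).minimalPrimes) :
    ∃ k : ℕ, ∀ (K : Type v) [AddCommGroup K] [Module R K] (g : H →ₗ[R] K),
      (∀ h, g h = 0 ↔ ∃ h', x ^ k • h' = h) → q ∈ associatedPrimes R K := by
  obtain ⟨hp', h, hh⟩ := isAssociatedPrime_iff.1 hass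
  obtain ⟨k, hk⟩ := Ideal.exists_pow_inf_eq_pow_smul (Ideal.span {x}) (Submodule.span R {h})
  refine ⟨k + 1, fun K _ _ g hg => ?_⟩
  have hmin : q ∈ ((⊥ : Submodule R K).colon {g h}).minimalPrimes := by
    obtain ⟨⟨hq1, hq2⟩, hq3⟩ := hq
    have hle : (⊥ : Submodule R K).colon {g h} ≤ p' ⊔ Ideal.span {x} := by
      intro r hr
      rw [Submodule.mem_colon_singleton, Submodule.mem_bot, ← map_smul, hg] at hr
      obtain ⟨h', hh'⟩ := hr
      have h1 : r • h ∈ (Ideal.span {x}) ^ (k + 1) • (⊤ : Submodule R H) ⊓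
          Submodule.span R {h} := by
        refine ⟨?_, Submodule.smul_mem _ _ (Submodule.mem_span_singleton_self h)⟩
        rw [← hh']
        exact Submodule.smul_mem_smul
          (Ideal.pow_mem_pow (Ideal.mem_span_singleton_self x) _) trivial
      rw [hk (k + 1) (by omega)] at h1
      have h2 : r • h ∈ Ideal.span {x} • Submodule.span R {h} := by
        simp only [Nat.add_sub_cancel_left, pow_one] at h1
        exact Submodule.smul_mono le_rfl inf_le_right h1
      rw [Submodule.ideal_span_singleton_smul] at h2
      obtain ⟨y, hy, hxy⟩ := (Submodule.mem_smul_pointwise_iff_exists _ _ _).1 h2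
      obtain ⟨s, rfl⟩ := Submodule.mem_span_singleton.1 hy
      have h3 : r - x * s ∈ p' := by
        rw [hh, Submodule.mem_colon_singleton, Submodule.mem_bot, sub_smul, mul_smul, hxy, sub_self]
      have : r = (r - x * s) + x * s := by ring
      rw [this]
      exact Submodule.add_mem_sup h3 (Ideal.mul_mem_right _ _ (Ideal.mem_span_singleton_self x))
    refine ⟨⟨hq1, hle.trans hq2⟩, fun q' ⟨h1, h2⟩ h3 => hq3 ⟨h1, ?_⟩ h3⟩
    refine sup_le (fun r hr => h2 ?_) ?_
    · rw [hh, Submodule.mem_colon_singleton, Submodule.mem_bot] at hr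
      rw [Submodule.mem_colon_singleton, Submodule.mem_bot, ← map_smul, hr, map_zero]
    · rw [Ideal.span_singleton_le_iff_mem]
      refine h1.mem_of_pow_mem (k + 1) (h2 ?_)
      rw [Submodule.mem_colon_singleton, Submodule.mem_bot, ← map_smul, hg]
      exact ⟨h, rfl⟩
  obtain ⟨y, hy⟩ := Submodule.exists_eq_colon_of_mem_minimalPrimes hmin
  exact isAssociatedPrime_iff.2 ⟨hmin.1.1, y, hy⟩

theorem exists_mulmap.{v} (R : Type) [CommRing R] [HasDerivedCategory.{w} (ModuleCat.{v} R)]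
    (M : DerivedCategory (ModuleCat.{v} R)) (a : R) :
    ∃ f : M ⟶ M, ∀ i : ℤ, (DerivedCategory.homologyFunctor (ModuleCat.{v} R) i).map f = a • 𝟙 _ := by
  let K := DerivedCategory.Q.objPreimage M
  let e : DerivedCategory.Q.obj K ≅ M := DerivedCategory.Q.objObjPreimageIso M
  refine ⟨e.inv ≫ DerivedCategory.Q.map (a • 𝟙 K) ≫ e.hom, fun i => ?_⟩
  have h1 : HomologicalComplex.homologyMap (a • 𝟙 K) i = a • 𝟙 _ := by
    have := ShortComplex.homologyMap_smul
      (φ := 𝟙 (((HomologicalComplex.shortComplexFunctor (ModuleCat.{v} R) (ComplexShape.up ℤ) i)).obj K)) a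
    rw [ShortComplex.homologyMap_id] at this
    exact this
  let φ : (DerivedCategory.homologyFunctor (ModuleCat.{v} R) i).obj (DerivedCategory.Q.obj K) ≅
    HomologicalComplex.homology K i := (DerivedCategory.homologyFunctorFactors _ i).app K
  have h2 : (DerivedCategory.homologyFunctor (ModuleCat.{v} R) i).map
      (DerivedCategory.Q.map (a • 𝟙 K)) ≫ φ.hom =
      φ.hom ≫ HomologicalComplex.homologyMap (a • 𝟙 K) i :=
    DerivedCategory.homologyFunctorFactors_hom_naturality (a • 𝟙 K) i
  rw [h1, Linear.comp_smul, Category.comp_id, ← Iso.eq_comp_inv, Linear.smul_comp,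
    Iso.hom_inv_id] at h2
  rw [Functor.map_comp, Functor.map_comp, h2, Linear.smul_comp, Linear.comp_smul, Category.id_comp,
    ← Functor.map_comp, Iso.inv_hom_id, CategoryTheory.Functor.map_id]

theorem cone_step.{v} (R : Type) [CommRing R] [HasDerivedCategory.{w} (ModuleCat.{v} R)]
    (M : DerivedCategory (ModuleCat.{v} R)) (a : R) :
    ∃ N : DerivedCategory (ModuleCat.{v} R),
      (∀ S, IsCocompletePreaisle R S → M ∈ S → N ∈ S) ∧
      ∀ i : ℤ, ∃ (g : Hh R i M →ₗ[R] Hh R i N) (d : Hh R i N →ₗ[R] Hh R (i - 1) M),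
        (∀ h, g h = 0 ↔ ∃ h', a • h' = h) ∧ (∀ y, d y = 0 ↔ ∃ h, g h = y) ∧
        (∀ y, a • d y = 0) := by
  obtain ⟨f, hf⟩ := exists_mulmap R M a
  obtain ⟨N, g, h, hT⟩ := distinguished_cocone_triangle f
  refine ⟨N, fun S hS hM => hS.ext_mem _ _ _ (rot_of_distTriang _ hT) hM (hS.shift_mem hM),
    fun i => ?_⟩
  have e : -i + 1 = -(i - 1) := by ring
  have h2 := DerivedCategory.HomologySequence.exact₂ _ hT (-i)
  have h3 := DerivedCategory.HomologySequence.exact₃ _ hT (-i) (-(i-1)) e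
  have h4 := DerivedCategory.HomologySequence.δ_comp _ hT (-i) (-(i-1)) e
  rw [ShortComplex.ShortExact.moduleCat_exact_iff_function_exact] at h2 h3
  refine ⟨((DerivedCategory.homologyFunctor (ModuleCat.{v} R) (-i)).map g).hom,
    (DerivedCategory.HomologySequence.δ (Triangle.mk f g h) (-i) (-(i-1)) e).hom, ?_, ?_, ?_⟩
  · intro y
    refine (h2 y).trans ?_
    refine exists_congr fun z => ?_
    have := congrArg (fun t => t.hom z) (hf (-i))
    exact (Eq.congr_left this.symm).symm
  · intro y
    exact h3 y
  · intro y
    have h5 := congrArg (fun t => t.hom y) h4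
    have := congrArg (fun t => t.hom
      ((DerivedCategory.HomologySequence.δ (Triangle.mk f g h) (-i) (-(i-1)) e).hom y))
      (hf (-(i-1)))
    exact this.symm.trans h5

theorem kos_step.{v} (R : Type) [CommRing R] [IsNoetherianRing R]
    [HasDerivedCategory.{w} (ModuleCat.{v} R)]
    (M : DerivedCategory (ModuleCat.{v} R)) (hM : memDqc R M) (n : ℤ) (p' p : Ideal R)
    (hp : p.IsPrime) (hpp : p' ≤ p)
    (hass : p' ∈ associatedPrimes R ↥(Hh R n M)) (x : R) (hx : x ∈ p) :
    ∃ N : DerivedCategory (ModuleCat.{v} R), ∃ q : Ideal R, memDqc R N ∧ p' ≤ q ∧ q ≤ p ∧ x ∈ q ∧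
      q ∈ associatedPrimes R ↥(Hh R n N) ∧
      (∀ S, IsCocompletePreaisle R S → M ∈ S → N ∈ S) ∧
      (∀ i, ∃ k : ℕ, ∀ y : Hh R i N, x ^ k • y = 0) ∧
      (∀ z : R, (∀ i, ∃ k : ℕ, ∀ y : Hh R i M, z ^ k • y = 0) →
        (∀ i, ∃ k : ℕ, ∀ y : Hh R i N, z ^ k • y = 0)) := by
  have := hM.1 n
  obtain ⟨q, hq, hqp⟩ := Ideal.exists_minimalPrimes_le (I := p' ⊔ Ideal.span {x}) (J := p)
    (sup_le hpp ((Ideal.span_singleton_le_iff_mem _).2 hx))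
  obtain ⟨k, hk⟩ := ass_step p' q x hass hq
  obtain ⟨N, hN, hN'⟩ := cone_step R M (x ^ k)
  refine ⟨N, q, ⟨fun i => ?_, ?_⟩, le_sup_left.trans hq.1.2, hqp,
    hq.1.2 (le_sup_right (a := p') (Ideal.mem_span_singleton_self x)), ?_, hN, fun i => ?_,
    fun z hz i => ?_⟩
  · obtain ⟨g, d, h1, h2, h3⟩ := hN' i
    have := hM.1 i
    have := hM.1 (i - 1)
    have : IsNoetherian R (Hh R i N) :=
      isNoetherian_of_range_eq_ker g d (by ext y; simp [h2])
    infer_instance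
  · refine (hM.2.union (hM.2.image (fun i => i + 1))).subset fun i hi => ?_
    by_contra hc
    simp only [Set.mem_union, Set.mem_image, Set.mem_setOf_eq, not_or, not_exists, not_and,
      not_not] at hc hi
    obtain ⟨c1, c2⟩ := hc
    have c3 : IsZero (Hh R (i - 1) M) := by
      by_contra h
      exact c2 (i - 1) h (by ring)
    obtain ⟨g, d, h1, h2, h3⟩ := hN' i
    have := ModuleCat.subsingleton_of_isZero c1
    have := ModuleCat.subsingleton_of_isZero c3
    apply hi
    have : Subsingleton (Hh R i N) := by
      refine subsingleton_of_forall_eq 0 fun y => ?_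
      obtain ⟨h, rfl⟩ := (h2 y).1 (Subsingleton.elim _ _)
      rw [Subsingleton.elim h 0, map_zero]
    exact ModuleCat.isZero_of_subsingleton _
  · obtain ⟨g, d, h1, h2, h3⟩ := hN' n
    exact hk _ g h1
  · obtain ⟨g, d, h1, h2, h3⟩ := hN' i
    refine ⟨k + k, fun y => ?_⟩
    obtain ⟨h, hh⟩ := (h2 (x ^ k • y)).1 (by rw [map_smul, h3])
    rw [pow_add, mul_smul, ← hh, ← map_smul]
    exact (h1 _).2 ⟨_, rfl⟩
  · obtain ⟨g, d, h1, h2, h3⟩ := hN' i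
    obtain ⟨k1, hk1⟩ := hz i
    obtain ⟨k2, hk2⟩ := hz (i - 1)
    refine ⟨k1 + k2, fun y => ?_⟩
    obtain ⟨h, hh⟩ := (h2 (z ^ k2 • y)).1 (by rw [map_smul, hk2])
    rw [pow_add, mul_smul, ← hh, ← map_smul, hk1, map_zero]

theorem kos_list.{v} (R : Type) [CommRing R] [IsNoetherianRing R]
    [HasDerivedCategory.{w} (ModuleCat.{v} R)]
    (M : DerivedCategory (ModuleCat.{v} R)) (hM : memDqc R M) (n : ℤ) (p' p : Ideal R)
    (hp : p.IsPrime) (hpp : p' ≤ p)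
    (hass : p' ∈ associatedPrimes R ↥(Hh R n M)) (l : List R) (hl : ∀ x ∈ l, x ∈ p) :
    ∃ N : DerivedCategory (ModuleCat.{v} R), ∃ q : Ideal R, memDqc R N ∧ q ≤ p ∧
      (∀ x ∈ l, x ∈ q) ∧
      q ∈ associatedPrimes R ↥(Hh R n N) ∧
      (∀ S, IsCocompletePreaisle R S → M ∈ S → N ∈ S) ∧
      (∀ x ∈ l, ∀ i, ∃ k : ℕ, ∀ y : Hh R i N, x ^ k • y = 0) := by
  induction l with
  | nil => exact ⟨M, p', hM, hpp, by simp, hass, fun S _ h => h, fun _ h => absurd h List.not_mem_nil⟩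
  | cons x l ih =>
    obtain ⟨N, q, a1, a2, a3, a4, a5, a6⟩ := ih fun y hy => hl y (List.mem_cons_of_mem _ hy)
    obtain ⟨N', q', b1, b2, b3, b4, b5, b6, b7, b8⟩ := kos_step R N a1 n q p hp a2 a4 x
      (hl x List.mem_cons_self)
    refine ⟨N', q', b1, b3, ?_, b5, fun S hS h => b6 S hS (a5 S hS h), ?_⟩
    · intro y hy
      rcases List.mem_cons.1 hy with rfl | hy
      · exact b4
      · exact b2 (a3 y hy)
    · intro y hy
      rcases List.mem_cons.1 hy with rfl | hy
      · exact b7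
      · exact b8 y (a6 y hy)

/-- Let `R` be Noetherian of finite Krull dimension, `M ∈ D_qc(R)`,
`n : ℤ`, and let `p' ⊆ p` be primes with `p' ∈ Ass H_n(M)`. Then there is `N ∈ D_qc(R)`
with `p ∈ Ass H_n(N)`, such that `N` lies in every cocomplete preaisle of `D(R)`
containing `M`, and every associated prime of every `H_i(N)` contains `p`. -/
theorem stmt11 (R : Type) [CommRing R] [IsNoetherianRing R]
    [HasDerivedCategory.{w} (ModuleCat R)]
    (D : ℕ) (hD : ringKrullDim R = D)
    (M : DerivedCategory (ModuleCat R)) (hM : memDqc R M)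
    (n : ℤ) (p' p : Ideal R) (hp' : p'.IsPrime) (hp : p.IsPrime) (hpp : p' ≤ p)
    (hass : p' ∈ associatedPrimes R ↥(Hh R n M)) :
    ∃ N : DerivedCategory (ModuleCat R), memDqc R N ∧
      p ∈ associatedPrimes R ↥(Hh R n N) ∧
      (∀ S : Set (DerivedCategory (ModuleCat R)), IsCocompletePreaisle R S → M ∈ S → N ∈ S) ∧
      (∀ i : ℤ, ∀ p'' ∈ associatedPrimes R ↥(Hh R i N), p ≤ p'') := by
  obtain ⟨s, hs⟩ := (isNoetherianRing_iff_ideal_fg R).1 inferInstance p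
  obtain ⟨N, q, a1, a2, a3, a4, a5, a6⟩ := kos_list R M hM n p' p hp hpp hass s.toList
    (fun x hx => by rw [← hs]; exact Ideal.subset_span (by simpa using hx))
  have hq : q = p := by
    refine le_antisymm a2 ?_
    rw [← hs, Ideal.span_le]
    exact fun x hx => a3 x (by simpa using hx)
  subst hq
  refine ⟨N, a1, a4, a5, fun i p'' hp'' => ?_⟩
  rw [← hs, Ideal.span_le]
  intro x hx
  obtain ⟨k, hk⟩ := a6 x (by simpa using hx) i
  obtain ⟨h1, y, hy⟩ := isAssociatedPrime_iff.1 hp''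
  refine h1.mem_of_pow_mem k ?_
  rw [hy, Submodule.mem_colon_singleton, Submodule.mem_bot, hk]
end
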